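/- arXiv:1608.05409 — 6 statements merged into one kernel-verified Lean document; each statement's English description precedes it below -/
import Mathlib

section
/- Let I = (γ, ∞) with γ ∈ ℝ ∪ {−∞}, and let f : I → ℝ be continuously differentiable with f'(x) > 0 for all x ∈ I, f' strictly monotone increasing on I, and log ∘ f' concave on I. Let A be a unital C*-algebra and let a ∈ A be self-adjoint with spectrum σ(a) ⊆ I. Then a is central (i.e., ab = ba for all b ∈ A) if and only if f is locally monotone at a, i.e., for every self-adjoint b ∈ A with σ(b) ⊆ I, a ≤ b implies f(a) ≤ f(b). -/
open Filter Topology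

open scoped ComplexOrder in
theorem cim_forward {A : Type*} [CStarAlgebra A] [PartialOrder A] [StarOrderedRing A]
    (I : Set ℝ) (f : ℝ → ℝ) (hf : ContinuousOn f I) (hm : MonotoneOn f I)
    (a b : A) (ha : IsSelfAdjoint a) (hb : IsSelfAdjoint b)
    (hsa : spectrum ℝ a ⊆ I) (hsb : spectrum ℝ b ⊆ I) (hc : a * b = b * a) (hab : a ≤ b) :
    cfc f a ≤ cfc f b := by
  set x : A := a + Complex.I • b with hx
  have hre : (realPart x : A) = a := by
    simp [hx, ha.coe_realPart, hb.imaginaryPart]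
  have him : (imaginaryPart x : A) = b := by
    simp [hx, ha.imaginaryPart, hb.coe_realPart]
  have hn : IsStarNormal x := by
    refine ⟨?_⟩
    show star x * x = x * star x
    simp only [hx, star_add, star_smul, ha.star_eq, hb.star_eq, add_mul, mul_add, smul_mul_assoc, mul_smul_comm, hc]
    simp
  have e1 := cfc_comp_re f x (by rw [hre]; exact hf.mono hsa) hn
  have e2 := cfc_comp_im f x (by rw [him]; exact hf.mono hsb) hn
  have s1 := spectrum_realPart' x hn
  have s2 := spectrum_imaginaryPart' x hn
  rw [hre] at e1 s1
  rw [him] at e2 s2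
  rw [← e1, ← e2]
  have c1 : ContinuousOn (fun z : ℂ => ((f z.re : ℝ) : ℂ)) (spectrum ℂ x) := by
    refine Complex.continuous_ofReal.comp_continuousOn ((hf.mono hsa).comp Complex.continuous_re.continuousOn ?_)
    intro z hz; rw [s1]; exact ⟨z, hz, rfl⟩
  have c2 : ContinuousOn (fun z : ℂ => ((f z.im : ℝ) : ℂ)) (spectrum ℂ x) := by
    refine Complex.continuous_ofReal.comp_continuousOn ((hf.mono hsb).comp Complex.continuous_im.continuousOn ?_)
    intro z hz; rw [s2]; exact ⟨z, hz, rfl⟩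
  rw [cfc_le_iff _ _ x c1 c2 hn]
  have key : ∀ z ∈ spectrum ℂ x, (z.re : ℂ) ≤ z.im := by
    rw [← cfc_le_iff (fun z : ℂ => (z.re : ℂ)) (fun z : ℂ => (z.im:ℂ)) x (by fun_prop) (by fun_prop) hn]
    rw [cfc_re_id x hn, cfc_im_id x hn, hre, him]; exact hab
  intro z hz
  have := key z hz
  rw [Complex.real_le_real] at this ⊢
  exact hm (hsa (by rw [s1]; exact ⟨z, hz, rfl⟩)) (hsb (by rw [s2]; exact ⟨z, hz, rfl⟩)) this

/-- separated elements: `p A m = 0`. -/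
theorem cim_comm_norm {A : Type*} [CStarAlgebra A] (p m b : A) (hp : IsSelfAdjoint p)
    (hm : IsSelfAdjoint m) (h : ∀ c, p * c * m = 0) :
    ‖(p - m) * b - b * (p - m)‖ ≤ max ‖p * b - b * p‖ ‖m * b - b * m‖ := by
  have h' : ∀ c, m * c * p = 0 := fun c => by
    have := congrArg star (h (star c))
    simpa [hp.star_eq, hm.star_eq, mul_assoc] using this
  have h1 : p * m = 0 := by simpa using h 1
  have h2 : m * p = 0 := by simpa using h' 1
  set X := p * b - b * p with hX
  set Y := m * b - b * m with hY
  have e : (p - m) * b - b * (p - m) = X - Y := by rw [hX, hY]; noncomm_ring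
  have xy : star X * Y = 0 := by
    simp only [hX, hY, star_sub, star_mul, hp.star_eq]
    have : (star b * p - p * star b) * (m * b - b * m) = star b * (p * m) * b - star b * (p * b * m)
      - (p * star b * m) * b + p * (star b * b) * m := by noncomm_ring
    rw [this]; simp [h1, h]
  have xy' : X * star Y = 0 := by
    simp only [hX, hY, star_sub, star_mul, hm.star_eq]
    have : (p * b - b * p) * (star b * m - m * star b) = p * (b * star b) * m - (p * b * m) * star b
      - b * (p * star b * m) + b * (p * m) * star b := by noncomm_ring
    rw [this]; simp [h1, h]
  have yx : star Y * X = 0 := by simpa using congrArg star xy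
  have s : star (X - Y) * (X - Y) = star X * X + star Y * Y := by
    rw [star_sub]
    have : (star X - star Y) * (X - Y) = star X * X - star X * Y - star Y * X + star Y * Y := by noncomm_ring
    rw [this, xy, yx]; simp
  have n := IsSelfAdjoint.norm_add_eq_max (IsSelfAdjoint.star_mul_self X) (IsSelfAdjoint.star_mul_self Y)
    (by rw [mul_assoc, ← mul_assoc X, xy']; simp)
  rw [← s, CStarRing.norm_star_mul_self, CStarRing.norm_star_mul_self, CStarRing.norm_star_mul_self] at n
  rw [e]
  by_contra hlt
  push Not at hlt
  have hx := (le_max_left ‖X‖ ‖Y‖).trans_lt hlt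
  have hy := (le_max_right ‖X‖ ‖Y‖).trans_lt hlt
  have := max_lt (mul_self_lt_mul_self (norm_nonneg X) hx) (mul_self_lt_mul_self (norm_nonneg Y) hy)
  linarith

theorem cim_central_of_sep {A : Type*} [CStarAlgebra A] (a : A) (ha : IsSelfAdjoint a)
    (H : ∀ (t t' : ℝ), t < t' → ∀ g k : ℝ → ℝ, Continuous g → Continuous k →
      (∀ s, s ≤ t' → g s = 0) → (∀ s, t ≤ s → k s = 0) → ∀ b : A, cfc g a * b * cfc k a = 0) :
    ∀ b : A, a * b = b * a := by
  intro b
  -- separated version at the same threshold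
  have H2 : ∀ (t : ℝ) (g k : ℝ → ℝ), Continuous g → Continuous k →
      (∀ s, g s ≤ max (s - t) 0) → (∀ s, 0 ≤ g s) → (∀ s, t ≤ s → k s = 0) →
      ∀ c : A, cfc g a * c * cfc k a = 0 := by
    intro t g k hg hk h1 h0 h2 c
    have : ∀ ε > 0, ‖cfc g a * c * cfc k a‖ ≤ ε * (‖c‖ * ‖cfc k a‖) := by
      intro ε hε
      have hz := H t (t + ε) (by linarith) (fun s => max (g s - ε) 0) k (by fun_prop) hk
        (fun s hs => by
          have := h1 s
          refine max_eq_right ?_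
          have : max (s - t) 0 ≤ ε := max_le (by linarith) hε.le
          linarith) h2 c
      have e : cfc g a * c * cfc k a = cfc (fun s => g s - max (g s - ε) 0) a * c * cfc k a := by
        rw [cfc_sub (fun s => g s) (fun s => max (g s - ε) 0) a, sub_mul, sub_mul, hz, sub_zero]
      rw [e, mul_assoc]
      refine (norm_mul_le _ _).trans (mul_le_mul ?_ (norm_mul_le _ _) (norm_nonneg _) hε.le)
      refine norm_cfc_le hε.le fun s _ => ?_
      rw [Real.norm_eq_abs, abs_le]
      have := h0 s
      rcases le_total (g s - ε) 0 with h | h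
      · rw [max_eq_right h]; constructor <;> linarith
      · rw [max_eq_left h]; constructor <;> linarith
    have h0 : ‖cfc g a * c * cfc k a‖ ≤ 0 := by
      refine le_of_forall_pos_le_add fun ε hε => ?_
      have hC : 0 ≤ ‖c‖ * ‖cfc k a‖ := by positivity
      refine (this (ε / (‖c‖ * ‖cfc k a‖ + 1)) (by positivity)).trans ?_
      rw [div_mul_eq_mul_div, zero_add, div_le_iff₀ (by positivity)]
      nlinarith
    simpa using h0
  have key : ∀ δ > 0, ∀ l : ℝ, ∀ n : ℕ,
      ‖cfc (fun s => min (max (s - l) 0) (n * δ)) a * b - b * cfc (fun s => min (max (s - l) 0) (n * δ)) a‖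
        ≤ 2 * δ * ‖b‖ := by
    intro δ hδ l n
    induction n with
    | zero =>
      have : cfc (fun s : ℝ => min (max (s - l) 0) (((0:ℕ):ℝ) * δ)) a = 0 := by
        rw [← cfc_zero ℝ a]
        refine cfc_congr fun s _ => ?_
        simp
      rw [this]; simp; positivity
    | succ n ih =>
      set p := cfc (fun s => min (max (s - (l + n * δ)) 0) δ) a with hp
      set m := cfc (fun s => n * δ - min (max (s - l) 0) (n * δ)) a with hm
      have hnd : 0 ≤ n * δ := by positivity
      have hm' : m = algebraMap ℝ A (n * δ) - cfc (fun s => min (max (s - l) 0) (n * δ)) a := by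
        rw [hm, cfc_sub (fun _ => n * δ) (fun s => min (max (s - l) 0) (n * δ)) a, cfc_const _ a]
      have hs : cfc (fun s => min (max (s - l) 0) ((n + 1 : ℕ) * δ)) a = (p - m) + algebraMap ℝ A (n * δ) := by
        rw [hm', hp]
        rw [show ∀ u v w : A, u - (v - w) + v = u + w from fun u v w => by abel, ← cfc_add a (fun s => min (max (s - (l + n * δ)) 0) δ) (fun s => min (max (s - l) 0) (n * δ))]
        refine cfc_congr fun s _ => ?_
        push_cast
        simp only [min_def, max_def]
        split_ifs <;> nlinarith
      have hc := Algebra.commutes (A := A) (n * δ) b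
      have h1 := cim_comm_norm p m b IsSelfAdjoint.cfc IsSelfAdjoint.cfc ?_
      · rw [hs, add_mul, mul_add, hc, add_sub_add_right_eq_sub]
        refine h1.trans (max_le ?_ ?_)
        · have hpn : ‖p‖ ≤ δ := by
            refine norm_cfc_le hδ.le fun s _ => ?_
            rw [Real.norm_eq_abs, abs_of_nonneg (le_min (le_max_right _ _) hδ.le)]
            exact min_le_right _ _
          calc ‖p * b - b * p‖ ≤ ‖p * b‖ + ‖b * p‖ := norm_sub_le _ _
            _ ≤ ‖p‖ * ‖b‖ + ‖b‖ * ‖p‖ := add_le_add (norm_mul_le _ _) (norm_mul_le _ _)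
            _ ≤ _ := by nlinarith [norm_nonneg b]
        · rw [hm', sub_mul, mul_sub, hc, sub_sub_sub_cancel_left, norm_sub_rev]
          exact ih
      · refine H2 (l + n * δ) _ _ (by fun_prop) (by fun_prop) (fun s => min_le_left _ _)
          (fun s => le_min (le_max_right _ _) hδ.le) (fun s hs => ?_)
        rw [min_eq_right (le_max_of_le_left (by linarith)), sub_self]
  have fin : ∀ δ > 0, ‖a * b - b * a‖ ≤ 2 * δ * ‖b‖ := by
    intro δ hδ
    obtain ⟨n, hn⟩ := exists_nat_gt (2 * ‖a‖ / δ)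
    rw [div_lt_iff₀ hδ] at hn
    have e : cfc (fun s => min (max (s - (-‖a‖)) 0) (n * δ)) a = a + algebraMap ℝ A ‖a‖ := by
      have e1 := cfc_add a (fun s : ℝ => s) (fun _ => ‖a‖)
      rw [cfc_id' ℝ a, cfc_const ‖a‖ a ha] at e1
      rw [← e1]
      refine cfc_congr fun s hs => ?_
      have : |s| ≤ ‖a‖ := IsometricContinuousFunctionalCalculus.norm_spectrum_le (𝕜 := ℝ) a hs ha
      rw [abs_le] at this
      show min (max (s - -‖a‖) 0) (n * δ) = s + ‖a‖
      rw [max_eq_left (by linarith), min_eq_left (by linarith)]; ring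
    have := key δ hδ (-‖a‖) n
    rwa [e, add_mul, mul_add, Algebra.commutes (A := A) ‖a‖ b, add_sub_add_right_eq_sub] at this
  have h0 : ‖a * b - b * a‖ ≤ 0 := by
    refine le_of_forall_pos_le_add fun ε hε => ?_
    refine (fin (ε / (2 * (‖b‖ + 1))) (by positivity)).trans ?_
    rw [zero_add]
    have : 2 * (ε / (2 * (‖b‖ + 1))) * ‖b‖ = ε * (‖b‖ / (‖b‖ + 1)) := by field_simp
    rw [this]
    have : ‖b‖ / (‖b‖ + 1) ≤ 1 := by rw [div_le_one (by positivity)]; linarith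
    nlinarith
  exact sub_eq_zero.mp (norm_le_zero_iff.mp h0)

theorem cim_loc {A : Type*} [CStarAlgebra A] (a : A) (ha : IsSelfAdjoint a)
    (g : ℝ → ℝ) (hg : Continuous g) (z : A) (hz : cfc g a * z ≠ 0) (δ : ℝ) (hδ : 0 < δ) :
    ∃ x ∈ spectrum ℝ a, g x ≠ 0 ∧ ∃ φ : ℝ → ℝ, Continuous φ ∧ cfc φ a * (cfc g a * z) ≠ 0 ∧
      ∀ c : A, ‖a * (cfc φ a * c) - x • (cfc φ a * c)‖ ≤ δ * ‖cfc φ a * c‖ := by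
  set η := δ / 2 with hη
  have hη0 : 0 < η := by positivity
  set r : ℝ → ℝ := fun s => min (max (s / η) 0) 1 with hr
  have hrc : Continuous r := by fun_prop
  set l := -‖a‖ - η with hl
  set F : ℕ → ℝ → ℝ := fun k s => r (s - l - k * η) with hF
  have hFc : ∀ k, Continuous (F k) := fun k => by simp only [hF]; fun_prop
  obtain ⟨n, hn⟩ := exists_nat_gt ((2 * ‖a‖ + η) / η)
  rw [div_lt_iff₀ hη0] at hn
  have hsum : ∑ k ∈ Finset.range n, cfc (fun s => F k s - F (k + 1) s) a = 1 := by
    have : ∀ k ∈ Finset.range n, cfc (fun s => F k s - F (k + 1) s) a = cfc (F k) a - cfc (F (k+1)) a :=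
      fun k _ => cfc_sub (F k) (F (k+1)) a (hFc k).continuousOn (hFc _).continuousOn
    rw [Finset.sum_congr rfl this, Finset.sum_range_sub', ← cfc_sub (F 0) (F n) a (hFc _).continuousOn (hFc _).continuousOn, ← cfc_one ℝ a]
    refine cfc_congr fun s hs => ?_
    have : |s| ≤ ‖a‖ := IsometricContinuousFunctionalCalculus.norm_spectrum_le (𝕜 := ℝ) a hs ha
    rw [abs_le] at this
    have h1 : F 0 s = 1 := by
      simp only [hF, hr]
      refine min_eq_right (le_max_of_le_left ?_)
      rw [le_div_iff₀ hη0]; simp; linarith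
    have h2 : F n s = 0 := by
      simp only [hF, hr]
      rw [max_eq_right (div_nonpos_of_nonpos_of_nonneg (by linarith) hη0.le)]; simp
    simp [h1, h2]
  have : ∃ k ∈ Finset.range n, cfc (fun s => F k s - F (k + 1) s) a * (cfc g a * z) ≠ 0 := by
    by_contra hcon
    push Not at hcon
    apply hz
    rw [← one_mul (cfc g a * z), ← hsum, Finset.sum_mul]
    exact Finset.sum_eq_zero hcon
  obtain ⟨k, -, hk⟩ := this
  set φ : ℝ → ℝ := fun s => F k s - F (k + 1) s with hφ
  have hφc : Continuous φ := by simp only [hφ]; exact (hFc _).sub (hFc _)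
  have hsupp : ∀ s, φ s ≠ 0 → |s - (l + (k + 1) * η)| ≤ η := by
    intro s hs
    by_contra hcon
    apply hs
    rw [not_le, lt_abs] at hcon
    simp only [hφ, hF, hr]
    push_cast
    rcases hcon with h | h
    · rw [min_eq_right (le_max_of_le_left _), min_eq_right (le_max_of_le_left _), sub_self]
      · rw [le_div_iff₀ hη0]; linarith
      · rw [le_div_iff₀ hη0]; linarith
    · rw [max_eq_right (div_nonpos_of_nonpos_of_nonneg (by linarith) hη0.le), max_eq_right (div_nonpos_of_nonpos_of_nonneg (by linarith) hη0.le), sub_self]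
  have hx : ∃ x ∈ spectrum ℝ a, φ x * g x ≠ 0 := by
    by_contra hcon
    push Not at hcon
    apply hk
    rw [← mul_assoc, ← cfc_mul φ g a hφc.continuousOn hg.continuousOn, cfc_congr (g := fun _ => 0) hcon]
    simp
  obtain ⟨x, hxs, hx⟩ := hx
  refine ⟨x, hxs, right_ne_zero_of_mul hx, φ, hφc, hk, fun c => ?_⟩
  have hx' := hsupp x (left_ne_zero_of_mul hx)
  set ψ : ℝ → ℝ := fun s => max (-δ) (min (s - x) δ) with hψ
  have hψc : Continuous ψ := by simp only [hψ]; fun_prop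
  have e : a * cfc φ a - x • cfc φ a = cfc ψ a * cfc φ a := by
    rw [← cfc_mul ψ φ a hψc.continuousOn hφc.continuousOn]
    have e1 := cfc_mul (fun s : ℝ => s - x) φ a (by fun_prop) hφc.continuousOn
    rw [cfc_sub (fun s : ℝ => s) (fun _ => x) a, cfc_id' ℝ a, cfc_const x a, sub_mul, ← Algebra.smul_def] at e1
    rw [← e1]
    refine cfc_congr fun s _ => ?_
    by_cases h : φ s = 0
    · simp [h]
    · have h1 := hsupp s h
      rw [abs_le] at h1 hx'
      simp only [hψ]
      rw [min_eq_left (by linarith), max_eq_right (by linarith)]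
  rw [← mul_assoc, ← smul_mul_assoc, ← sub_mul, e, mul_assoc]
  refine (norm_mul_le _ _).trans (mul_le_mul_of_nonneg_right ?_ (norm_nonneg _))
  refine norm_cfc_le hδ.le fun s _ => ?_
  rw [Real.norm_eq_abs, abs_le]
  exact ⟨le_max_left _ _, max_le (by linarith) (min_le_right _ _)⟩

/-- sequences of approximate eigenvectors -/
theorem cim_seq {A : Type*} [CStarAlgebra A] (a : A) (ha : IsSelfAdjoint a)
    (t t' : ℝ) (htt : t < t') (g k : ℝ → ℝ) (hg : Continuous g) (hk : Continuous k)
    (hg0 : ∀ s, s ≤ t' → g s = 0) (hk0 : ∀ s, t ≤ s → k s = 0) (b : A)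
    (hne : cfc g a * b * cfc k a ≠ 0) :
    ∃ x ∈ spectrum ℝ a, ∃ y ∈ spectrum ℝ a, y < x ∧ ∃ Z : ℕ → A, (∀ n, ‖Z n‖ = 1) ∧
      Tendsto (fun n => a * Z n - x • Z n) atTop (𝓝 0) ∧
      Tendsto (fun n => Z n * a - y • Z n) atTop (𝓝 0) := by
  have step : ∀ n : ℕ, ∃ x ∈ spectrum ℝ a, ∃ y ∈ spectrum ℝ a, t' ≤ x ∧ y ≤ t ∧ ∃ Z : A, ‖Z‖ = 1 ∧
      ‖a * Z - x • Z‖ ≤ 1 / ((n:ℝ) + 1) ∧ ‖Z * a - y • Z‖ ≤ 1 / ((n:ℝ) + 1) := by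
    intro n
    have hδ : 0 < 1 / ((n:ℝ) + 1) := by positivity
    obtain ⟨x, hx, hgx, φ, hφ, hne1, hb1⟩ := cim_loc a ha g hg (b * cfc k a) (by rwa [← mul_assoc]) _ hδ
    have hsa : ∀ u : ℝ → ℝ, star (cfc u a) = cfc u a := fun u => IsSelfAdjoint.cfc.star_eq
    have hne2 : cfc k a * (star (cfc φ a * (cfc g a * b))) ≠ 0 := by
      intro h
      apply hne1
      have := congrArg star h
      simpa [hsa, mul_assoc] using this
    obtain ⟨y, hy, hky, χ, hχ, hne3, hb2⟩ := cim_loc a ha k hk _ hne2 _ hδ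
    set Y := star (cfc χ a * (cfc k a * (star (cfc φ a * (cfc g a * b))))) with hY
    have hY0 : Y ≠ 0 := by rw [hY]; simpa [-star_mul] using hne3
    have hYe : Y = cfc φ a * (cfc g a * b * cfc k a * cfc χ a) := by
      rw [hY]; simp [hsa, mul_assoc]
    have hn : ‖Y‖ ≠ 0 := norm_ne_zero_iff.mpr hY0
    have i1 : ‖a * Y - x • Y‖ ≤ 1 / ((n:ℝ) + 1) * ‖Y‖ := by rw [hYe]; exact hb1 _
    have i2 : ‖Y * a - y • Y‖ ≤ 1 / ((n:ℝ) + 1) * ‖Y‖ := by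
      have := hb2 (cfc k a * (star (cfc φ a * (cfc g a * b))))
      rw [← norm_star (cfc χ a * _), ← hY, ← norm_star (a * _ - _)] at this
      rw [star_sub, star_mul, star_smul, ← hY, ha.star_eq] at this
      simpa using this
    refine ⟨x, hx, y, hy, ?_, ?_, ‖Y‖⁻¹ • Y, ?_, ?_, ?_⟩
    · by_contra h; exact hgx (hg0 _ (by linarith))
    · by_contra h; exact hky (hk0 _ (by linarith))
    · rw [norm_smul, norm_inv, norm_norm, inv_mul_cancel₀ hn]
    · rw [mul_smul_comm, smul_comm, ← smul_sub, norm_smul, norm_inv, norm_norm, inv_mul_le_iff₀ (by positivity), mul_comm]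
      exact i1
    · rw [smul_mul_assoc, smul_comm, ← smul_sub, norm_smul, norm_inv, norm_norm, inv_mul_le_iff₀ (by positivity), mul_comm]
      exact i2
  choose x hx y hy hx' hy' Z hZ h1 h2 using step
  have hK : IsCompact (spectrum ℝ a ×ˢ spectrum ℝ a) := 
    (spectrum.isCompact a).prod (spectrum.isCompact a)
  obtain ⟨⟨X, Y⟩, hXY, φ, hφ, hlim⟩ := hK.tendsto_subseq (x := fun n => (x n, y n)) (fun n => ⟨hx n, hy n⟩)
  have lx : Tendsto (fun n => x (φ n)) atTop (𝓝 X) := (continuous_fst.tendsto _).comp hlim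
  have ly : Tendsto (fun n => y (φ n)) atTop (𝓝 Y) := (continuous_snd.tendsto _).comp hlim
  have hX := ge_of_tendsto' lx fun n => hx' _
  have hY := le_of_tendsto' ly fun n => hy' _
  have l0 : Tendsto (fun n => 1 / ((φ n : ℝ) + 1)) atTop (𝓝 0) :=
    tendsto_one_div_add_atTop_nhds_zero_nat.comp hφ.tendsto_atTop
  refine ⟨X, hXY.1, Y, hXY.2, by linarith, fun n => Z (φ n), fun n => hZ _, ?_, ?_⟩
  · refine squeeze_zero_norm (a := fun n => 1 / ((φ n : ℝ) + 1) + |x (φ n) - X|) (fun n => ?_) ?_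
    · have : a * Z (φ n) - X • Z (φ n) = (a * Z (φ n) - x (φ n) • Z (φ n)) + (x (φ n) - X) • Z (φ n) := by
        module
      rw [this]
      refine (norm_add_le _ _).trans (add_le_add (h1 _) ?_)
      rw [norm_smul, hZ, mul_one, Real.norm_eq_abs]
    · have := (lx.sub_const X).abs
      simpa using l0.add this
  · refine squeeze_zero_norm (a := fun n => 1 / ((φ n : ℝ) + 1) + |y (φ n) - Y|) (fun n => ?_) ?_
    · have : Z (φ n) * a - Y • Z (φ n) = (Z (φ n) * a - y (φ n) • Z (φ n)) + (y (φ n) - Y) • Z (φ n) := by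
        module
      rw [this]
      refine (norm_add_le _ _).trans (add_le_add (h2 _) ?_)
      rw [norm_smul, hZ, mul_one, Real.norm_eq_abs]
    · have := (ly.sub_const Y).abs
      simpa using l0.add this

/-- functional calculus on approximate eigenvectors -/
theorem cim_cfc_approx {A : Type*} [CStarAlgebra A] [PartialOrder A] [StarOrderedRing A]
    (K : Set ℝ) (hK : IsCompact K) (f : ℝ → ℝ) (hf : ContinuousOn f K)
    (b q : ℕ → A) (hb : ∀ n, IsSelfAdjoint (b n)) (hs : ∀ n, spectrum ℝ (b n) ⊆ K)
    (x : ℝ) (hx : x ∈ K) (C : ℝ) (hq : ∀ n, ‖q n‖ ≤ C)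
    (h : Tendsto (fun n => b n * q n - x • q n) atTop (𝓝 0)) :
    Tendsto (fun n => cfc f (b n) * q n - f x • q n) atTop (𝓝 0) := by
  have key : ∀ ε > 0, ∃ D > 0, ∀ s ∈ K, (f s - f x) ^ 2 ≤ ε + D * (s - x) ^ 2 := by
    intro ε hε
    obtain ⟨M, hM⟩ := hK.exists_bound_of_continuousOn hf
    have hM0 : 0 ≤ M := (norm_nonneg _).trans (hM x hx)
    obtain ⟨δ, hδ, hd⟩ := Metric.continuousOn_iff.mp hf x hx (Real.sqrt ε) (Real.sqrt_pos.mpr hε)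
    refine ⟨(4 * M ^ 2 + 1) / δ ^ 2, by positivity, fun s hsK => ?_⟩
    by_cases hsx : dist s x < δ
    · have := hd s hsK hsx
      rw [Real.dist_eq] at this
      have h2 : (f s - f x) ^ 2 ≤ ε := by
        rw [← sq_abs, ← Real.sq_sqrt hε.le]
        exact pow_le_pow_left₀ (abs_nonneg _) this.le 2
      have : 0 ≤ (4 * M ^ 2 + 1) / δ ^ 2 * (s - x) ^ 2 := by positivity
      linarith
    · rw [not_lt, Real.dist_eq] at hsx
      have h1 : δ ^ 2 ≤ (s - x) ^ 2 := by
        rw [← sq_abs (s - x)]; exact pow_le_pow_left₀ hδ.le hsx 2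
      have h2 : 4 * M ^ 2 + 1 ≤ (4 * M ^ 2 + 1) / δ ^ 2 * (s - x) ^ 2 := by
        rw [div_mul_eq_mul_div, le_div_iff₀ (by positivity)]
        exact mul_le_mul_of_nonneg_left h1 (by positivity)
      have h3 := hM s hsK
      have h4 := hM x hx
      rw [Real.norm_eq_abs, abs_le] at h3 h4
      nlinarith
  have hC : 0 ≤ C := (norm_nonneg _).trans (hq 0)
  have bound : ∀ ε > 0, ∀ D > 0, (∀ s ∈ K, (f s - f x) ^ 2 ≤ ε + D * (s - x) ^ 2) → ∀ n,
      ‖cfc f (b n) * q n - f x • q n‖ ^ 2 ≤ ε * C ^ 2 + D * ‖b n * q n - x • q n‖ ^ 2 := by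
    intro ε hε D hD hKD n
    have hfc : ContinuousOn f (spectrum ℝ (b n)) := hf.mono (hs n)
    set B := b n
    have hB : IsSelfAdjoint B := hb n
    set P := cfc f B - algebraMap ℝ A (f x) with hP
    set Q := B - algebraMap ℝ A x with hQ
    have hP' : P = cfc (fun s => f s - f x) B := by
      rw [cfc_sub f (fun _ => f x) B hfc (by fun_prop), cfc_const _ B]
    have hQ' : Q = cfc (fun s => s - x) B := by
      rw [cfc_sub (fun s => s) (fun _ => x) B, cfc_const _ B, cfc_id' ℝ B]
    have hPs : IsSelfAdjoint P := by rw [hP']; exact IsSelfAdjoint.cfc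
    have hQs : IsSelfAdjoint Q := by rw [hQ']; exact IsSelfAdjoint.cfc
    have hle : P * P ≤ algebraMap ℝ A ε + D • (Q * Q) := by
      have e1 : P * P = cfc (fun s => (f s - f x) * (f s - f x)) B := by
        rw [hP', cfc_mul (fun s => f s - f x) (fun s => f s - f x) B (by fun_prop) (by fun_prop)]
      have e2 : algebraMap ℝ A ε + D • (Q * Q) = cfc (fun s => ε + D * ((s - x) * (s - x))) B := by
        rw [cfc_add B (fun _ => ε) (fun s => D * ((s - x) * (s - x))), cfc_const ε B,
          cfc_const_mul D (fun s => (s - x) * (s - x)) B, cfc_mul (fun s => s - x) (fun s => s - x) B, hQ']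
      rw [e1, e2]
      refine cfc_mono (fun s hsB => ?_) (by fun_prop) (by fun_prop)
      have := hKD s (hs n hsB)
      simpa [sq] using this
    have hconj := star_left_conjugate_le_conjugate hle (q n)
    have e3 : star (q n) * (P * P) * q n = star (P * q n) * (P * q n) := by
      rw [star_mul, hPs.star_eq]; simp only [mul_assoc]
    have e4 : star (q n) * (algebraMap ℝ A ε + D • (Q * Q)) * q n
        = ε • (star (q n) * q n) + D • (star (Q * q n) * (Q * q n)) := by
      rw [star_mul, hQs.star_eq, mul_add, add_mul, ← Algebra.commutes, mul_assoc, ← Algebra.smul_def]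
      simp only [mul_assoc, mul_smul_comm, smul_mul_assoc]
    rw [e3, e4] at hconj
    have hn := CStarAlgebra.norm_le_norm_of_nonneg_of_le (star_mul_self_nonneg (P * q n)) hconj
    rw [CStarRing.norm_star_mul_self] at hn
    have f1 : P * q n = cfc f B * q n - f x • q n := by rw [hP, sub_mul, ← Algebra.smul_def]
    have f2 : Q * q n = B * q n - x • q n := by rw [hQ, sub_mul, ← Algebra.smul_def]
    rw [f1, f2] at hn
    calc _ ≤ _ := (sq _).le.trans hn
      _ ≤ _ := norm_add_le _ _
      _ ≤ _ := by
        rw [norm_smul, norm_smul, CStarRing.norm_star_mul_self, CStarRing.norm_star_mul_self,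
          Real.norm_of_nonneg hε.le, Real.norm_of_nonneg hD.le, ← sq, ← sq]
        gcongr
        exact hq n
  have hsq : Tendsto (fun n => ‖cfc f (b n) * q n - f x • q n‖ ^ 2) atTop (𝓝 0) := by
    rw [Metric.tendsto_atTop]
    intro ε hε
    obtain ⟨D, hD, hKD⟩ := key (ε / (2 * (C ^ 2 + 1))) (by positivity)
    have hb' := bound _ (by positivity) D hD hKD
    have ht : Tendsto (fun n => D * ‖b n * q n - x • q n‖ ^ 2) atTop (𝓝 0) := by
      simpa using (h.norm.pow 2).const_mul D
    obtain ⟨N, hN⟩ := Metric.tendsto_atTop.mp ht (ε / 2) (by positivity)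
    refine ⟨N, fun n hn => ?_⟩
    have h1 := hN n hn
    rw [dist_zero_right, Real.norm_eq_abs, abs_lt] at h1
    rw [dist_zero_right, Real.norm_of_nonneg (by positivity)]
    refine (hb' n).trans_lt ?_
    have : ε / (2 * (C ^ 2 + 1)) * C ^ 2 ≤ ε / 2 := by
      rw [div_mul_eq_mul_div, div_le_div_iff₀ (by positivity) (by positivity)]
      nlinarith
    linarith
  rw [tendsto_zero_iff_norm_tendsto_zero]
  have := hsq.sqrt
  simpa [Real.sqrt_sq] using this

theorem cim_null_mul {A : Type*} [CStarAlgebra A] {s t : ℕ → A} {C : ℝ} (hs : ∀ n, ‖s n‖ ≤ C)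
    (ht : Tendsto t atTop (𝓝 0)) : Tendsto (fun n => s n * t n) atTop (𝓝 0) := by
  refine squeeze_zero_norm (a := fun n => C * ‖t n‖) (fun n => ?_) (by simpa using ht.norm.const_mul C)
  exact (norm_mul_le _ _).trans (mul_le_mul_of_nonneg_right (hs n) (norm_nonneg _))

theorem cim_mul_null {A : Type*} [CStarAlgebra A] {s t : ℕ → A} {C : ℝ} (hs : ∀ n, ‖s n‖ ≤ C)
    (ht : Tendsto t atTop (𝓝 0)) : Tendsto (fun n => t n * s n) atTop (𝓝 0) := by
  refine squeeze_zero_norm (a := fun n => ‖t n‖ * C) (fun n => ?_) (by simpa using ht.norm.mul_const C)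
  exact (norm_mul_le _ _).trans (mul_le_mul_of_nonneg_left (hs n) (norm_nonneg _))

theorem cim_null_smul {A : Type*} [CStarAlgebra A] {t : ℕ → A} (r : ℝ)
    (ht : Tendsto t atTop (𝓝 0)) : Tendsto (fun n => r • t n) atTop (𝓝 0) := by
  simpa using ht.const_smul r

theorem cim_null_add {A : Type*} [CStarAlgebra A] {s t : ℕ → A} (hs : Tendsto s atTop (𝓝 0))
    (ht : Tendsto t atTop (𝓝 0)) : Tendsto (fun n => s n + t n) atTop (𝓝 0) := by
  simpa using hs.add ht

theorem cim_null_sub {A : Type*} [CStarAlgebra A] {s t : ℕ → A} (hs : Tendsto s atTop (𝓝 0))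
    (ht : Tendsto t atTop (𝓝 0)) : Tendsto (fun n => s n - t n) atTop (𝓝 0) := by
  simpa using hs.sub ht

theorem cim_null_star {A : Type*} [CStarAlgebra A] {t : ℕ → A}
    (ht : Tendsto t atTop (𝓝 0)) : Tendsto (fun n => star (t n)) atTop (𝓝 0) := by
  simpa using ht.star

theorem cim_pow_null {A : Type*} [CStarAlgebra A] [PartialOrder A] [StarOrderedRing A]
    (c : A) (hc : 0 ≤ c) (hc1 : ‖c‖ ≤ 1) (m : ℕ) : ‖c * c ^ m - c ^ m‖ ≤ 1 / ((m : ℝ) + 1) := by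
  have hsa : IsSelfAdjoint c := .of_nonneg hc
  have e : c * c ^ m - c ^ m = cfc (fun s : ℝ => s * s ^ m - s ^ m) c := by
    rw [cfc_sub (fun s : ℝ => s * s ^ m) (fun s => s ^ m) c, cfc_mul (fun s : ℝ => s) (fun s => s ^ m) c,
      cfc_id' ℝ c, cfc_pow_id c m]
  rw [e]
  refine norm_cfc_le (by positivity) fun s hs => ?_
  have h0 : 0 ≤ s := spectrum_nonneg_of_nonneg hc hs
  have h1 : s ≤ 1 := by
    have := IsometricContinuousFunctionalCalculus.norm_spectrum_le (𝕜 := ℝ) c hs hsa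
    exact ((le_abs_self s).trans this).trans hc1
  rw [Real.norm_eq_abs, abs_sub_comm, abs_of_nonneg, le_div_iff₀ (by positivity)]
  · have hg := geom_sum_mul_neg s (m + 1)
    have : ∑ i ∈ Finset.range (m + 1), s ^ m ≤ ∑ i ∈ Finset.range (m + 1), s ^ i := by
      refine Finset.sum_le_sum fun i hi => pow_le_pow_of_le_one h0 h1 ?_
      have := Finset.mem_range.mp hi
      omega
    rw [Finset.sum_const, Finset.card_range, nsmul_eq_mul] at this
    push_cast at this
    have h2 := mul_le_mul_of_nonneg_right this (by linarith : 0 ≤ 1 - s)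
    rw [hg] at h2
    have : 0 ≤ s ^ (m+1) := by positivity
    nlinarith
  · have : 0 ≤ s ^ m := by positivity
    nlinarith

theorem cim_main {A : Type*} [CStarAlgebra A] [PartialOrder A] [StarOrderedRing A]
    (I : Set ℝ) (hI : ∀ s ∈ I, ∀ t, s ≤ t → t ∈ I) (f : ℝ → ℝ) (hf : ContinuousOn f I)
    (hcx : StrictConvexOn ℝ I f) (a : A) (ha : IsSelfAdjoint a) (haI : spectrum ℝ a ⊆ I)
    (hmono : ∀ b : A, IsSelfAdjoint b → spectrum ℝ b ⊆ I → a ≤ b → cfc f a ≤ cfc f b)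
    (x y : ℝ) (hx : x ∈ spectrum ℝ a) (hy : y ∈ spectrum ℝ a) (hyx : y < x)
    (Z : ℕ → A) (hZ : ∀ n, ‖Z n‖ = 1)
    (h1 : Tendsto (fun n => a * Z n - x • Z n) atTop (𝓝 0))
    (h2 : Tendsto (fun n => Z n * a - y • Z n) atTop (𝓝 0)) : False := by
  -- scalars
  set δ := (x - y) / 2 with hδ
  have hδ0 : 0 < δ := by rw [hδ]; linarith
  set μ := (x + y) / 2 with hμ
  have hfμ : f μ < (f x + f y) / 2 := by
    have := hcx.2 (haI hx) (haI hy) hyx.ne' (show (0:ℝ) < 1 / 2 by norm_num) (show (0:ℝ) < 1 / 2 by norm_num) (by norm_num)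
    simp only [smul_eq_mul] at this
    rw [show 1 / 2 * x + 1 / 2 * y = μ by rw [hμ]; ring] at this
    linarith
  obtain ⟨α, β, hαβ, hκ⟩ : ∃ α β : ℝ, β ^ 2 = α ^ 2 + δ ∧
      f μ * (α ^ 2 + β ^ 2) < f x * α ^ 2 + f y * β ^ 2 := by
    obtain ⟨N, hN⟩ := exists_nat_gt (δ * (f μ - f y) / (f x + f y - 2 * f μ))
    rw [div_lt_iff₀ (by linarith)] at hN
    have hN0 : (0:ℝ) ≤ N := Nat.cast_nonneg N
    refine ⟨√N, √(N + δ), ?_, ?_⟩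
    · rw [Real.sq_sqrt hN0, Real.sq_sqrt (by positivity)]
    · rw [Real.sq_sqrt hN0, Real.sq_sqrt (by positivity)]; nlinarith
  set κ := f x * α ^ 2 + f y * β ^ 2 - f μ * (α ^ 2 + β ^ 2) with hκd
  have hκ0 : 0 < κ := by rw [hκd]; linarith
  -- sequences
  set c : ℕ → A := fun n => star (Z n) * Z n with hc
  set W : ℕ → A := fun n => c n ^ (2 ^ n) with hW
  set U : ℕ → A := fun n => Z n * W n with hU
  set q : ℕ → A := fun n => α • U n - β • W n with hq
  set v : ℕ → A := fun n => α • Z n + β • c n with hv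
  set b : ℕ → A := fun n => a + v n * star (v n) with hb
  have hcs : ∀ n, IsSelfAdjoint (c n) := fun n => IsSelfAdjoint.star_mul_self _
  have hWs : ∀ n, star (W n) = W n := fun n => ((hcs n).pow _).star_eq
  have hcn : ∀ n, ‖c n‖ = 1 := fun n => by simp [hc, CStarRing.norm_star_mul_self, hZ]
  have hWn : ∀ n, ‖W n‖ = 1 := fun n => by
    simp only [hW]; rw [(hcs n).norm_pow_two_pow, hcn, one_pow]
  have bZ : ∀ n, ‖Z n‖ ≤ 1 := fun n => (hZ n).le
  have bZs : ∀ n, ‖star (Z n)‖ ≤ 1 := fun n => by rw [norm_star]; exact bZ n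
  have bc : ∀ n, ‖c n‖ ≤ 1 := fun n => (hcn n).le
  have bW : ∀ n, ‖W n‖ ≤ 1 := fun n => (hWn n).le
  have bU : ∀ n, ‖U n‖ ≤ 1 := fun n => (norm_mul_le _ _).trans (by rw [hZ, hWn, one_mul])
  have bq : ∀ n, ‖q n‖ ≤ |α| + |β| := fun n => by
    refine (norm_sub_le _ _).trans (add_le_add ?_ ?_)
    · rw [norm_smul, Real.norm_eq_abs]; exact mul_le_of_le_one_right (abs_nonneg _) (bU n)
    · rw [norm_smul, Real.norm_eq_abs]; exact mul_le_of_le_one_right (abs_nonneg _) (bW n)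
  have bv : ∀ n, ‖v n‖ ≤ |α| + |β| := fun n => by
    refine (norm_add_le _ _).trans (add_le_add ?_ ?_)
    · rw [norm_smul, Real.norm_eq_abs]; exact mul_le_of_le_one_right (abs_nonneg _) (bZ n)
    · rw [norm_smul, Real.norm_eq_abs]; exact mul_le_of_le_one_right (abs_nonneg _) (bc n)
  have bvs : ∀ n, ‖star (v n)‖ ≤ |α| + |β| := fun n => by rw [norm_star]; exact bv n
  have bqs : ∀ n, ‖star (q n)‖ ≤ |α| + |β| := fun n => by rw [norm_star]; exact bq n
  have ba : ∀ n : ℕ, ‖a - algebraMap ℝ A y‖ ≤ ‖a - algebraMap ℝ A y‖ := fun _ => le_rfl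
  -- null sequences
  have h3 : Tendsto (fun n => c n * W n - W n) atTop (𝓝 0) := by
    refine squeeze_zero_norm (a := fun n : ℕ => 1 / ((n:ℝ) + 1)) (fun n => ?_) tendsto_one_div_add_atTop_nhds_zero_nat
    refine (cim_pow_null (c n) (star_mul_self_nonneg _) (bc n) (2 ^ n)).trans ?_
    have : (n:ℝ) ≤ ((2 ^ n : ℕ) : ℝ) := by exact_mod_cast Nat.lt_two_pow_self.le
    exact one_div_le_one_div_of_le (by positivity) (by linarith)
  have h4 : Tendsto (fun n => Z n * Z n) atTop (𝓝 0) := by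
    have := cim_null_smul (x - y)⁻¹ (cim_null_sub (cim_mul_null bZ h2) (cim_null_mul bZ h1))
    refine this.congr fun n => ?_
    have : (Z n * a - y • Z n) * Z n - Z n * (a * Z n - x • Z n) = (x - y) • (Z n * Z n) := by
      simp only [sub_mul, mul_sub, smul_mul_assoc, mul_smul_comm, mul_assoc]; module
    rw [this, smul_smul, inv_mul_cancel₀ (by linarith), one_smul]
  have h5 : Tendsto (fun n => a * U n - x • U n) atTop (𝓝 0) := by
    refine (cim_mul_null bW h1).congr fun n => ?_
    simp only [hU, sub_mul, smul_mul_assoc, mul_assoc]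
  have h6 : Tendsto (fun n => a * W n - y • W n) atTop (𝓝 0) := by
    have := cim_null_sub (cim_mul_null bW (cim_mul_null bZ (cim_null_star h2))) (cim_null_mul ba h3)
    refine this.congr fun n => ?_
    simp only [hc, star_sub, star_mul, ha.star_eq, star_smul, star_trivial, sub_mul, mul_sub, smul_mul_assoc, mul_smul_comm,
      mul_assoc, ← Algebra.smul_def]
    module
  have h7 : Tendsto (fun n => Z n * U n) atTop (𝓝 0) :=
    (cim_mul_null bW h4).congr fun n => by simp only [hU, mul_assoc]
  have h8 : Tendsto (fun n => star (Z n) * W n) atTop (𝓝 0) := by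
    have := cim_null_sub (cim_mul_null bW (cim_mul_null bZ (cim_null_star h4))) (cim_null_mul bZs h3)
    refine this.congr fun n => ?_
    simp only [hc, star_mul, mul_sub, mul_assoc]
    abel
  -- b q ~ μ q
  have h9 : Tendsto (fun n => star (v n) * q n - (α ^ 2 - β ^ 2) • W n) atTop (𝓝 0) := by
    have := cim_null_add (cim_null_add (cim_null_smul (α ^ 2 - β ^ 2) h3)
      (cim_null_smul (α * β) (cim_null_mul bZs h7))) (cim_null_smul (-(α * β)) h8)
    refine this.congr fun n => ?_
    simp only [hv, hq, hU, star_add, star_smul, star_trivial, (hcs n).star_eq, add_mul, mul_sub, smul_mul_assoc,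
      mul_smul_comm]
    simp only [hc, mul_assoc]
    module
  have h10 : Tendsto (fun n => v n * W n - (α • U n + β • W n)) atTop (𝓝 0) := by
    refine (cim_null_smul β h3).congr fun n => ?_
    simp only [hv, hU, add_mul, smul_mul_assoc]
    module
  have hbq : Tendsto (fun n => b n * q n - μ • q n) atTop (𝓝 0) := by
    have := cim_null_add (cim_null_add (cim_null_smul α h5) (cim_null_smul (-β) h6))
      (cim_null_add (cim_null_mul bv h9) (cim_null_smul (α ^ 2 - β ^ 2) h10))
    refine this.congr fun n => ?_
    have hd : α ^ 2 - β ^ 2 = -δ := by rw [hαβ]; ring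
    have ex : x = μ + δ := by rw [hμ, hδ]; ring
    have ey : y = μ - δ := by rw [hμ, hδ]; ring
    rw [hd, ex, ey]
    simp only [hb, add_mul, mul_assoc, mul_sub]
    generalize v n * (star (v n) * q n) = E
    simp only [hq, mul_sub, mul_smul_comm]
    module
  -- spectra
  have hnt : Nontrivial A := by
    refine ⟨Z 0, 0, fun h => ?_⟩
    have := hZ 0
    rw [h, norm_zero] at this
    exact zero_ne_one this
  obtain ⟨m, hm, hmle⟩ := (spectrum.isCompact (𝕜 := ℝ) a).exists_isLeast ⟨x, hx⟩
  set M := ‖a‖ + (|α| + |β|) * (|α| + |β|) with hM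
  have hbs : ∀ n, IsSelfAdjoint (b n) := fun n => ha.add (IsSelfAdjoint.mul_star_self _)
  have hab : ∀ n, a ≤ b n := fun n => le_add_of_nonneg_right (mul_star_self_nonneg _)
  have hbsp : ∀ n, spectrum ℝ (b n) ⊆ Set.Icc m M := by
    intro n s hs
    constructor
    · have h : algebraMap ℝ A m ≤ a := (algebraMap_le_iff_le_spectrum (a := a)).mpr (fun s hs => hmle hs)
      exact (algebraMap_le_iff_le_spectrum (a := b n) (ha := hbs n)).mp (h.trans (hab n)) s hs
    · have := IsometricContinuousFunctionalCalculus.norm_spectrum_le (𝕜 := ℝ) (b n) hs (hbs n)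
      refine ((le_abs_self s).trans this).trans ((norm_add_le _ _).trans ?_)
      refine add_le_add le_rfl ((norm_mul_le _ _).trans ?_)
      exact mul_le_mul (bv n) (bvs n) (norm_nonneg _) (by positivity)
  have hasp : spectrum ℝ a ⊆ Set.Icc m M := by
    intro s hs
    refine ⟨hmle hs, ?_⟩
    have := IsometricContinuousFunctionalCalculus.norm_spectrum_le (𝕜 := ℝ) a hs ha
    refine ((le_abs_self s).trans this).trans ?_
    rw [hM]; have : 0 ≤ (|α| + |β|) * (|α| + |β|) := by positivity
    linarith
  have hKI : Set.Icc m M ⊆ I := fun s hs => hI m (haI hm) s hs.1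
  have hfK := hf.mono hKI
  have hμK : μ ∈ Set.Icc m M := by
    have := hasp hx
    have := hasp hy
    simp only [Set.mem_Icc] at *
    constructor <;> rw [hμ] <;> linarith
  have F1 := cim_cfc_approx _ isCompact_Icc f hfK b q hbs hbsp μ hμK _ bq hbq
  have F2 := cim_cfc_approx _ isCompact_Icc f hfK (fun _ => a) U (fun _ => ha) (fun _ => hasp) x (hasp hx) _ bU h5
  have F3 := cim_cfc_approx _ isCompact_Icc f hfK (fun _ => a) W (fun _ => ha) (fun _ => hasp) y (hasp hy) _ bW h6
  -- inner products
  have g1 : Tendsto (fun n => star (U n) * U n - W n * W n) atTop (𝓝 0) := by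
    refine (cim_null_mul bW h3).congr fun n => ?_
    simp only [hU, hc, star_mul, hWs, mul_sub, mul_assoc]
  have g2 : Tendsto (fun n => star (U n) * W n) atTop (𝓝 0) := by
    refine (cim_null_mul bW h8).congr fun n => ?_
    simp only [hU, star_mul, hWs, mul_assoc]
  have g3 : Tendsto (fun n => W n * U n) atTop (𝓝 0) := by
    refine (cim_null_star g2).congr fun n => ?_
    simp only [star_mul, star_star, hWs]
  have G : Tendsto (fun n => star (q n) * (cfc f (b n) - cfc f a) * q n + κ • (W n * W n)) atTop (𝓝 0) := by
    have T1 := cim_null_mul bqs F1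
    have T2 := cim_null_mul bqs (cim_null_sub (cim_null_smul α F2) (cim_null_smul β F3))
    have T3 := cim_null_add (cim_null_add (cim_null_smul ((f μ - f x) * α ^ 2) g1)
      (cim_null_smul (-(f μ - f y) * α * β) g2)) (cim_null_smul (-(f μ - f x) * α * β) g3)
    refine (cim_null_add (cim_null_sub T1 T2) T3).congr fun n => ?_
    have hqs : star (q n) = α • star (U n) - β • W n := by
      simp only [hq, star_sub, star_smul, star_trivial, hWs]
    have e1 : star (q n) * (cfc f (b n) - cfc f a) * q n
      = star (q n) * (cfc f (b n) * q n) - star (q n) * (α • (cfc f a * U n) - β • (cfc f a * W n)) := by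
      rw [mul_assoc, sub_mul, mul_sub]
      congr 2
      simp only [hq, mul_sub, mul_smul_comm]
    rw [e1]
    have e2 : ∀ P Q R : A, (star (q n) * (P - f μ • q n) - star (q n) * (α • (Q - f x • U n) - β • (R - f y • W n)))
        = star (q n) * P - star (q n) * (α • Q - β • R)
          - star (q n) * (f μ • q n - (α * f x) • U n + (β * f y) • W n) := by
      intro P Q R
      simp only [← mul_sub]
      congr 1
      module
    rw [e2, hqs]
    simp only [hq, hκd, sub_mul, mul_sub, mul_add, smul_mul_assoc, mul_smul_comm]
    module
  have hfin : ∀ n, κ ≤ ‖star (q n) * (cfc f (b n) - cfc f a) * q n + κ • (W n * W n)‖ := by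
    intro n
    have hnn : 0 ≤ star (q n) * (cfc f (b n) - cfc f a) * q n :=
      star_left_conjugate_nonneg (sub_nonneg.mpr (hmono _ (hbs n) ((hbsp n).trans hKI) (hab n))) _
    have hWW : 0 ≤ κ • (W n * W n) := by
      refine smul_nonneg hκ0.le ?_
      have := star_mul_self_nonneg (W n)
      rwa [hWs] at this
    have := CStarAlgebra.norm_le_norm_of_nonneg_of_le hWW (le_add_of_nonneg_left hnn)
    refine le_trans ?_ this
    have hs : IsSelfAdjoint (W n) := hWs n
    rw [norm_smul, hs.norm_mul_self, hWn, Real.norm_of_nonneg hκ0.le]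
    simp
  have := ge_of_tendsto' G.norm hfin
  rw [norm_zero] at this
  linarith


/-- **Main theorem.** Let `I = (γ, ∞)` with `γ ∈ ℝ ∪ {−∞}`, and let `f` be continuously
differentiable on `I` with positive, strictly increasing, logarithmically concave derivative.
A self-adjoint element `a` of a unital C*-algebra with spectrum in `I` is central if and only
if `f` is locally monotone at `a`. -/
theorem central_iff_locally_monotone
    {A : Type*} [CStarAlgebra A] [PartialOrder A] [StarOrderedRing A]
    (γ : EReal) (hγ : γ ≠ ⊤) (I : Set ℝ) (hI : I = {x : ℝ | γ < (x : EReal)})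
    (f f' : ℝ → ℝ)
    (hderiv : ∀ x ∈ I, HasDerivAt f (f' x) x)
    (hcont : ContinuousOn f' I)
    (hpos : ∀ x ∈ I, 0 < f' x)
    (hmono : StrictMonoOn f' I)
    (hconc : ∀ x ∈ I, ∀ y ∈ I, ∀ t ∈ Set.Icc (0:ℝ) 1,
      t * Real.log (f' x) + (1 - t) * Real.log (f' y)
        ≤ Real.log (f' (t * x + (1 - t) * y)))
    (a : A) (ha : IsSelfAdjoint a) (haspec : spectrum ℝ a ⊆ I) :
    (∀ b : A, a * b = b * a) ↔
      (∀ b : A, IsSelfAdjoint b → spectrum ℝ b ⊆ I → a ≤ b → cfc f a ≤ cfc f b) := by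

  have hup : ∀ s ∈ I, ∀ t, s ≤ t → t ∈ I := by
    intro s hs t hst
    rw [hI] at hs ⊢
    exact lt_of_lt_of_le hs (EReal.coe_le_coe_iff.mpr hst)
  have hconv : Convex ℝ I := by
    refine Set.OrdConnected.convex ⟨fun s hs t _ u hu => hup s hs u hu.1⟩
  have hopen : IsOpen I := by
    rw [hI]; exact isOpen_lt continuous_const continuous_coe_real_ereal
  have hfc : ContinuousOn f I := fun s hs => (hderiv s hs).continuousAt.continuousWithinAt
  have hder : ∀ s ∈ I, deriv f s = f' s := fun s hs => (hderiv s hs).deriv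
  constructor
  · intro h b hb hbs hab
    refine cim_forward I f hfc ?_ a b ha hb haspec hbs (h b) hab
    refine (strictMonoOn_of_deriv_pos hconv hfc fun s hs => ?_).monotoneOn
    rw [hder s (interior_subset hs)]
    exact hpos s (interior_subset hs)
  · intro h
    have hcx : StrictConvexOn ℝ I f := by
      refine StrictMonoOn.strictConvexOn_of_deriv hconv hfc ?_
      rw [hopen.interior_eq]
      intro s hs t ht hst
      rw [hder s hs, hder t ht]
      exact hmono hs ht hst
    refine cim_central_of_sep a ha ?_
    intro t t' htt g k hg hk hg0 hk0 b
    by_contra hne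
    obtain ⟨x, hx, y, hy, hyx, Z, hZ, h1, h2⟩ := cim_seq a ha t t' htt g k hg hk hg0 hk0 b hne
    exact cim_main I hup f hfc hcx a ha haspec h x y hx hy hyx Z hZ h1 h2
end

section
/- Let I = (γ, ∞) with γ ∈ ℝ ∪ {−∞}, and let f : I → ℝ be continuously differentiable with f'(x) > 0 for all x ∈ I, f' strictly monotone increasing on I, and log ∘ f' concave on I. Let A be a unital C*-algebra and let a ∈ A be self-adjoint with spectrum σ(a) ⊆ I. If a is not central, i.e., there exists a' ∈ A with aa' ≠ a'a, then there exists a self-adjoint b ∈ A with σ(b) ⊆ I such that a ≤ b but f(a) ≤ f(b) fails. -/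
open Filter Topology

lemma aux_eig {A : Type*} [CStarAlgebra A] (B : A) (hB : IsSelfAdjoint B) (f : ℝ → ℝ)
    (hf : ContinuousOn f (spectrum ℝ B)) (l : ℝ) (u : A) (hu : B * u = l • u) :
    cfc f B * u = f l • u := by
  by_cases hu0 : u = 0
  · simp [hu0]
  have hl : l ∈ spectrum ℝ B := by
    rw [spectrum.mem_iff]
    intro h
    apply hu0
    have h2 : (algebraMap ℝ A l - B) * u = 0 := by
      rw [sub_mul, hu, Algebra.algebraMap_eq_smul_one, smul_mul_assoc, one_mul, sub_self]
    exact (h.mul_right_eq_zero).1 h2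
  have key : ∀ g : C(spectrum ℝ B, ℝ), cfcHom hB g * u = g ⟨l, hl⟩ • u := by
    intro g
    induction g using ContinuousMap.induction_on_of_compact with
    | const r =>
      have : (ContinuousMap.const (spectrum ℝ B) r) = algebraMap ℝ C(spectrum ℝ B, ℝ) r := rfl
      rw [this, AlgHomClass.commutes, Algebra.algebraMap_eq_smul_one, smul_mul_assoc, one_mul]
      rfl
    | id => rw [cfcHom_id]; exact hu
    | star_id => rw [map_star, cfcHom_id, hB.star_eq]; exact hu
    | add g1 g2 h1 h2 => rw [map_add, add_mul, h1, h2, ContinuousMap.add_apply, add_smul]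
    | mul g1 g2 h1 h2 =>
      rw [map_mul, mul_assoc, h2, mul_smul_comm, h1, smul_smul, ContinuousMap.mul_apply, mul_comm]
    | frequently g h =>
      refine h.mem_of_closed <| isClosed_eq ?_ ?_
      · exact (cfcHom_continuous hB).mul continuous_const
      · exact (continuous_eval_const (F := C(spectrum ℝ B, ℝ)) (⟨l, hl⟩ : spectrum ℝ B)).smul continuous_const
  rw [cfc_apply f B hB hf, key]
  rfl

lemma aux_eig2 {A : Type*} [CStarAlgebra A] (B : A) (hB : IsSelfAdjoint B) (f : ℝ → ℝ)
    (hf : ContinuousOn f (spectrum ℝ B)) (l m : ℝ) (hlm : l ≠ m) (u : A)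
    (hu : B * (B * u) = (l + m) • (B * u) - (l * m) • u) :
    cfc f B * u = f l • u + ((f m - f l) / (m - l)) • (B * u - l • u) := by
  have h1 := aux_eig B hB f hf l (B * u - m • u) (by
    rw [mul_sub, hu, mul_smul_comm]; module)
  have h2 := aux_eig B hB f hf m (B * u - l • u) (by
    rw [mul_sub, hu, mul_smul_comm]; module)
  have hml : m - l ≠ 0 := sub_ne_zero.2 hlm.symm
  have hu' : u = (m - l)⁻¹ • ((B * u - l • u) - (B * u - m • u)) := by
    have : (B * u - l • u) - (B * u - m • u) = (m - l) • u := by module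
    rw [this, smul_smul, inv_mul_cancel₀ hml, one_smul]
  conv_lhs => rw [hu']
  rw [mul_smul_comm, mul_sub, h1, h2]
  have : f l • u = ((m - l)⁻¹ * (m - l) * f l) • u := by rw [inv_mul_cancel₀ hml, one_mul]
  rw [this, div_eq_inv_mul]
  module

lemma aux_polar {A : Type*} [CStarAlgebra A] [PartialOrder A] [StarOrderedRing A]
    (d : A) (hd : d ≠ 0) (hdd : d * d = 0) :
    ∃ V φ k1 k2 : A, V = d * k1 ∧ φ = star d * k2 ∧ star V * V * φ = φ ∧
      star V * V * V = 0 ∧ star φ = φ ∧ φ ≠ 0 := by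
  have : Nontrivial A := ⟨d, 0, hd⟩
  set e := star d * d with he
  have he0 : 0 ≤ e := star_mul_self_nonneg d
  have hesa : IsSelfAdjoint e := .of_nonneg he0
  have hene : e ≠ 0 := by simpa [he] using hd
  have hm : 0 < ‖e‖ := norm_pos_iff.2 hene
  set m := ‖e‖ / 2 with hm'
  have hmpos : 0 < m := by positivity
  let kf : ℝ → ℝ := fun s => (√(max s m))⁻¹
  let pf : ℝ → ℝ := fun s => max 0 (s - m)
  have hpos : ∀ s : ℝ, 0 < max s m := fun s => lt_max_of_lt_right hmpos
  have hkc : Continuous kf := by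
    refine Continuous.inv₀ (by fun_prop) fun s => ?_
    exact (Real.sqrt_pos.2 (hpos s)).ne'
  have hpc : Continuous pf := by fun_prop
  set k := cfc kf e with hk
  set p := cfc pf e with hp
  have hksa : star k = k := (cfc_predicate kf e : IsSelfAdjoint _)
  have hpsa : star p = p := (cfc_predicate pf e : IsSelfAdjoint _)
  have hke : k * e = e * k := by
    have h := cfc_commute_cfc kf id e
    rw [cfc_id ℝ e hesa] at h
    exact h
  have hed : e * d = 0 := by rw [he, mul_assoc, hdd, mul_zero]
  have hE : star (d * k) * (d * k) = k * k * e := by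
    rw [star_mul, hksa]
    calc k * star d * (d * k) = k * (e * k) := by simp only [he, mul_assoc]
      _ = _ := by rw [← hke, mul_assoc]
  have hid : k * k * e * p = p := by
    have h1 : k * k * e * p = cfc (fun s => kf s * kf s * s * pf s) e := by
      rw [cfc_mul (fun s => kf s * kf s * s) pf e (by fun_prop) (by fun_prop),
        cfc_mul (fun s => kf s * kf s) (fun s => s) e (by fun_prop) (by fun_prop),
        cfc_mul kf kf e (by fun_prop) (by fun_prop), cfc_id' ℝ e hesa]
    rw [h1]
    apply cfc_congr
    intro s _
    simp only [kf, pf]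
    rcases le_total s m with h | h
    · rw [max_eq_left (sub_nonpos.2 h)]; simp
    · rw [max_eq_left h, ← mul_inv, Real.mul_self_sqrt (hmpos.le.trans h),
        inv_mul_cancel₀ (hmpos.trans_le h).ne', one_mul]
  refine ⟨d * k, p, k, d * (k * k * p), rfl, ?_, ?_, ?_, hpsa, ?_⟩
  · conv_lhs => rw [← hid]
    rw [← mul_assoc (star d), ← he]
    have : k * k * e = e * (k * k) := by rw [mul_assoc, hke, ← mul_assoc, hke, mul_assoc]
    rw [this, mul_assoc]
  · rw [hE, hid]
  · rw [hE]
    simp only [mul_assoc]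
    rw [← mul_assoc e, hed]; simp
  · intro h0
    have h1 : cfc pf e = cfc (fun _ : ℝ => (0:ℝ)) e := by rw [cfc_const_zero]; exact h0
    have h2 := eqOn_of_cfc_eq_cfc h1 (by fun_prop) (by fun_prop) hesa
    have h3 := h2 (CStarAlgebra.norm_mem_spectrum_of_nonneg he0)
    simp only [pf] at h3
    have := le_max_right 0 (‖e‖ - m)
    rw [h3] at this
    linarith

lemma aux_fin {A : Type*} [CStarAlgebra A] [PartialOrder A] [StarOrderedRing A]
    (V φ aF aG : A) (X Y gX gY v1 v2 l m α β : ℝ) (f : ℝ → ℝ)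
    (hEφ : star V * V * φ = φ) (hEV : star V * V * V = 0) (hφ : star φ = φ) (hφ0 : φ ≠ 0)
    (hFV : aF * V = X • V) (hFφ : aF * φ = Y • φ)
    (hGV : aG * V = gX • V) (hGφ : aG * φ = gY • φ) (hlm : l ≠ m)
    (h1 : v1 ^ 2 + X + (v2 ^ 2 + Y) = l + m)
    (h2 : (v1 ^ 2 + X) * (v2 ^ 2 + Y) - (v1 * v2) ^ 2 = l * m)
    (hneg : α ^ 2 * (f l + (f m - f l) / (m - l) * (v1 ^ 2 + X - l) - gX)
      + 2 * (α * β) * ((f m - f l) / (m - l) * (v1 * v2))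
      + β ^ 2 * (f l + (f m - f l) / (m - l) * (v2 ^ 2 + Y - l) - gY) < 0)
    (B : A) (hB : B = aF + (v1 • V + v2 • (star V * V)) * star (v1 • V + v2 • (star V * V)))
    (hBsa : IsSelfAdjoint B) (hf : ContinuousOn f (spectrum ℝ B)) (hle : aG ≤ cfc f B) : False := by
  have hVE : star V * (star V * V) = 0 := by
    have := congrArg star hEV
    simpa [mul_assoc] using this
  have hVφ : star V * φ = 0 := by
    rw [← hEφ, ← mul_assoc, hVE, zero_mul]
  have hzφ : (v1 • V + v2 • (star V * V)) * φ = v1 • (V * φ) + v2 • φ := by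
    rw [add_mul, smul_mul_assoc, smul_mul_assoc, hEφ]
  have hzs : star (v1 • V + v2 • (star V * V)) = v1 • star V + v2 • (star V * V) := by simp
  have hBV : B * (V * φ) = (v1 ^ 2 + X) • (V * φ) + (v1 * v2) • φ := by
    have : star (v1 • V + v2 • (star V * V)) * (V * φ) = v1 • φ := by
      rw [hzs, add_mul, smul_mul_assoc, smul_mul_assoc, ← mul_assoc, hEφ, ← mul_assoc, hEV]
      simp
    rw [hB, add_mul, mul_assoc _ (star _), this, mul_smul_comm, hzφ, ← mul_assoc, hFV,
      smul_mul_assoc]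
    module
  have hBφ : B * φ = (v1 * v2) • (V * φ) + (v2 ^ 2 + Y) • φ := by
    have : star (v1 • V + v2 • (star V * V)) * φ = v2 • φ := by
      rw [hzs, add_mul, smul_mul_assoc, smul_mul_assoc, hEφ, hVφ]
      simp
    rw [hB, add_mul, mul_assoc _ (star _), this, mul_smul_comm, hzφ, hFφ]
    module
  have hc1 : cfc f B * (V * φ) = _ := aux_eig2 B hBsa f hf l m hlm (V * φ) (by
    rw [← h1, ← h2, hBV, mul_add, mul_smul_comm, mul_smul_comm, hBV, hBφ]; module)
  have hc2 : cfc f B * φ = _ := aux_eig2 B hBsa f hf l m hlm φ (by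
    rw [← h1, ← h2, hBφ, mul_add, mul_smul_comm, mul_smul_comm, hBV, hBφ]; module)
  rw [hBV] at hc1
  rw [hBφ] at hc2
  set g := (f m - f l) / (m - l)
  have hconj := star_left_conjugate_le_conjugate hle (α • (V * φ) + β • φ)
  have hws : star (α • (V * φ) + β • φ) = α • (φ * star V) + β • φ := by simp [hφ]
  have i1 : φ * star V * (V * φ) = φ * φ := by
    rw [mul_assoc, ← mul_assoc (star V), hEφ]
  have i2 : φ * star V * φ = 0 := by rw [mul_assoc, hVφ, mul_zero]
  have i3 : φ * (V * φ) = 0 := by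
    have := congrArg star i2
    simpa [hφ, mul_assoc] using this
  have hL : star (α • (V * φ) + β • φ) * aG * (α • (V * φ) + β • φ)
      = (α ^ 2 * gX + β ^ 2 * gY) • (φ * φ) := by
    rw [hws, mul_assoc, mul_add, mul_smul_comm, mul_smul_comm, ← mul_assoc aG, hGV, hGφ]
    simp only [add_mul, mul_add, smul_mul_assoc, mul_smul_comm, i1, i2, i3]
    module
  have hR : star (α • (V * φ) + β • φ) * cfc f B * (α • (V * φ) + β • φ)
      = (α ^ 2 * (f l + g * (v1 ^ 2 + X - l)) + 2 * (α * β) * (g * (v1 * v2))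
        + β ^ 2 * (f l + g * (v2 ^ 2 + Y - l))) • (φ * φ) := by
    rw [hws, mul_assoc, mul_add, mul_smul_comm, mul_smul_comm, hc1, hc2]
    simp only [add_mul, mul_add, mul_sub, smul_mul_assoc, mul_smul_comm, i1, i2, i3]
    module
  rw [hL, hR, ← sub_nonneg, ← sub_smul] at hconj
  have hφφ : 0 ≤ φ * φ := by
    have := star_mul_self_nonneg φ
    rwa [hφ] at this
  set q := (α ^ 2 * (f l + g * (v1 ^ 2 + X - l)) + 2 * (α * β) * (g * (v1 * v2))
        + β ^ 2 * (f l + g * (v2 ^ 2 + Y - l))) - (α ^ 2 * gX + β ^ 2 * gY) with hq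
  have hq0 : q < 0 := by rw [hq]; linarith
  have h3 : 0 ≤ (-q) • (φ * φ) := smul_nonneg (by linarith) hφφ
  have h4 : (-q) • (φ * φ) = 0 := by
    apply le_antisymm _ h3
    rw [neg_smul]; exact neg_nonpos.2 hconj
  have h5 : φ * φ = 0 := by
    rcases smul_eq_zero.1 h4 with h | h
    · linarith
    · exact h
  apply hφ0
  have : star φ * φ = 0 := by rw [hφ, h5]
  exact CStarRing.star_mul_self_eq_zero_iff φ |>.1 this

lemma aux_mean (I : Set ℝ) (hup : ∀ x ∈ I, ∀ y, x ≤ y → y ∈ I) (f f' : ℝ → ℝ)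
    (hderiv : ∀ x ∈ I, HasDerivAt f (f' x) x)
    (hpos : ∀ x ∈ I, 0 < f' x)
    (hmono : StrictMonoOn f' I)
    (hconc : ∀ x ∈ I, ∀ y ∈ I, ∀ t ∈ Set.Icc (0:ℝ) 1,
      t * Real.log (f' x) + (1 - t) * Real.log (f' y)
        ≤ Real.log (f' (t * x + (1 - t) * y)))
    (x y : ℝ) (hx : x ∈ I) (hxy : x < y) :
    f' x * f' y < ((f y - f x) / (y - x)) ^ 2 := by
  have hy : y ∈ I := hup x hx y hxy.le
  have hpx := hpos x hx
  have hpy := hpos y hy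
  set G := √(f' x * f' y) with hG
  have hGpos : 0 < G := Real.sqrt_pos.2 (by positivity)
  have hG2 : G ^ 2 = f' x * f' y := Real.sq_sqrt (by positivity)
  set c := (x + y) / 2 with hc
  set r := (y - x) / 2 with hr
  have hr0 : 0 < r := by rw [hr]; linarith
  have hmemp : ∀ s ∈ Set.Icc 0 r, c + s ∈ I := fun s hs =>
    hup x hx _ (by have := hs.1; linarith)
  have hmemm : ∀ s ∈ Set.Icc 0 r, c - s ∈ I := fun s hs =>
    hup x hx _ (by have := hs.2; linarith)
  have hd : ∀ s ∈ Set.Icc 0 r, HasDerivAt (fun s => f (c + s) - f (c - s) - 2 * G * s)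
      (f' (c + s) + f' (c - s) - 2 * G) s := by
    intro s hs
    have h1 := (hderiv _ (hmemp s hs)).comp s ((hasDerivAt_id s).const_add c)
    have h2 := (hderiv _ (hmemm s hs)).comp s ((hasDerivAt_id s).const_sub c)
    have h3 := (hasDerivAt_id s).const_mul (2 * G)
    have h4 := (h1.sub h2).sub h3
    refine HasDerivAt.congr_deriv (f := fun s => f (c + s) - f (c - s) - 2 * G * s) h4 ?_
    ring
  have hsm : StrictMonoOn (fun s => f (c + s) - f (c - s) - 2 * G * s) (Set.Icc 0 r) := by
    apply strictMonoOn_of_deriv_pos (convex_Icc 0 r)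
    · intro s hs
      exact (hd s hs).continuousAt.continuousWithinAt
    · intro s hs
      rw [interior_Icc] at hs
      have hs' : s ∈ Set.Icc 0 r := ⟨hs.1.le, hs.2.le⟩
      rw [(hd s hs').deriv]
      have hp := hmemp s hs'
      have hm := hmemm s hs'
      have hlt : f' (c - s) < f' (c + s) := hmono hm hp (by have := hs.1; linarith)
      have p1 := hpos _ hp
      have p2 := hpos _ hm
      set t := (r - s) / (2 * r) with ht
      have ht0 : 0 ≤ t := by rw [ht]; apply div_nonneg <;> linarith [hs.2]
      have ht1 : t ≤ 1 := by rw [ht, div_le_one (by linarith)]; linarith [hs.1]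
      have htr : t * (2 * r) = r - s := by rw [ht]; field_simp
      have e1 : t * x + (1 - t) * y = c + s := by
        have : t * x + (1 - t) * y = y - t * (2 * r) := by rw [hr]; ring
        rw [this, htr, hc, hr]; ring
      have e2 : t * y + (1 - t) * x = c - s := by
        have : t * y + (1 - t) * x = x + t * (2 * r) := by rw [hr]; ring
        rw [this, htr, hc, hr]; ring
      have c1 := hconc x hx y hy t ⟨ht0, ht1⟩
      have c2 := hconc y hy x hx t ⟨ht0, ht1⟩
      rw [e1] at c1
      rw [e2] at c2
      have hl : Real.log (f' x * f' y) ≤ Real.log (f' (c + s) * f' (c - s)) := by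
        rw [Real.log_mul hpx.ne' hpy.ne', Real.log_mul p1.ne' p2.ne']
        linarith
      have hl2 := (Real.log_le_log_iff (by positivity) (by positivity)).1 hl
      have : (2 * G) ^ 2 < (f' (c + s) + f' (c - s)) ^ 2 := by
        nlinarith [pow_pos (sub_pos.2 hlt) 2]
      have := lt_of_pow_lt_pow_left₀ 2 (by positivity) this
      linarith
  have h := hsm ⟨le_rfl, hr0.le⟩ ⟨hr0.le, le_rfl⟩ hr0
  have ey : c + r = y := by rw [hc, hr]; ring
  have ex : c - r = x := by rw [hc, hr]; ring
  simp only [add_zero, sub_zero, sub_self, mul_zero, ey, ex] at h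
  rw [← hG2]
  have hL : 0 < y - x := by linarith
  apply pow_lt_pow_left₀ _ hGpos.le two_ne_zero
  rw [lt_div_iff₀ hL]
  rw [hr] at h
  linarith

lemma aux_num (I : Set ℝ) (hop : IsOpen I) (hup : ∀ x ∈ I, ∀ y, x ≤ y → y ∈ I) (f f' : ℝ → ℝ)
    (hderiv : ∀ x ∈ I, HasDerivAt f (f' x) x)
    (hfm : StrictMonoOn f I)
    (x y : ℝ) (hx : x ∈ I) (hxy : x < y)
    (hdet : f' x * f' y < ((f y - f x) / (y - x)) ^ 2) :
    ∃ t v1 v2 α β δ : ℝ, 0 < t ∧ 0 < δ ∧ 2 * δ < y - x ∧ x - δ ∈ I ∧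
      v1 ^ 2 = t + t ^ 2 / (y - x) ∧ v2 ^ 2 = t - t ^ 2 / (y - x) ∧
      α ^ 2 * (f (x + t + δ) + (f (y + t + δ) - f (x + t + δ)) / (y - x) * (t ^ 2 / (y - x))
          - f (x - δ))
      + 2 * (α * β) * ((f (y + t + δ) - f (x + t + δ)) / (y - x) * (v1 * v2))
      + β ^ 2 * (f (x + t + δ) + (f (y + t + δ) - f (x + t + δ)) / (y - x)
          * ((y - x) - t ^ 2 / (y - x)) - f (y - δ)) < 0 := by
  have hL : 0 < y - x := by linarith
  have hy : y ∈ I := hup x hx y hxy.le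
  set L := y - x with hLdef
  have hfc : ∀ z ∈ I, ContinuousAt f z := fun z hz => (hderiv z hz).continuousAt
  -- choose t
  have tx : Tendsto (fun t => t⁻¹ * (f (x + t) - f x)) (𝓝[>] 0) (𝓝 (f' x)) := by
    have := (hderiv x hx).tendsto_slope_zero_right
    simpa using this
  have ty : Tendsto (fun t => t⁻¹ * (f (y + t) - f y)) (𝓝[>] 0) (𝓝 (f' y)) := by
    have := (hderiv y hy).tendsto_slope_zero_right
    simpa using this
  have tg : Tendsto (fun t => (f (y + t) - f (x + t)) / L) (𝓝[>] 0) (𝓝 ((f y - f x) / L)) := by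
    have h1 : ContinuousAt (fun t => (f (y + t) - f (x + t)) / L) 0 := by
      have a1 : ContinuousAt (fun t => f (y + t)) 0 :=
        ContinuousAt.comp (f := fun t => y + t) (by simpa using hfc y hy) (by fun_prop)
      have a2 : ContinuousAt (fun t => f (x + t)) 0 :=
        ContinuousAt.comp (f := fun t => x + t) (by simpa using hfc x hx) (by fun_prop)
      exact (a1.sub a2).div_const L
    have := h1.tendsto
    simp only [add_zero] at this
    exact this.mono_left nhdsWithin_le_nhds
  have tid : Tendsto (fun t : ℝ => t) (𝓝[>] 0) (𝓝 0) := tendsto_id.mono_left nhdsWithin_le_nhds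
  have tT : Tendsto (fun t => (t⁻¹ * (f (x + t) - f x) + (f (y + t) - f (x + t)) / L * (t / L))
      * (t⁻¹ * (f (y + t) - f y) - (f (y + t) - f (x + t)) / L * (t / L))
      - ((f (y + t) - f (x + t)) / L) ^ 2 * (1 - (t / L) ^ 2)) (𝓝[>] 0)
      (𝓝 ((f' x + (f y - f x) / L * (0 / L)) * (f' y - (f y - f x) / L * (0 / L))
        - ((f y - f x) / L) ^ 2 * (1 - (0 / L) ^ 2))) :=
    ((tx.add (tg.mul (tid.div_const L))).mul (ty.sub (tg.mul (tid.div_const L)))).sub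
      ((tg.pow 2).mul (((tid.div_const L).pow 2).const_sub 1))
  have ev1 := tT.eventually_lt_const (u := 0) (by simp; linarith)
  have ev2 : ∀ᶠ t in 𝓝[>] (0:ℝ), t < L := tid.eventually_lt_const hL
  obtain ⟨t, ⟨h1, h2⟩, (h3 : 0 < t)⟩ := ((ev1.and ev2).and self_mem_nhdsWithin).exists
  have hxt : x + t ∈ I := hup x hx _ (by linarith)
  have hyt : y + t ∈ I := hup y hy _ (by linarith)
  set g := (f (y + t) - f (x + t)) / L with hg
  have hgpos : 0 < g := div_pos (sub_pos.2 (hfm hxt hyt (by linarith))) hL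
  set Aa := t⁻¹ * (f (x + t) - f x) + g * (t / L) with hAa
  set Bb := t⁻¹ * (f (y + t) - f y) - g * (t / L) with hBb
  have hApos : 0 < Aa := by
    have := sub_pos.2 (hfm hx hxt (by linarith))
    positivity
  have hw1 : 0 ≤ t + t ^ 2 / L := by positivity
  have hw2 : 0 ≤ t - t ^ 2 / L := by
    rw [sub_nonneg, div_le_iff₀ hL]; nlinarith
  set v1 := √(t + t ^ 2 / L) with hv1
  set v2 := √(t - t ^ 2 / L) with hv2
  have s1 : v1 ^ 2 = t + t ^ 2 / L := Real.sq_sqrt hw1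
  have s2 : v2 ^ 2 = t - t ^ 2 / L := Real.sq_sqrt hw2
  set C := g * (v1 * v2) / t with hC
  have hC2 : C ^ 2 = g ^ 2 * (1 - (t / L) ^ 2) := by
    have : C ^ 2 = g ^ 2 * (v1 ^ 2 * v2 ^ 2) / t ^ 2 := by rw [hC]; ring
    rw [this, s1, s2]; field_simp; ring
  let Φ : ℝ → ℝ := fun δ =>
      C ^ 2 * (f (x + t + δ) + (f (y + t + δ) - f (x + t + δ)) / L * (t ^ 2 / L) - f (x - δ))
      + 2 * (C * (-Aa)) * ((f (y + t + δ) - f (x + t + δ)) / L * (v1 * v2))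
      + (-Aa) ^ 2 * (f (x + t + δ) + (f (y + t + δ) - f (x + t + δ)) / L
          * (L - t ^ 2 / L) - f (y - δ))
  have hΦ0 : Φ 0 < 0 := by
    have q1 : f (x + t) + g * (t ^ 2 / L) - f x = t * Aa := by rw [hAa]; field_simp; ring
    have q2 : g * (v1 * v2) = t * C := by rw [hC]; field_simp
    have q3 : f (x + t) + g * (L - t ^ 2 / L) - f y = t * Bb := by
      have : g * L = f (y + t) - f (x + t) := by rw [hg]; field_simp
      rw [hBb, mul_sub, this]; field_simp; ring
    simp only [Φ, add_zero, sub_zero]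
    rw [← hg, q1, q2, q3]
    have : C ^ 2 * (t * Aa) + 2 * (C * -Aa) * (t * C) + (-Aa) ^ 2 * (t * Bb)
        = (t * Aa) * (Aa * Bb - C ^ 2) := by ring
    rw [this, hC2]
    exact mul_neg_of_pos_of_neg (by positivity) h1
  have hΦc : ContinuousAt Φ 0 := by
    have a1 : ContinuousAt (fun δ => f (y + t + δ)) 0 :=
      ContinuousAt.comp (f := fun δ => y + t + δ) (by simpa using hfc _ hyt) (by fun_prop)
    have a2 : ContinuousAt (fun δ => f (x + t + δ)) 0 :=
      ContinuousAt.comp (f := fun δ => x + t + δ) (by simpa using hfc _ hxt) (by fun_prop)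
    have a3 : ContinuousAt (fun δ => f (y - δ)) 0 :=
      ContinuousAt.comp (f := fun δ => y - δ) (by simpa using hfc _ hy) (by fun_prop)
    have a4 : ContinuousAt (fun δ => f (x - δ)) 0 :=
      ContinuousAt.comp (f := fun δ => x - δ) (by simpa using hfc _ hx) (by fun_prop)
    have D := (a1.sub a2).div_const L
    exact ((continuousAt_const.mul ((a2.add (D.mul continuousAt_const)).sub a4)).add
      (continuousAt_const.mul (D.mul continuousAt_const))).add
      (continuousAt_const.mul ((a2.add (D.mul continuousAt_const)).sub a3))
  have e1 : ∀ᶠ δ in 𝓝[>] (0:ℝ), Φ δ < 0 :=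
    (hΦc.tendsto.mono_left nhdsWithin_le_nhds).eventually_lt_const hΦ0
  have e2 : ∀ᶠ δ in 𝓝[>] (0:ℝ), δ < L / 2 := tid.eventually_lt_const (by linarith)
  have e3 : ∀ᶠ δ in 𝓝[>] (0:ℝ), x - δ ∈ I := by
    have : Tendsto (fun δ : ℝ => x - δ) (𝓝[>] 0) (𝓝 x) := by
      simpa using tid.const_sub x
    exact this.eventually (hop.mem_nhds hx)
  obtain ⟨δ, ⟨⟨d1, d2⟩, d3⟩, (d4 : 0 < δ)⟩ := (((e1.and e2).and e3).and self_mem_nhdsWithin).exists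
  exact ⟨t, v1, v2, C, -Aa, δ, h3, d4, by linarith, d3, s1, s2, d1⟩

lemma aux_comm0 {A : Type*} [CStarAlgebra A] (a : A) (h : ∀ c : A, a * (a * c - c * a) = (a * c - c * a) * a)
    (ha : IsSelfAdjoint a) (c : A) : a * c = c * a := by
  set d := a * c - c * a with hd
  have hs : star d = star c * a - a * star c := by rw [hd, star_sub, star_mul, star_mul, ha.star_eq]
  have h1 := h c
  have h2 := h (star c)
  have h3 := h (c * star c)
  have h4 : d * star d + d * star d = 0 := by
    have e0 : a * (c * star c) - (c * star c) * a = d * star c - c * star d := by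
      rw [hs, hd]; noncomm_ring
    rw [e0] at h3
    have e1 : a * (star c * a - a * star c) = (star c * a - a * star c) * a := by
      rw [← neg_sub (a * star c) (star c * a), mul_neg, neg_mul, h2]
    rw [← hs] at e1
    have e2 : a * (d * star c - c * star d) - (d * star c - c * star d) * a
        = (a * d - d * a) * star c - c * (a * star d - star d * a)
          - (d * star d + d * star d) := by
      have k1 : d * star d = d * star c * a - d * a * star c := by rw [hs]; noncomm_ring
      have k2 : d * star d = a * c * star d - c * a * star d := by
        rw [show a * c * star d - c * a * star d = (a * c - c * a) * star d by noncomm_ring, ← hd]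
      conv_rhs => enter [2]; rw [k1]
      have : d * star c * a - d * a * star c + (d * star c * a - d * a * star c)
        = d * star c * a - d * a * star c + (a * c * star d - c * a * star d) := by
        rw [← k1, ← k2]
      rw [this]
      noncomm_ring
    rw [h3, sub_self, h1, sub_self, e1, sub_self] at e2
    rw [zero_mul, mul_zero, sub_zero, zero_sub] at e2
    exact neg_eq_zero.1 e2.symm
  have h5 : d * star d = 0 := by
    have : (2:ℝ) • (d * star d) = 0 := by rw [two_smul]; exact h4
    rcases smul_eq_zero.1 this with h | h
    · norm_num at h
    · exact h
  have h6 := (CStarRing.mul_star_self_eq_zero_iff d).1 h5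
  exact sub_eq_zero.1 h6

lemma aux_comm {A : Type*} [CStarAlgebra A] (a : A) (ha : IsSelfAdjoint a)
    (hZ : ∀ (r : ℝ) (u v : ℝ → ℝ), Continuous u → Continuous v → (∀ s ≤ r, u s = 0) →
      (∀ s, r ≤ s → v s = 0) → ∀ c : A, cfc u a * c * cfc v a = 0) (c : A) : a * c = c * a := by
  have hZ' : ∀ (r : ℝ) (u v : ℝ → ℝ), Continuous u → Continuous v → (∀ s ≤ r, u s = 0) →
      (∀ s, r ≤ s → v s = 0) → ∀ c : A, cfc v a * c * cfc u a = 0 := by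
    intro r u v hu hv h1 h2 c
    have h := congrArg star (hZ r u v hu hv h1 h2 (star c))
    have e1 : star (cfc u a) = cfc u a := (cfc_predicate u a : IsSelfAdjoint _)
    have e2 : star (cfc v a) = cfc v a := (cfc_predicate v a : IsSelfAdjoint _)
    simpa [e1, e2, mul_assoc] using h
  let F : ℝ → ℝ → ℝ → ℝ := fun l w s => max 0 (min (s - l) w)
  have hF : ∀ l w, Continuous (F l w) := fun l w => by simp only [F]; fun_prop
  have hsplit : ∀ l h, 0 ≤ h → ∀ s, F l (2 * h) s = F l h s + F (l + h) h s := by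
    intro l h h0 s
    simp only [F]
    rcases le_total (s - l) h with h1 | h1
    · have : s - (l + h) ≤ 0 := by linarith
      rw [min_eq_left h1, min_eq_left (by linarith : s - l ≤ 2 * h),
        min_eq_left (by linarith : s - (l + h) ≤ h), max_eq_left this, add_zero]
    · rw [min_eq_right h1, max_eq_right h0]
      rcases le_total (s - l) (2 * h) with h2 | h2
      · rw [min_eq_left h2, min_eq_left (by linarith), max_eq_right (by linarith),
          max_eq_right (by linarith)]; ring
      · rw [min_eq_right h2, min_eq_right (by linarith), max_eq_right (by linarith),
          max_eq_right (by linarith)]; ring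
  have key : ∀ (n : ℕ) (l w : ℝ), 0 ≤ w → ∀ c : A,
      ‖cfc (F l w) a * (cfc (F l w) a * c - c * cfc (F l w) a)
        - (cfc (F l w) a * c - c * cfc (F l w) a) * cfc (F l w) a‖ ≤ 4 * w ^ 2 * ‖c‖ / 2 ^ n := by
    intro n
    induction n with
    | zero =>
      intro l w hw c
      have hb : ‖cfc (F l w) a‖ ≤ w := by
        apply norm_cfc_le hw
        intro s _
        simp only [F]
        rw [Real.norm_of_nonneg (le_max_left _ _)]
        exact max_le hw (min_le_right _ _)
      set b := cfc (F l w) a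
      have hbc : ‖b * c - c * b‖ ≤ 2 * w * ‖c‖ := by
        calc ‖b * c - c * b‖ ≤ ‖b‖ * ‖c‖ + ‖c‖ * ‖b‖ :=
              (norm_sub_le _ _).trans (add_le_add (norm_mul_le _ _) (norm_mul_le _ _))
          _ ≤ w * ‖c‖ + ‖c‖ * w := by gcongr
          _ = _ := by ring
      calc ‖b * (b * c - c * b) - (b * c - c * b) * b‖
            ≤ ‖b‖ * ‖b * c - c * b‖ + ‖b * c - c * b‖ * ‖b‖ :=
              (norm_sub_le _ _).trans (add_le_add (norm_mul_le _ _) (norm_mul_le _ _))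
        _ ≤ w * (2 * w * ‖c‖) + (2 * w * ‖c‖) * w := by gcongr
        _ = _ := by ring
    | succ n ih =>
      intro l w hw c
      set h := w / 2 with hh
      have h0 : 0 ≤ h := by positivity
      have hw2 : w = 2 * h := by rw [hh]; ring
      have e : cfc (F l w) a = cfc (F l h) a + cfc (F (l + h) h) a := by
        rw [← cfc_add a (F l h) (F (l + h) h) ((hF _ _).continuousOn) ((hF _ _).continuousOn), hw2]
        exact cfc_congr fun s _ => hsplit l h h0 s
      have i1 := ih l h h0 c
      have i2 := ih (l + h) h h0 c
      have hsub : cfc (fun s => h - F l h s) a = algebraMap ℝ A h - cfc (F l h) a := by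
        rw [cfc_sub (fun _ => h) (F l h) a (by fun_prop) ((hF _ _).continuousOn), cfc_const h a ha]
      have z1 := hZ (l + h) (F (l + h) h) (fun s => h - F l h s) (hF _ _)
        (continuous_const.sub (hF _ _))
        (fun s hs => by
          simp only [F]; exact max_eq_left ((min_le_left _ _).trans (by linarith)))
        (fun s hs => by
          simp only [F]; rw [min_eq_right (by linarith), max_eq_right h0, sub_self])
      have z2 := hZ' (l + h) (F (l + h) h) (fun s => h - F l h s) (hF _ _)
        (continuous_const.sub (hF _ _))
        (fun s hs => by
          simp only [F]; exact max_eq_left ((min_le_left _ _).trans (by linarith)))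
        (fun s hs => by
          simp only [F]; rw [min_eq_right (by linarith), max_eq_right h0, sub_self])
      rw [hsub] at z1 z2
      rw [e]
      set b1 := cfc (F l h) a
      set b2 := cfc (F (l + h) h) a
      have y1 : ∀ c : A, b2 * c * b1 = h • (b2 * c) := by
        intro c
        have := z1 c
        rw [mul_sub, sub_eq_zero, Algebra.algebraMap_eq_smul_one, mul_smul_comm, mul_one] at this
        exact this.symm
      have y2 : ∀ c : A, b1 * c * b2 = h • (c * b2) := by
        intro c
        have := z2 c
        rw [sub_mul, sub_mul, sub_eq_zero, Algebra.algebraMap_eq_smul_one, smul_mul_assoc, one_mul,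
          smul_mul_assoc] at this
        exact this.symm
      have y3 : b2 * b1 = h • b2 := by simpa using y1 1
      have y4 : b1 * b2 = h • b2 := by simpa using y2 1
      have etot : (b1 + b2) * ((b1 + b2) * c - c * (b1 + b2))
          - ((b1 + b2) * c - c * (b1 + b2)) * (b1 + b2)
          = (b1 * (b1 * c - c * b1) - (b1 * c - c * b1) * b1)
          + (b2 * (b2 * c - c * b2) - (b2 * c - c * b2) * b2) := by
        have : (b1 + b2) * ((b1 + b2) * c - c * (b1 + b2))
          - ((b1 + b2) * c - c * (b1 + b2)) * (b1 + b2)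
          = (b1 * (b1 * c - c * b1) - (b1 * c - c * b1) * b1)
          + (b2 * (b2 * c - c * b2) - (b2 * c - c * b2) * b2)
          + ((b1 * b2) * c + (b2 * b1) * c + c * (b1 * b2) + c * (b2 * b1)
            - (b1 * c * b2 + b1 * c * b2) - (b2 * c * b1 + b2 * c * b1)) := by noncomm_ring
        rw [this, y1, y2, y3, y4]
        simp only [smul_mul_assoc, mul_smul_comm]
        module
      rw [etot]
      calc _ ≤ _ := norm_add_le _ _
        _ ≤ 4 * h ^ 2 * ‖c‖ / 2 ^ n + 4 * h ^ 2 * ‖c‖ / 2 ^ n := add_le_add i1 i2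
        _ = _ := by rw [hw2, pow_succ]; field_simp; ring
  -- apply to a
  obtain ⟨l, hl⟩ : ∃ l : ℝ, ∀ s ∈ spectrum ℝ a, l ≤ s := by
    obtain ⟨l, hl⟩ := (ContinuousFunctionalCalculus.isCompact_spectrum (R := ℝ) a).bddBelow
    exact ⟨l, fun s hs => hl hs⟩
  obtain ⟨m, hm⟩ : ∃ l : ℝ, ∀ s ∈ spectrum ℝ a, s ≤ l := by
    obtain ⟨l, hl⟩ := (ContinuousFunctionalCalculus.isCompact_spectrum (R := ℝ) a).bddAbove
    exact ⟨l, fun s hs => hl hs⟩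
  have hae : cfc (F l (max 0 (m - l))) a = a - algebraMap ℝ A l := by
    have h1 : a - algebraMap ℝ A l = cfc (fun s : ℝ => s - l) a := by
      rw [cfc_sub (fun s => s) (fun _ => l) a (by fun_prop) (by fun_prop), cfc_const l a ha,
        cfc_id' ℝ a ha]
    rw [h1]
    apply cfc_congr
    intro s hs
    simp only [F]
    rw [min_eq_left ((sub_le_sub_right (hm s hs) l).trans (le_max_right _ _)),
      max_eq_right (sub_nonneg.2 (hl s hs))]
  apply aux_comm0 a _ ha
  intro c
  have hb := fun n => key n l (max 0 (m - l)) (le_max_left _ _) c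
  rw [hae] at hb
  have hcomm : ∀ c : A, (a - algebraMap ℝ A l) * c - c * (a - algebraMap ℝ A l) = a * c - c * a := by
    intro c
    rw [sub_mul, mul_sub, Algebra.commutes l c]; abel
  rw [hcomm c, hcomm] at hb
  rw [← sub_eq_zero, ← norm_le_zero_iff]
  refine ge_of_tendsto' (x := atTop) (f := fun n : ℕ => 4 * (max 0 (m - l)) ^ 2 * ‖c‖ / 2 ^ n) ?_ hb
  exact tendsto_const_nhds.div_atTop (tendsto_pow_atTop_atTop_of_one_lt (by norm_num))

lemma aux_div {A : Type*} [CStarAlgebra A] (a : A) (K : Set ℝ) (hK : IsCompact K)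
    (u g : ℝ → ℝ) (hu : Continuous u) (hg : Continuous g)
    (hgK : ∀ s ∈ K, 0 < g s) (huK : ∀ s ∈ spectrum ℝ a, s ∉ K → u s = 0) :
    ∃ k : A, cfc u a = k * cfc g a ∧ cfc u a = cfc g a * k := by
  obtain ⟨μ, hμ, hμK⟩ := hK.exists_forall_le' hg.continuousOn hgK
  have hc : Continuous (fun s => u s / max (g s) μ) :=
    hu.div (hg.max continuous_const) fun s => (lt_max_of_lt_right hμ).ne'
  refine ⟨cfc (fun s => u s / max (g s) μ) a, ?_, ?_⟩
  · rw [← cfc_mul _ g a hc.continuousOn hg.continuousOn]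
    apply cfc_congr
    intro s hs
    simp only
    by_cases h : s ∈ K
    · rw [max_eq_left (hμK s h), div_mul_cancel₀ _ (hgK s h).ne']
    · rw [huK s hs h]; simp
  · rw [← cfc_mul g _ a hg.continuousOn hc.continuousOn]
    apply cfc_congr
    intro s hs
    simp only
    by_cases h : s ∈ K
    · rw [max_eq_left (hμK s h), mul_div_cancel₀ _ (hgK s h).ne']
    · rw [huK s hs h]; simp

lemma aux_loc {A : Type*} [CStarAlgebra A] (a : A)
    (hN : ∀ x ∈ spectrum ℝ a, ∀ y ∈ spectrum ℝ a, y < x → ∃ δ > 0, ∀ c : A,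
      cfc (fun s => max 0 (δ - |s - x|)) a * c * cfc (fun s => max 0 (δ - |s - y|)) a = 0)
    (r r' : ℝ) (hr : r < r') (u v : ℝ → ℝ) (hu : Continuous u) (hv : Continuous v)
    (hu0 : ∀ s ≤ r', u s = 0) (hv0 : ∀ s, r ≤ s → v s = 0) (c : A) :
    cfc u a * c * cfc v a = 0 := by
  have hbc : ∀ δ x : ℝ, Continuous (fun s : ℝ => max 0 (δ - |s - x|)) := fun δ x => by fun_prop
  have hσ := ContinuousFunctionalCalculus.isCompact_spectrum (R := ℝ) a
  have hK1 : IsCompact (spectrum ℝ a ∩ Set.Ici r') := hσ.inter_right isClosed_Ici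
  have hK2 : IsCompact (spectrum ℝ a ∩ Set.Iic r) := hσ.inter_right isClosed_Iic
  have inner : ∀ y ∈ spectrum ℝ a ∩ Set.Iic r, ∃ δ > 0, ∀ c : A,
      cfc u a * c * cfc (fun s => max 0 (δ - |s - y|)) a = 0 := by
    intro y hy
    have : ∃ δ > 0, ∃ g : ℝ → ℝ, Continuous g ∧ (∀ s, 0 ≤ g s) ∧
        (∀ s ∈ spectrum ℝ a ∩ Set.Ici r', 0 < g s) ∧
        ∀ c : A, cfc g a * c * cfc (fun s => max 0 (δ - |s - y|)) a = 0 := by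
      refine hK1.induction_on (p := fun S => ∃ δ > 0, ∃ g : ℝ → ℝ, Continuous g ∧ (∀ s, 0 ≤ g s) ∧
        (∀ s ∈ S, 0 < g s) ∧
        ∀ c : A, cfc g a * c * cfc (fun s => max 0 (δ - |s - y|)) a = 0) ?_ ?_ ?_ ?_
      · exact ⟨1, one_pos, fun _ => 0, continuous_const, fun _ => le_rfl, by simp, by simp⟩
      · rintro S T hST ⟨δ, hδ, g, h1, h2, h3, h4⟩
        exact ⟨δ, hδ, g, h1, h2, fun s hs => h3 s (hST hs), h4⟩
      · rintro S T ⟨δ, hδ, g, h1, h2, h3, h4⟩ ⟨δ', hδ', g', h1', h2', h3', h4'⟩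
        have hshr : ∀ ε, min δ δ' ≤ ε → ∃ k : A,
            cfc (fun s => max 0 (min δ δ' / 2 - |s - y|)) a
              = cfc (fun s => max 0 (ε - |s - y|)) a * k := by
          intro ε hε
          have hm : 0 < min δ δ' := lt_min hδ hδ'
          obtain ⟨k, -, hk⟩ := aux_div a (Metric.closedBall y (min δ δ' / 2))
            (isCompact_closedBall _ _) _ _ (hbc (min δ δ' / 2) y) (hbc ε y)
            (fun s hs => by
              rw [Metric.mem_closedBall, Real.dist_eq] at hs
              exact lt_max_of_lt_right (by linarith))
            (fun s _ hs => by
              rw [Metric.mem_closedBall, Real.dist_eq] at hs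
              exact max_eq_left (by linarith))
          exact ⟨k, hk⟩
        refine ⟨min δ δ' / 2, half_pos (lt_min hδ hδ'), fun s => g s + g' s, h1.add h1',
          fun s => add_nonneg (h2 s) (h2' s), ?_, ?_⟩
        · rintro s (hs | hs)
          · exact add_pos_of_pos_of_nonneg (h3 s hs) (h2' s)
          · exact add_pos_of_nonneg_of_pos (h2 s) (h3' s hs)
        · intro c
          rw [cfc_add a g g' h1.continuousOn h1'.continuousOn, add_mul, add_mul]
          obtain ⟨k, hk⟩ := hshr δ (min_le_left _ _)
          obtain ⟨k', hk'⟩ := hshr δ' (min_le_right _ _)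
          have e1 := h4 c
          have e2 := h4' c
          nth_rewrite 1 [hk]
          rw [hk', ← mul_assoc, e1, ← mul_assoc, e2]
          simp
      · intro x hx
        obtain ⟨δ, hδ, h⟩ := hN x hx.1 y hy.1 (lt_of_le_of_lt hy.2 (lt_of_lt_of_le hr hx.2))
        refine ⟨Metric.ball x δ, mem_nhdsWithin_of_mem_nhds (Metric.ball_mem_nhds x hδ), δ, hδ,
          _, hbc δ x, fun s => le_max_left _ _, fun s hs => ?_, h⟩
        rw [Metric.mem_ball, Real.dist_eq] at hs
        exact lt_max_of_lt_right (by linarith)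
    obtain ⟨δ, hδ, g, h1, h2, h3, h4⟩ := this
    refine ⟨δ, hδ, fun c => ?_⟩
    obtain ⟨k, hk, -⟩ := aux_div a _ hK1 u g hu h1 h3 (fun s hs hs' => hu0 s (by
      by_contra hlt
      exact hs' ⟨hs, (not_le.1 hlt).le⟩))
    rw [hk, mul_assoc, mul_assoc, ← mul_assoc (cfc g a), h4, mul_zero]
  have : ∃ g : ℝ → ℝ, Continuous g ∧ (∀ s, 0 ≤ g s) ∧
        (∀ s ∈ spectrum ℝ a ∩ Set.Iic r, 0 < g s) ∧
        ∀ c : A, cfc u a * c * cfc g a = 0 := by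
    refine hK2.induction_on (p := fun S => ∃ g : ℝ → ℝ, Continuous g ∧ (∀ s, 0 ≤ g s) ∧
        (∀ s ∈ S, 0 < g s) ∧ ∀ c : A, cfc u a * c * cfc g a = 0) ?_ ?_ ?_ ?_
    · exact ⟨fun _ => 0, continuous_const, fun _ => le_rfl, by simp, by simp⟩
    · rintro S T hST ⟨g, h1, h2, h3, h4⟩
      exact ⟨g, h1, h2, fun s hs => h3 s (hST hs), h4⟩
    · rintro S T ⟨g, h1, h2, h3, h4⟩ ⟨g', h1', h2', h3', h4'⟩
      refine ⟨fun s => g s + g' s, h1.add h1',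
          fun s => add_nonneg (h2 s) (h2' s), ?_, ?_⟩
      · rintro s (hs | hs)
        · exact add_pos_of_pos_of_nonneg (h3 s hs) (h2' s)
        · exact add_pos_of_nonneg_of_pos (h2 s) (h3' s hs)
      · intro c
        rw [cfc_add a g g' h1.continuousOn h1'.continuousOn, mul_add, h4, h4', add_zero]
    · intro y hy
      obtain ⟨δ, hδ, h⟩ := inner y hy
      refine ⟨Metric.ball y δ, mem_nhdsWithin_of_mem_nhds (Metric.ball_mem_nhds y hδ),
          _, hbc δ y, fun s => le_max_left _ _, fun s hs => ?_, h⟩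
      rw [Metric.mem_ball, Real.dist_eq] at hs
      exact lt_max_of_lt_right (by linarith)
  obtain ⟨g, h1, h2, h3, h4⟩ := this
  obtain ⟨k, -, hk⟩ := aux_div a _ hK2 v g hv h1 h3 (fun s hs hs' => hv0 s (by
      by_contra hlt
      exact hs' ⟨hs, (not_le.1 hlt).le⟩))
  rw [hk, ← mul_assoc, h4, zero_mul]

lemma aux_pair {A : Type*} [CStarAlgebra A] (a : A) (ha : IsSelfAdjoint a)
    (hnc : ∃ a' : A, a * a' ≠ a' * a) :
    ∃ x ∈ spectrum ℝ a, ∃ y ∈ spectrum ℝ a, x < y ∧ ∀ δ > 0, ∃ c : A,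
      cfc (fun s => max 0 (δ - |s - x|)) a * c * cfc (fun s => max 0 (δ - |s - y|)) a ≠ 0 := by
  by_contra hcon
  push Not at hcon
  obtain ⟨a', ha'⟩ := hnc
  apply ha'
  have hN : ∀ x ∈ spectrum ℝ a, ∀ y ∈ spectrum ℝ a, y < x → ∃ δ > 0, ∀ c : A,
      cfc (fun s => max 0 (δ - |s - x|)) a * c * cfc (fun s => max 0 (δ - |s - y|)) a = 0 := by
    intro x hx y hy hxy
    obtain ⟨δ, hδ, h⟩ := hcon y hy x hx hxy
    refine ⟨δ, hδ, fun c => ?_⟩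
    have := congrArg star (h (star c))
    have e1 : star (cfc (fun s => max 0 (δ - |s - x|)) a) = cfc (fun s => max 0 (δ - |s - x|)) a :=
      (cfc_predicate _ a : IsSelfAdjoint _)
    have e2 : star (cfc (fun s => max 0 (δ - |s - y|)) a) = cfc (fun s => max 0 (δ - |s - y|)) a :=
      (cfc_predicate _ a : IsSelfAdjoint _)
    rw [star_mul, star_mul, e1, e2, star_star, star_zero, ← mul_assoc] at this
    exact this
  refine aux_comm a ha ?_ a'
  intro r u v hu hv hu0 hv0 c
  rw [← norm_le_zero_iff]
  refine le_of_forall_pos_le_add fun ε hε => ?_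
  rw [zero_add]
  set M := ‖c‖ * ‖cfc v a‖ with hM
  have hM0 : 0 ≤ M := by positivity
  set η := ε / (M + 1) with hη
  have hη0 : 0 < η := by positivity
  let u' : ℝ → ℝ := fun s => u s - max (-η) (min (u s) η)
  have hu' : Continuous u' := by simp only [u']; fun_prop
  obtain ⟨ρ, hρ, hball⟩ := Metric.continuousAt_iff.1 (hu.continuousAt (x := r)) η hη0
  have hz : ∀ s ≤ r + ρ / 2, u' s = 0 := by
    intro s hs
    have : |u s| ≤ η := by
      rcases le_total s r with h | h
      · rw [hu0 s h]; simpa using hη0.le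
      · have := hball (x := s) (by rw [Real.dist_eq, abs_of_nonneg (by linarith)]; linarith)
        rw [hu0 r le_rfl, Real.dist_eq, sub_zero] at this
        exact this.le
    have := abs_le.1 this
    simp only [u']
    rw [min_eq_left this.2, max_eq_right this.1, sub_self]
  have h0 := aux_loc a hN r (r + ρ / 2) (by linarith) u' v hu' hv hz hv0 c
  have hd : ‖cfc u a - cfc u' a‖ ≤ η := by
    rw [← cfc_sub u u' a hu.continuousOn hu'.continuousOn]
    apply norm_cfc_le hη0.le
    intro s _
    simp only [u', sub_sub_cancel]
    rw [Real.norm_eq_abs, abs_le]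
    exact ⟨le_max_left _ _, max_le (by linarith) (min_le_right _ _)⟩
  have e : cfc u a * c * cfc v a = (cfc u a - cfc u' a) * c * cfc v a := by
    rw [sub_mul, sub_mul, h0, sub_zero]
  rw [e]
  calc _ ≤ ‖cfc u a - cfc u' a‖ * ‖c‖ * ‖cfc v a‖ :=
        (norm_mul_le _ _).trans (by gcongr; exact norm_mul_le _ _)
    _ ≤ η * ‖c‖ * ‖cfc v a‖ := by gcongr
    _ = η * M := by rw [hM, mul_assoc]
    _ ≤ η * (M + 1) := by gcongr; linarith
    _ = ε := by rw [hη]; field_simp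

lemma aux_const {A : Type*} [CStarAlgebra A] (a : A) (F p : ℝ → ℝ) (k : ℝ)
    (hF : ContinuousOn F (spectrum ℝ a)) (hp : Continuous p) (h : ∀ s, p s ≠ 0 → F s = k) (c : A) :
    cfc F a * (cfc p a * c) = k • (cfc p a * c) := by
  rw [← mul_assoc, ← cfc_mul F p a hF hp.continuousOn, ← smul_mul_assoc,
    ← cfc_smul k p a hp.continuousOn]
  congr 1
  apply cfc_congr
  intro s _
  simp only [smul_eq_mul]
  by_cases hs : p s = 0
  · rw [hs]; simp
  · rw [h s hs]

lemma aux_spec {A : Type*} [CStarAlgebra A] [PartialOrder A] [StarOrderedRing A]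
    (I : Set ℝ) (hup : ∀ x ∈ I, ∀ y, x ≤ y → y ∈ I) (a b : A) (ha : IsSelfAdjoint a)
    (hb : IsSelfAdjoint b) (hab : a ≤ b) (h : spectrum ℝ a ⊆ I) : spectrum ℝ b ⊆ I := by
  intro s hs
  have : Nontrivial A := by
    by_contra hA
    rw [not_nontrivial_iff_subsingleton] at hA
    simp [spectrum.of_subsingleton] at hs
  have hc := ContinuousFunctionalCalculus.isCompact_spectrum (R := ℝ) a
  obtain ⟨m, hm, hmin⟩ := hc.exists_isLeast (CFC.spectrum_nonempty ℝ a ha)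
  have h1 : algebraMap ℝ A m ≤ a := algebraMap_le_of_le_spectrum (fun x hx => hmin hx) ha
  have h2 := (algebraMap_le_iff_le_spectrum hb).1 (h1.trans hab)
  exact hup m (h hm) s (h2 s hs)

/-- If `a` is a non-central self-adjoint element with spectrum in `I = (γ, ∞)`, and `f` is
continuously differentiable on `I` with positive, strictly increasing, log-concave derivative,
then there is a self-adjoint `b` with spectrum in `I` such that `a ≤ b` but `f(a) ≤ f(b)`
fails. -/
theorem exists_not_cfc_le_of_not_central
    {A : Type*} [CStarAlgebra A] [PartialOrder A] [StarOrderedRing A]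
    (γ : EReal) (hγ : γ ≠ ⊤) (I : Set ℝ) (hI : I = {x : ℝ | γ < (x : EReal)})
    (f f' : ℝ → ℝ)
    (hderiv : ∀ x ∈ I, HasDerivAt f (f' x) x)
    (hcont : ContinuousOn f' I)
    (hpos : ∀ x ∈ I, 0 < f' x)
    (hmono : StrictMonoOn f' I)
    (hconc : ∀ x ∈ I, ∀ y ∈ I, ∀ t ∈ Set.Icc (0:ℝ) 1,
      t * Real.log (f' x) + (1 - t) * Real.log (f' y)
        ≤ Real.log (f' (t * x + (1 - t) * y)))
    (a : A) (ha : IsSelfAdjoint a) (haspec : spectrum ℝ a ⊆ I)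
    (hnc : ∃ a' : A, a * a' ≠ a' * a) :
    ∃ b : A, IsSelfAdjoint b ∧ spectrum ℝ b ⊆ I ∧ a ≤ b ∧ ¬ cfc f a ≤ cfc f b := by
  have hop : IsOpen I := by
    rw [hI]
    exact isOpen_lt continuous_const continuous_coe_real_ereal
  have hup : ∀ x ∈ I, ∀ y, x ≤ y → y ∈ I := by
    intro x hx y hxy
    rw [hI] at hx ⊢
    exact lt_of_lt_of_le hx (EReal.coe_le_coe_iff.2 hxy)
  have hfcI : ContinuousOn f I := fun z hz => (hderiv z hz).continuousAt.continuousWithinAt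
  have hconv : Convex ℝ I :=
    Set.OrdConnected.convex ⟨fun x hx y _ z hz => hup x hx z hz.1⟩
  have hfm : StrictMonoOn f I := by
    apply strictMonoOn_of_deriv_pos hconv hfcI
    intro z hz
    rw [(hderiv z (interior_subset hz)).deriv]
    exact hpos z (interior_subset hz)
  obtain ⟨x, hxσ, y, hyσ, hxy, hpair⟩ := aux_pair a ha hnc
  have hx := haspec hxσ
  have hy := haspec hyσ
  have hdet := aux_mean I hup f f' hderiv hpos hmono hconc x y hx hxy
  obtain ⟨t, v1, v2, α, β, δ, ht, hδ, hδL, hxδ, hv1, hv2, hneg⟩ :=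
    aux_num I hop hup f f' hderiv hfm x y hx hxy hdet
  obtain ⟨c, hc⟩ := hpair δ hδ
  have hbc : ∀ z : ℝ, Continuous (fun s : ℝ => max 0 (δ - |s - z|)) := fun z => by fun_prop
  have hnear : ∀ z s : ℝ, max 0 (δ - |s - z|) ≠ 0 → z - δ ≤ s ∧ s ≤ z + δ := by
    intro z s h
    have : |s - z| ≤ δ := by
      by_contra hlt
      exact h (max_eq_left (by linarith))
    have := abs_le.1 this
    constructor <;> linarith
  set P := cfc (fun s => max 0 (δ - |s - x|)) a with hP
  set Q := cfc (fun s => max 0 (δ - |s - y|)) a with hQ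
  have hPs : star P = P := (cfc_predicate _ a : IsSelfAdjoint _)
  have hQs : star Q = Q := (cfc_predicate _ a : IsSelfAdjoint _)
  have hQP : Q * P = 0 := by
    have := aux_const a (fun s => max 0 (δ - |s - y|)) _ 0 (hbc y).continuousOn (hbc x)
      (fun s hs => by
        by_contra h
        have h1 := hnear x s hs
        have h2 := hnear y s h
        linarith [h1.2, h2.1]) 1
    simpa using this
  obtain ⟨V, φ, k1, k2, hV, hφ, hEφ, hEV, hφs, hφ0⟩ := aux_polar (P * c * Q) hc (by
    calc P * c * Q * (P * c * Q) = P * c * (Q * P) * c * Q := by simp only [mul_assoc]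
      _ = 0 := by rw [hQP]; simp)
  have hV' : V = P * (c * Q * k1) := by rw [hV]; simp only [mul_assoc]
  have hφ' : φ = Q * (star c * P * k2) := by
    rw [hφ]; simp only [star_mul, hPs, hQs, mul_assoc]
  set κ := (y - x) / (y - x - 2 * δ) with hκ
  have hκ0 : 0 < κ := div_pos (by linarith) (by linarith)
  have hκ1 : κ * (y - x - 2 * δ) = y - x := div_mul_cancel₀ _ (by linarith)
  let F : ℝ → ℝ := fun s => max s (min (y + δ) (max (x + δ) (x + δ + κ * (s - (x + δ)))))
  let G : ℝ → ℝ := fun s => min s (max (x - δ) (min (y - δ) (x - δ + κ * (s - (x + δ)))))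
  have hFc : Continuous F := by simp only [F]; fun_prop
  have hGc : Continuous G := by simp only [G]; fun_prop
  have hFx : ∀ s, max 0 (δ - |s - x|) ≠ 0 → F s = x + δ := by
    intro s hs
    obtain ⟨h1, h2⟩ := hnear x s hs
    have : κ * (s - (x + δ)) ≤ 0 := mul_nonpos_of_nonneg_of_nonpos hκ0.le (by linarith)
    simp only [F]
    rw [max_eq_left (by linarith : x + δ + κ * (s - (x + δ)) ≤ x + δ),
      min_eq_right (by linarith), max_eq_right h2]
  have hGx : ∀ s, max 0 (δ - |s - x|) ≠ 0 → G s = x - δ := by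
    intro s hs
    obtain ⟨h1, h2⟩ := hnear x s hs
    have : κ * (s - (x + δ)) ≤ 0 := mul_nonpos_of_nonneg_of_nonpos hκ0.le (by linarith)
    simp only [G]
    rw [max_eq_left ((min_le_right _ _).trans (by linarith)), min_eq_right h1]
  have hFy : ∀ s, max 0 (δ - |s - y|) ≠ 0 → F s = y + δ := by
    intro s hs
    obtain ⟨h1, h2⟩ := hnear y s hs
    have : y - x ≤ κ * (s - (x + δ)) := by
      rw [← hκ1]; exact mul_le_mul_of_nonneg_left (by linarith) hκ0.le
    simp only [F]
    rw [min_eq_left ((by linarith : y + δ ≤ x + δ + κ * (s - (x + δ))).trans (le_max_right _ _)),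
      max_eq_right h2]
  have hGy : ∀ s, max 0 (δ - |s - y|) ≠ 0 → G s = y - δ := by
    intro s hs
    obtain ⟨h1, h2⟩ := hnear y s hs
    have : y - x ≤ κ * (s - (x + δ)) := by
      rw [← hκ1]; exact mul_le_mul_of_nonneg_left (by linarith) hκ0.le
    simp only [G]
    rw [min_eq_left (by linarith : y - δ ≤ x - δ + κ * (s - (x + δ))), max_eq_right (by linarith),
      min_eq_right h1]
  have hGI : ∀ s ∈ I, G s ∈ I := by
    intro s hs
    rcases min_choice s (max (x - δ) (min (y - δ) (x - δ + κ * (s - (x + δ))))) with h | h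
    · simp only [G]; rw [h]; exact hs
    · simp only [G]; rw [h]; exact hup _ hxδ _ (le_max_left _ _)
  have hfGc : ContinuousOn (fun s => f (G s)) (spectrum ℝ a) :=
    hfcI.comp hGc.continuousOn (fun s hs => hGI s (haspec hs))
  set z := v1 • V + v2 • (star V * V) with hz
  have hFa : a ≤ cfc F a := by
    conv_lhs => rw [← cfc_id' ℝ a ha]
    exact cfc_mono (fun s _ => le_max_left _ _) (by fun_prop) hFc.continuousOn
  have hle : a ≤ cfc F a + z * star z := hFa.trans (le_add_of_nonneg_right (mul_star_self_nonneg z))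
  have hsa : IsSelfAdjoint (cfc F a + z * star z) :=
    IsSelfAdjoint.add (cfc_predicate F a) (IsSelfAdjoint.mul_star_self z)
  have hspec := aux_spec I hup a _ ha hsa hle haspec
  refine ⟨cfc F a + z * star z, hsa, hspec, hle, fun hcon => ?_⟩
  have hGa : cfc (fun s => f (G s)) a ≤ cfc f a :=
    cfc_mono (fun s hs => hfm.monotoneOn (hGI s (haspec hs)) (haspec hs) (min_le_left _ _))
      hfGc (hfcI.mono haspec)
  have hml : y + t + δ - (x + t + δ) = y - x := by ring
  have hLne : y - x ≠ 0 := by linarith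
  refine aux_fin V φ (cfc F a) (cfc (fun s => f (G s)) a) (x + δ) (y + δ) (f (x - δ)) (f (y - δ))
    v1 v2 (x + t + δ) (y + t + δ) α β f hEφ hEV hφs hφ0 ?_ ?_ ?_ ?_ (by linarith) ?_ ?_ ?_ _ rfl hsa
    (hfcI.mono hspec) (hGa.trans hcon)
  · rw [hV']; exact aux_const a F _ _ hFc.continuousOn (hbc x) hFx _
  · rw [hφ']; exact aux_const a F _ _ hFc.continuousOn (hbc y) hFy _
  · rw [hV']; exact aux_const a _ _ _ hfGc (hbc x) (fun s hs => by rw [hGx s hs]) _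
  · rw [hφ']; exact aux_const a _ _ _ hfGc (hbc y) (fun s hs => by rw [hGy s hs]) _
  · rw [hv1, hv2]; ring
  · rw [mul_pow, hv1, hv2]
    have hq : t ^ 2 / (y - x) * (y - x) = t ^ 2 := div_mul_cancel₀ _ hLne
    generalize t ^ 2 / (y - x) = q at hq
    linear_combination hq
  · rw [hml]
    have e1 : v1 ^ 2 + (x + δ) - (x + t + δ) = t ^ 2 / (y - x) := by rw [hv1]; ring
    have e2 : v2 ^ 2 + (y + δ) - (x + t + δ) = (y - x) - t ^ 2 / (y - x) := by rw [hv2]; ring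
    rw [e1, e2]
    exact hneg
end

section
/- Let p > 1 be a real number, let A be a unital C*-algebra, and let a ∈ A be a positive invertible element (self-adjoint with spectrum contained in (0, ∞)). Then a is central (ab = ba for all b ∈ A) if and only if for every positive invertible b ∈ A, a ≤ b implies a^p ≤ b^p. -/
theorem aux_forward {A : Type*} [CStarAlgebra A] [PartialOrder A] [StarOrderedRing A]
    (p : ℝ) (hp : 0 < p) (a b : A) (ha : IsSelfAdjoint a)
    (haspec : spectrum ℝ a ⊆ Set.Ioi (0 : ℝ)) (hb : IsSelfAdjoint b)
    (hbspec : spectrum ℝ b ⊆ Set.Ioi (0 : ℝ)) (hab : a ≤ b) (hc : Commute a b) :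
    cfc (fun t : ℝ => t ^ p) a ≤ cfc (fun t : ℝ => t ^ p) b := by
  have key : ∀ (q : ℝ) (x : A), IsSelfAdjoint x → spectrum ℝ x ⊆ Set.Ioi (0 : ℝ) →
      cfc (fun t : ℝ => t ^ q) x = NormedSpace.exp (q • CFC.log x) := by
    intro q x hx hs
    have hlog : ContinuousOn Real.log (spectrum ℝ x) := 
      Real.continuousOn_log.mono fun t ht => (hs ht).ne'
    have hl : IsSelfAdjoint (q • CFC.log x) := (IsSelfAdjoint.all q).smul IsSelfAdjoint.log
    rw [← CFC.real_exp_eq_normedSpace_exp hl, CFC.log, ← cfc_smul q Real.log x hlog,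
      ← cfc_comp' Real.exp (fun t => q • Real.log t) x (by fun_prop) (by fun_prop)]
    refine cfc_congr fun t ht => ?_
    have : 0 < t := hs ht
    simp [Real.rpow_def_of_pos this, mul_comm]
  have hsa : IsStrictlyPositive a :=
    (StarOrderedRing.isStrictlyPositive_iff_spectrum_pos (R := ℝ) a ha).2 fun x hx => haspec hx
  have hlog := CFC.log_le_log hab hsa
  have hcl : Commute (CFC.log a) (CFC.log b) := by
    unfold CFC.log
    exact ((hc.cfc_real _).symm.cfc_real _).symm
  rw [key p a ha haspec, key p b hb hbspec]
  set la := CFC.log a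
  set lb := CFC.log b
  have hla : IsSelfAdjoint la := IsSelfAdjoint.log
  have hlb : IsSelfAdjoint lb := IsSelfAdjoint.log
  set E := p • (lb - la) with hE
  have hEsa : IsSelfAdjoint E := (IsSelfAdjoint.all p).smul (hlb.sub hla)
  have hE0 : 0 ≤ E := smul_nonneg hp.le (sub_nonneg.2 hlog)
  have hE1 : 1 ≤ NormedSpace.exp E := by
    rw [← CFC.real_exp_eq_normedSpace_exp hEsa]
    refine one_le_cfc _ _ fun x hx => ?_
    exact Real.one_le_exp (spectrum_nonneg_of_nonneg hE0 hx)
  set h := (p / 2) • la with hh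
  have hhsa : IsSelfAdjoint h := (IsSelfAdjoint.all _).smul hla
  have h1 : p • la = h + h := by rw [hh, ← add_smul]; congr 1; ring
  have h2 : p • lb = h + E + h := by
    rw [add_right_comm, ← h1, hE, smul_sub]; abel
  have hcE : Commute h E := by
    apply Commute.smul_left; apply Commute.smul_right
    exact hcl.sub_right (Commute.refl _)
  have hQ : IsSelfAdjoint (NormedSpace.exp h) := hhsa.exp_nonneg.isSelfAdjoint
  have hadd : ∀ x y : A, Commute x y →
      NormedSpace.exp (x + y) = NormedSpace.exp x * NormedSpace.exp y := by
    intro x y hxy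
    letI : NormedAlgebra ℚ A := NormedAlgebra.restrictScalars ℚ ℝ A
    exact NormedSpace.exp_add_of_commute hxy
  rw [h2, h1, hadd _ _ ((Commute.refl h).add_left hcE.symm), hadd _ _ hcE,
    hadd _ _ (Commute.refl h)]
  have := hQ.conjugate_le_conjugate hE1
  simpa using this

theorem aux_intertwine {A : Type*} [CStarAlgebra A] (f : ℝ → ℝ) (hf : Continuous f) (x y w : A)
    (hx : IsSelfAdjoint x) (hy : IsSelfAdjoint y) (h : x * w = w * y) :
    cfc f x * w = w * cfc f y := by
  have hpow : ∀ n : ℕ, x ^ n * w = w * y ^ n := by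
    intro n
    induction n with
    | zero => simp
    | succ n ih => rw [pow_succ, mul_assoc, h, ← mul_assoc, ih, mul_assoc, ← pow_succ]
  have hpoly : ∀ q : Polynomial ℝ, Polynomial.aeval x q * w = w * Polynomial.aeval y q := by
    intro q
    induction q using Polynomial.induction_on' with
    | add p q hp hq => simp [add_mul, mul_add, hp, hq]
    | monomial n r => simp [Polynomial.aeval_monomial, ← Algebra.smul_def, hpow]
  rw [← sub_eq_zero, ← norm_le_zero_iff]
  refine le_of_forall_pos_le_add fun ε hε => ?_
  set R := ‖x‖ + ‖y‖
  set δ := ε / (2 * ‖w‖ + 1) with hδ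
  have hδ0 : 0 < δ := by positivity
  obtain ⟨q, hq⟩ := exists_polynomial_near_of_continuousOn (-R) R f hf.continuousOn δ hδ0
  have hb : ∀ z : A, IsSelfAdjoint z → ‖z‖ ≤ R → ‖cfc f z - Polynomial.aeval z q‖ ≤ δ := by
    intro z hz hzR
    rw [← cfc_polynomial q z hz, ← cfc_sub f q.eval z]
    refine norm_cfc_le hδ0.le fun t ht => ?_
    have := IsometricContinuousFunctionalCalculus.norm_spectrum_le z ht hz
    rw [norm_sub_rev]
    exact (hq t (by rw [Set.mem_Icc, ← abs_le]; exact this.trans hzR)).le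
  have e : cfc f x * w - w * cfc f y = (cfc f x - Polynomial.aeval x q) * w -
      w * (cfc f y - Polynomial.aeval y q) := by
    rw [sub_mul, mul_sub, hpoly]; abel
  rw [e]
  calc _ ≤ ‖(cfc f x - Polynomial.aeval x q) * w‖ + ‖w * (cfc f y - Polynomial.aeval y q)‖ :=
        norm_sub_le _ _
    _ ≤ δ * ‖w‖ + ‖w‖ * δ := by
        grw [norm_mul_le, norm_mul_le, hb x hx (by simp [R]), hb y hy (by simp [R])]
    _ ≤ δ * (2 * ‖w‖ + 1) := by nlinarith
    _ = 0 + ε := by rw [hδ]; field_simp; ring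

theorem aux_jensen (p : ℝ) (hp : 1 < p) (S : Set ℝ) (hS : IsCompact S) (hpos : S ⊆ Set.Ioi 0)
    (η : ℝ) (hη : 0 < η) : ∃ ε > 0, ε < 1 ∧ ∀ s ∈ S, ∀ t ∈ S, η ≤ |s - t| →
      2 * ((s + t + 5 * ε) / 2) ^ p < s ^ p + t ^ p - 4 * ε := by
  set K : Set (ℝ × ℝ) := (S ×ˢ S) ∩ {z | η ≤ |z.1 - z.2|}
  have hK : IsCompact K := (hS.prod hS).inter_right (isClosed_le (by fun_prop) (by fun_prop))
  have hp0 : 0 ≤ p := by linarith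
  have hcont : Continuous fun u : ℝ × (ℝ × ℝ) =>
      u.2.1 ^ p + u.2.2 ^ p - 4 * u.1 - 2 * ((u.2.1 + u.2.2 + 5 * u.1) / 2) ^ p := by
    have h1 : Continuous fun t : ℝ => t ^ p := Real.continuous_rpow_const hp0
    exact (((h1.comp (by fun_prop : Continuous fun u : ℝ × (ℝ × ℝ) => u.2.1)).add
      (h1.comp (by fun_prop : Continuous fun u : ℝ × (ℝ × ℝ) => u.2.2))).sub (by fun_prop)).sub
      (continuous_const.mul (h1.comp (by fun_prop : Continuous fun u : ℝ × (ℝ × ℝ) =>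
        (u.2.1 + u.2.2 + 5 * u.1) / 2)))
  have := hK.eventually_forall_of_forall_eventually (x₀ := (0 : ℝ))
    (P := fun e z => 0 < z.1 ^ p + z.2 ^ p - 4 * e - 2 * ((z.1 + z.2 + 5 * e) / 2) ^ p) (by
      rintro ⟨s, t⟩ ⟨⟨hs, ht⟩, hst⟩
      refine hcont.continuousAt.eventually_const_lt ?_
      have hne : s ≠ t := by rintro rfl; simp at hst; linarith
      have h := (strictConvexOn_rpow hp).2 (Set.mem_Ici.2 (Set.mem_Ioi.1 (hpos hs)).le)
        (Set.mem_Ici.2 (Set.mem_Ioi.1 (hpos ht)).le) hne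
        (by norm_num : (0 : ℝ) < 1 / 2) (by norm_num : (0 : ℝ) < 1 / 2) (by norm_num)
      simp only [smul_eq_mul] at h
      have e : 1 / 2 * s + 1 / 2 * t = (s + t + 5 * 0) / 2 := by ring
      rw [e] at h
      simp only
      linarith)
  obtain ⟨r, hr, h⟩ := Metric.eventually_nhds_iff.1 this
  refine ⟨min (r / 2) (1 / 2), by positivity, (min_le_right _ _).trans_lt (by norm_num), fun s hs t ht hst => ?_⟩
  have := h (y := min (r / 2) (1 / 2)) (by
    rw [Real.dist_eq, sub_zero, abs_of_pos (by positivity)]; exact (min_le_left _ _).trans_lt (by linarith)) (s, t) ⟨⟨hs, ht⟩, hst⟩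
  simp only at this
  linarith

theorem aux_conj {A : Type*} [CStarAlgebra A] (d y : A) (hd : IsSelfAdjoint d) (σ τ ε : ℝ)
    (hy : ‖y‖ = 1) (hyy : y * y = 0) (h1 : ‖d * y - σ • y‖ ≤ ε) (h2 : ‖y * d - τ • y‖ ≤ ε) :
    ‖star (y + star y * y) * d * (y + star y * y) -
      (σ • (star y * y) + τ • (star y * y * (star y * y)))‖ ≤ 4 * ε := by
  set m := star y * y with hm
  have hε : 0 ≤ ε := (norm_nonneg _).trans h1
  have hmn : ‖m‖ = 1 := by rw [hm, CStarRing.norm_star_mul_self, hy]; simp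
  have hms : star m = m := by simp [hm]
  have hmy : m * y = 0 := by rw [hm, mul_assoc, hyy, mul_zero]
  have hym : star y * m = 0 := by
    have := congrArg star hmy
    simpa [hms] using this
  have h3 : ‖d * m - τ • m‖ ≤ ε := by
    have e : d * m - τ • m = star (y * d - τ • y) * y := by
      simp [hm, sub_mul, hd.star_eq, mul_assoc]
    rw [e]
    calc _ ≤ ‖star (y * d - τ • y)‖ * ‖y‖ := norm_mul_le _ _
      _ ≤ ε := by rw [norm_star, hy, mul_one]; exact h2
  have hw : ‖star (y + m)‖ ≤ 2 := by
    rw [norm_star]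
    calc _ ≤ ‖y‖ + ‖m‖ := norm_add_le _ _
      _ = 2 := by rw [hy, hmn]; norm_num
  have e : star (y + m) * d * (y + m) - (σ • m + τ • (m * m)) =
      star (y + m) * ((d * y - σ • y) + (d * m - τ • m)) := by
    have : star (y + m) * (σ • y + τ • m) = σ • m + τ • (m * m) := by
      rw [star_add, hms, mul_add, add_mul, add_mul]
      simp [hmy, hym, ← hm]
    rw [← this]
    noncomm_ring
  rw [e]
  calc _ ≤ ‖star (y + m)‖ * ‖(d * y - σ • y) + (d * m - τ • m)‖ := norm_mul_le _ _
    _ ≤ 2 * (ε + ε) := by grw [hw, norm_add_le, h1, h3]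
    _ = 4 * ε := by ring

set_option maxHeartbeats 2000000 in
theorem aux_core {A : Type*} [CStarAlgebra A] [PartialOrder A] [StarOrderedRing A]
    (p : ℝ) (hp : 1 < p)
    (a : A) (ha : IsSelfAdjoint a) (haspec : spectrum ℝ a ⊆ Set.Ioi (0 : ℝ))
    (H : ∀ b : A, IsSelfAdjoint b → spectrum ℝ b ⊆ Set.Ioi (0 : ℝ) → a ≤ b →
        cfc (fun t : ℝ => t ^ p) a ≤ cfc (fun t : ℝ => t ^ p) b)
    (y : A) (hy : ‖y‖ = 1) (hyy : y * y = 0) (s t ε : ℝ) (hs : 0 < s) (ht : 0 < t) (hε : 0 < ε)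
    (h1 : ‖a * y - s • y‖ ≤ ε) (h2 : ‖y * a - t • y‖ ≤ ε)
    (h3 : ‖cfc (fun t : ℝ => t ^ p) a * y - (s ^ p) • y‖ ≤ ε)
    (h4 : ‖y * cfc (fun t : ℝ => t ^ p) a - (t ^ p) • y‖ ≤ ε) :
    s ^ p + t ^ p - 4 * ε ≤ 2 * ((s + t + 5 * ε) / 2) ^ p := by
  have hp2 : 0 ≤ p / 2 := by linarith
  have hNT : Nontrivial A := ⟨⟨y, 0, by rintro rfl; simp at hy⟩⟩
  have hap : IsSelfAdjoint (cfc (fun t : ℝ => t ^ p) a) := IsSelfAdjoint.cfc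
  have c1 := aux_conj a y ha s t ε hy hyy h1 h2
  have c2 := aux_conj _ y hap (s ^ p) (t ^ p) ε hy hyy h3 h4
  set ap := cfc (fun t : ℝ => t ^ p) a with hapdef
  set m := star y * y with hm
  set w := y + m with hw
  have hmn : ‖m‖ = 1 := by rw [hm, CStarRing.norm_star_mul_self, hy]; simp
  have hm0 : 0 ≤ m := star_mul_self_nonneg y
  have hmsa : IsSelfAdjoint m := hm0.isSelfAdjoint
  have hms : star m = m := hmsa
  have hmy : m * y = 0 := by rw [hm, mul_assoc, hyy, mul_zero]
  have hym : star y * m = 0 := by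
    have := congrArg star hmy
    simpa [hms] using this
  have hww : star w * w = m + m * m := by
    rw [hw, star_add, hms, mul_add, add_mul, add_mul]
    simp [hmy, hym, ← hm]
  have hmspec : ∀ x ∈ spectrum ℝ m, 0 ≤ x ∧ x ≤ 1 := by
    intro x hx
    have hx0 := spectrum_nonneg_of_nonneg hm0 hx
    have := IsometricContinuousFunctionalCalculus.norm_spectrum_le m hx hmsa
    rw [hmn] at this
    exact ⟨hx0, (Real.le_norm_self x).trans this⟩
  have hm1 : (1 : ℝ) ∈ spectrum ℝ m := by
    have := CStarAlgebra.norm_mem_spectrum_of_nonneg hm0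
    rwa [hmn] at this
  have hmmn : ‖m * m‖ ≤ 1 := by
    grw [norm_mul_le, hmn]; norm_num
  clear_value w m
  set c := s + t + 5 * ε with hc
  have hc0 : 0 < c := by positivity
  have hwaw : ‖star w * a * w‖ ≤ c - ε := by
    have e : ‖s • m + t • (m * m)‖ ≤ s + t := by
      grw [norm_add_le, norm_smul, norm_smul, hmmn, hmn]
      simp [abs_of_pos hs, abs_of_pos ht]
    have := norm_le_norm_add_norm_sub' (star w * a * w) (s • m + t • (m * m))
    rw [hc]; linarith
  set η := ε / (c * (‖a‖ + 1)) with hη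
  have hη0 : 0 < η := by positivity
  set X := c⁻¹ • (w * star w) + algebraMap ℝ A η with hX
  have hX1 : algebraMap ℝ A η ≤ X := by
    rw [hX]
    exact le_add_of_nonneg_left (smul_nonneg (by positivity) (mul_star_self_nonneg w))
  have hXsa : IsSelfAdjoint X := by
    rw [hX]
    exact ((IsSelfAdjoint.all _).smul (IsSelfAdjoint.mul_star_self w)).add
      (IsSelfAdjoint.algebraMap A (IsSelfAdjoint.all η))
  have hXs : ∀ x ∈ spectrum ℝ X, 0 < x := fun x hx =>
    hη0.trans_le ((algebraMap_le_iff_le_spectrum hXsa).1 hX1 x hx)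
  set r := cfc Real.sqrt a with hr
  have hrsa : star r = r := IsSelfAdjoint.cfc
  have hrr : r * r = a := by
    rw [hr, ← cfc_mul Real.sqrt Real.sqrt a]
    conv_rhs => rw [← cfc_id' ℝ a ha]
    exact cfc_congr fun x hx => Real.mul_self_sqrt (Set.mem_Ioi.1 (haspec hx)).le
  have hinv : ContinuousOn (fun x : ℝ => x⁻¹) (spectrum ℝ X) :=
    continuousOn_inv₀.mono fun x hx => (hXs x hx).ne'
  have hsqinv : ContinuousOn (fun x : ℝ => (Real.sqrt x)⁻¹) (spectrum ℝ X) :=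
    Real.continuous_sqrt.continuousOn.inv₀ fun x hx => (Real.sqrt_pos.2 (hXs x hx)).ne'
  set g := cfc Real.sqrt X with hg
  have hgsa : star g = g := IsSelfAdjoint.cfc
  have hgg : g * g = X := by
    rw [hg, ← cfc_mul Real.sqrt Real.sqrt X]
    conv_rhs => rw [← cfc_id' ℝ X hXsa]
    exact cfc_congr fun x hx => Real.mul_self_sqrt (hXs x hx).le
  set gi := cfc (fun x : ℝ => (Real.sqrt x)⁻¹) X with hgi
  have hgisa : IsSelfAdjoint gi := IsSelfAdjoint.cfc
  have hggi : g * gi = 1 := by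
    rw [hg, hgi, ← cfc_mul _ _ X (by fun_prop) hsqinv, ← cfc_const_one ℝ X hXsa]
    exact cfc_congr fun x hx => mul_inv_cancel₀ (Real.sqrt_pos.2 (hXs x hx)).ne'
  have hgig : gi * g = 1 := by
    rw [← hggi]; exact (cfc_commute_cfc _ _ _).eq
  set b := cfc (fun x : ℝ => x⁻¹) X with hb
  have hbsa : IsSelfAdjoint b := IsSelfAdjoint.cfc
  have hgigi : gi * gi = b := by
    rw [hgi, hb, ← cfc_mul _ _ X hsqinv hsqinv]
    refine cfc_congr fun x hx => ?_
    rw [← mul_inv, Real.mul_self_sqrt (hXs x hx).le]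
  have hbs : spectrum ℝ b ⊆ Set.Ioi 0 := by
    rw [hb, cfc_map_spectrum (fun x : ℝ => x⁻¹) X hXsa hinv]
    rintro _ ⟨x, hx, rfl⟩
    exact inv_pos.2 (hXs x hx)
  have hrX : ‖r * X * r‖ ≤ 1 := by
    have e : r * X * r = c⁻¹ • ((r * w) * star (r * w)) + η • a := by
      rw [hX, star_mul, hrsa, mul_add, add_mul, ← hrr, Algebra.algebraMap_eq_smul_one]
      simp [mul_assoc]
    have e2 : ‖(r * w) * star (r * w)‖ ≤ c - ε := by
      rw [CStarRing.norm_self_mul_star, ← CStarRing.norm_star_mul_self, star_mul, hrsa]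
      rwa [show star w * r * (r * w) = star w * a * w by rw [← hrr]; simp only [mul_assoc]]
    rw [e]
    grw [norm_add_le, norm_smul, norm_smul, e2]
    rw [Real.norm_of_nonneg hη0.le, Real.norm_of_nonneg (by positivity), hη]
    have : c⁻¹ * (c - ε) + ε / (c * (‖a‖ + 1)) * ‖a‖ = 1 - ε / (c * (‖a‖ + 1)) := by
      field_simp; ring
    rw [this]
    have : 0 < ε / (c * (‖a‖ + 1)) := by positivity
    linarith
  have hgag : g * a * g ≤ 1 := by
    have e : g * a * g = star (r * g) * (r * g) := by
      rw [star_mul, hrsa, hgsa, ← hrr]; simp only [mul_assoc]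
    have h0 : 0 ≤ g * a * g := by rw [e]; exact star_mul_self_nonneg _
    refine (CStarAlgebra.norm_le_one_iff_of_nonneg _ h0).1 ?_
    rw [e, CStarRing.norm_star_mul_self, ← CStarRing.norm_self_mul_star, star_mul, hrsa, hgsa]
    rwa [show r * g * (g * r) = r * X * r by rw [← hgg]; simp only [mul_assoc]]
  have hab : a ≤ b := by
    have := hgisa.conjugate_le_conjugate hgag
    rw [mul_one, hgigi] at this
    have e : gi * (g * a * g) * gi = (gi * g) * a * (g * gi) := by simp only [mul_assoc]
    rwa [e, hggi, hgig, one_mul, mul_one] at this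
  have hpow := H b hbsa hbs hab
  have hcr : Continuous fun x : ℝ => x ^ (p / 2) := Real.continuous_rpow_const hp2
  set h := cfc (fun x : ℝ => x ^ (p / 2)) X with hh
  have hhsa : IsSelfAdjoint h := IsSelfAdjoint.cfc
  have hbp : cfc (fun t : ℝ => t ^ p) b = cfc (fun x : ℝ => (x⁻¹) ^ p) X := by
    rw [hb, ← cfc_comp' (fun t : ℝ => t ^ p) (fun x : ℝ => x⁻¹) X
      (Real.continuous_rpow_const (by linarith)).continuousOn hinv]
  have hinvp : ContinuousOn (fun x : ℝ => (x⁻¹) ^ p) (spectrum ℝ X) :=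
    (Real.continuous_rpow_const (by linarith : (0:ℝ) ≤ p)).comp_continuousOn hinv
  have hhbh : h * cfc (fun t : ℝ => t ^ p) b * h = 1 := by
    have hprod : ContinuousOn (fun x : ℝ => x ^ (p / 2) * (x⁻¹) ^ p) (spectrum ℝ X) :=
      hcr.continuousOn.mul hinvp
    rw [hbp, hh, ← cfc_mul _ _ X hcr.continuousOn hinvp,
      ← cfc_mul _ _ X hprod hcr.continuousOn, ← cfc_const_one ℝ X hXsa]
    refine cfc_congr fun x hx => ?_
    have hx := hXs x hx
    rw [Real.inv_rpow hx.le, mul_right_comm, ← Real.rpow_add hx, add_halves]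
    exact mul_inv_cancel₀ (Real.rpow_pos_of_pos hx p).ne'
  have hhah : h * ap * h ≤ 1 := by
    rw [← hhbh]; exact hhsa.conjugate_le_conjugate hpow
  set Y := c⁻¹ • (m + m * m) + algebraMap ℝ A η with hY
  have hYsa : IsSelfAdjoint Y := by
    rw [hY, ← hww]
    exact ((IsSelfAdjoint.all _).smul (IsSelfAdjoint.star_mul_self w)).add
      (IsSelfAdjoint.algebraMap A (IsSelfAdjoint.all η))
  have hXY : X * w = w * Y := by
    rw [hX, hY, ← hww, add_mul, mul_add, Algebra.commutes]
    simp [mul_assoc]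
  set F : ℝ → ℝ := fun x => (c⁻¹ * (x + x * x) + η) ^ (p / 2) with hF
  have hFc : Continuous F := hcr.comp (by fun_prop)
  set k := cfc F m with hk
  have hYm : Y = cfc (fun x : ℝ => c⁻¹ * (x + x * x) + η) m := by
    rw [cfc_add_const η (fun x : ℝ => c⁻¹ * (x + x * x)) m,
      cfc_const_mul c⁻¹ (fun x : ℝ => x + x * x) m, cfc_add m (fun x : ℝ => x) (fun x : ℝ => x * x),
      cfc_mul (fun x : ℝ => x) (fun x : ℝ => x) m, cfc_id' ℝ m]
  have hhw : h * w = w * k := by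
    rw [hh, aux_intertwine _ hcr X Y w hXsa hYsa hXY, hYm,
      ← cfc_comp' (fun x : ℝ => x ^ (p / 2)) (fun x : ℝ => c⁻¹ * (x + x * x) + η) m
        hcr.continuousOn]
  have hksa : star k = k := IsSelfAdjoint.cfc
  have hF0 : ∀ x, 0 ≤ x → 0 ≤ F x := fun x hx => by
    simp only [hF]; positivity
  have hkn : ‖k‖ ≤ F 1 := by
    refine norm_cfc_le (hF0 1 zero_le_one) fun x hx => ?_
    obtain ⟨hx0, hx1⟩ := hmspec x hx
    rw [Real.norm_of_nonneg (hF0 x hx0)]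
    simp only [hF]
    gcongr
  set G : ℝ → ℝ := fun x => s ^ p * x + t ^ p * (x * x) with hG
  have hGm : cfc G m = s ^ p • m + t ^ p • (m * m) := by
    rw [hG, cfc_add m (fun x : ℝ => s ^ p * x) (fun x : ℝ => t ^ p * (x * x)),
      cfc_const_mul _ (fun x : ℝ => x * x) m, cfc_const_mul _ (fun x : ℝ => x) m,
      cfc_mul (fun x : ℝ => x) (fun x : ℝ => x) m, cfc_id' ℝ m]
  have hGc : Continuous G := by fun_prop
  have low : F 1 * G 1 * F 1 ≤ ‖k * cfc G m * k‖ := by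
    have hFGc : Continuous (fun x => F x * G x) := hFc.mul hGc
    have hFGFc : Continuous (fun x => F x * G x * F x) := hFGc.mul hFc
    rw [hk, ← cfc_mul F G m hFc.continuousOn hGc.continuousOn,
      ← cfc_mul (fun x => F x * G x) F m hFGc.continuousOn hFc.continuousOn]
    exact (Real.le_norm_self _).trans
      (norm_apply_le_norm_cfc (fun x => F x * G x * F x) m hm1 hFGFc.continuousOn hmsa)
  have up : ‖k * (star w * ap * w) * k‖ ≤ 2 := by
    have e : k * (star w * ap * w) * k = star w * (h * ap * h) * w := by
      have e1 : star w * h = k * star w := by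
        have := congrArg star hhw
        rwa [star_mul, star_mul, hksa, hhsa.star_eq] at this
      calc _ = (k * star w) * ap * (w * k) := by simp only [mul_assoc]
        _ = _ := by rw [← e1, ← hhw]; simp only [mul_assoc]
    rw [e]
    have ap0 : 0 ≤ ap := cfc_nonneg fun x hx => Real.rpow_nonneg (Set.mem_Ioi.1 (haspec hx)).le _
    have e0 : 0 ≤ h * ap * h := hhsa.conjugate_nonneg ap0
    refine (CStarAlgebra.norm_le_norm_of_nonneg_of_le (star_left_conjugate_nonneg e0 w)
      (star_left_conjugate_le_conjugate hhah w)).trans ?_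
    rw [mul_one, hww]
    grw [norm_add_le, hmmn, hmn]
    norm_num
  have err : ‖k * (star w * ap * w - cfc G m) * k‖ ≤ F 1 * (4 * ε) * F 1 := by
    rw [hGm]
    have := hF0 1 zero_le_one
    grw [norm_mul_le, norm_mul_le, hkn, c2]
    gcongr
  have key : F 1 * F 1 * (s ^ p + t ^ p - 4 * ε) ≤ 2 := by
    have e : k * cfc G m * k = k * (star w * ap * w) * k -
      k * (star w * ap * w - cfc G m) * k := by noncomm_ring
    have := norm_sub_le (k * (star w * ap * w) * k) (k * (star w * ap * w - cfc G m) * k)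
    rw [← e] at this
    have hG1 : G 1 = s ^ p + t ^ p := by simp [hG]
    rw [hG1] at low
    nlinarith
  by_cases hneg : s ^ p + t ^ p - 4 * ε ≤ 0
  · exact hneg.trans (by positivity)
  push Not at hneg
  have hFF : (2 / c) ^ p ≤ F 1 * F 1 := by
    simp only [hF]
    rw [← Real.rpow_add (by positivity), add_halves]
    apply Real.rpow_le_rpow (by positivity) _ (by linarith)
    have : 2 / c = c⁻¹ * (1 + 1 * 1) := by field_simp; norm_num
    linarith
  have k2 : (2 / c) ^ p * (s ^ p + t ^ p - 4 * ε) ≤ 2 :=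
    (mul_le_mul_of_nonneg_right hFF hneg.le).trans key
  have k3 : (c / 2) ^ p * (2 / c) ^ p = 1 := by
    rw [← Real.mul_rpow (by positivity) (by positivity)]
    rw [show c / 2 * (2 / c) = 1 by field_simp, Real.one_rpow]
  have k4 : 0 < (c / 2) ^ p := by positivity
  calc s ^ p + t ^ p - 4 * ε = (c / 2) ^ p * ((2 / c) ^ p * (s ^ p + t ^ p - 4 * ε)) := by
        rw [← mul_assoc, k3, one_mul]
    _ ≤ (c / 2) ^ p * 2 := by gcongr
    _ = _ := by ring

/-- clamp -/
noncomputable def aRho (u : ℝ) : ℝ := max 0 (min 1 u)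

noncomputable def aP (N : ℝ) (i : ℕ) (t : ℝ) : ℝ := aRho (N * t - i + 1) - aRho (N * t - i)

noncomputable def aQ (N : ℝ) (i : ℕ) (t : ℝ) : ℝ := aRho (N * t - i + 3) - aRho (N * t - i - 2)

theorem aRho_cont : Continuous aRho := by unfold aRho; fun_prop

theorem aP_cont (N : ℝ) (i : ℕ) : Continuous (aP N i) := by unfold aP aRho; fun_prop

theorem aQ_cont (N : ℝ) (i : ℕ) : Continuous (aQ N i) := by unfold aQ aRho; fun_prop

theorem aRho_mono : Monotone aRho := fun x y h => by unfold aRho; gcongr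

theorem aRho_nonneg (u : ℝ) : 0 ≤ aRho u := le_max_left _ _

theorem aRho_le (u : ℝ) : aRho u ≤ 1 := max_le zero_le_one (min_le_left _ _)

theorem aRho_one (u : ℝ) (h : 1 ≤ u) : aRho u = 1 := by
  unfold aRho; rw [min_eq_left h]; simp

theorem aRho_zero (u : ℝ) (h : u ≤ 0) : aRho u = 0 := by
  unfold aRho; rw [min_eq_right (by linarith)]; simp [h]

theorem aP_nonneg (N : ℝ) (i : ℕ) (t : ℝ) : 0 ≤ aP N i t :=
  sub_nonneg.2 (aRho_mono (by linarith))

theorem aP_le (N : ℝ) (i : ℕ) (t : ℝ) : aP N i t ≤ 1 := by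
  unfold aP; linarith [aRho_nonneg (N * t - i), aRho_le (N * t - i + 1)]

theorem aQ_nonneg (N : ℝ) (i : ℕ) (t : ℝ) : 0 ≤ aQ N i t :=
  sub_nonneg.2 (aRho_mono (by linarith))

theorem aQ_le (N : ℝ) (i : ℕ) (t : ℝ) : aQ N i t ≤ 1 := by
  unfold aQ; linarith [aRho_nonneg (N * t - i - 2), aRho_le (N * t - i + 3)]

theorem aP_zero (N : ℝ) (i : ℕ) (t : ℝ) (h : 1 ≤ |N * t - i|) : aP N i t = 0 := by
  unfold aP
  rcases le_abs.1 h with h | h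
  · rw [aRho_one _ (by linarith), aRho_one _ h]; simp
  · rw [aRho_zero _ (by linarith), aRho_zero _ (by linarith)]; simp

theorem aQ_zero (N : ℝ) (i : ℕ) (t : ℝ) (h : 3 ≤ |N * t - i|) : aQ N i t = 0 := by
  unfold aQ
  rcases le_abs.1 h with h | h
  · rw [aRho_one _ (by linarith), aRho_one _ (by linarith)]; simp
  · rw [aRho_zero _ (by linarith), aRho_zero _ (by linarith)]; simp

theorem aQ_one (N : ℝ) (i : ℕ) (t : ℝ) (h : |N * t - i| ≤ 2) : aQ N i t = 1 := by
  unfold aQ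
  obtain ⟨h1, h2⟩ := abs_le.1 h
  rw [aRho_one _ (by linarith), aRho_zero _ (by linarith)]; simp

theorem aP_mul_aQ (N : ℝ) (i : ℕ) (t : ℝ) : aP N i t * aQ N i t = aP N i t := by
  rcases le_total |N * t - i| 1 with h | h
  · rw [aQ_one _ _ _ (by linarith), mul_one]
  · rw [aP_zero _ _ _ h, zero_mul]

theorem aP_sum (N : ℝ) (K : ℕ) (t : ℝ) (h0 : 0 ≤ N * t) (h1 : N * t ≤ K) :
    ∑ i ∈ Finset.range (K + 1), aP N i t = 1 := by
  have : ∀ n : ℕ, ∑ i ∈ Finset.range n, aP N i t = aRho (N * t + 1) - aRho (N * t - n + 1) := by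
    intro n
    induction n with
    | zero => simp
    | succ n ih =>
      rw [Finset.sum_range_succ, ih]
      unfold aP
      push_cast
      rw [show N * t - (n + 1) + 1 = N * t - n by ring]
      ring
  rw [this, aRho_one _ (by linarith), aRho_zero _ (by push_cast; linarith)]
  simp

theorem aQ_sum (N : ℝ) (K : ℕ) (t : ℝ) : ∑ i ∈ Finset.range K, aQ N i t ≤ 5 := by
  have : ∀ n : ℕ, ∑ i ∈ Finset.range n, aQ N i t =
      (aRho (N * t + 3) + aRho (N * t + 2) + aRho (N * t + 1) + aRho (N * t) + aRho (N * t - 1)) -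
      (aRho (N * t - n + 3) + aRho (N * t - n + 2) + aRho (N * t - n + 1) + aRho (N * t - n)
        + aRho (N * t - n - 1)) := by
    intro n
    induction n with
    | zero => simp
    | succ n ih =>
      rw [Finset.sum_range_succ, ih]
      unfold aQ
      push_cast
      rw [show N * t - (n + 1) + 3 = N * t - n + 2 by ring,
        show N * t - (n + 1) + 2 = N * t - n + 1 by ring,
        show N * t - (n + 1) + 1 = N * t - n by ring,
        show N * t - (n + 1) = N * t - n - 1 by ring,
        show N * t - n - 1 - 1 = N * t - n - 2 by ring]
      ring
  rw [this]
  linarith [aRho_le (N * t + 3), aRho_le (N * t + 2), aRho_le (N * t + 1), aRho_le (N * t),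
    aRho_le (N * t - 1), aRho_nonneg (N * t - K + 3), aRho_nonneg (N * t - K + 2),
    aRho_nonneg (N * t - K + 1), aRho_nonneg (N * t - K), aRho_nonneg (N * t - K - 1)]

theorem aux_near {A : Type*} [CStarAlgebra A] (a : A) (f g : ℝ → ℝ)
    (hf : ContinuousOn f (spectrum ℝ a)) (hg : ContinuousOn g (spectrum ℝ a)) (ε : ℝ) (hε : 0 ≤ ε)
    (h : ∀ t ∈ spectrum ℝ a, |f t * g t| ≤ ε) : ‖cfc f a * cfc g a‖ ≤ ε := by
  rw [← cfc_mul f g a hf hg]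
  exact norm_cfc_le hε h

theorem aP_psum {A : Type*} [CStarAlgebra A] (a : A) (ha : IsSelfAdjoint a)
    (haspec : spectrum ℝ a ⊆ Set.Ioi (0 : ℝ)) (N : ℝ) (hN : 0 < N) :
    ∃ K : ℕ, ∑ i ∈ Finset.range K, cfc (aP N i) a = 1 := by
  obtain ⟨K, hK⟩ := exists_nat_ge (N * ‖a‖)
  refine ⟨K + 1, ?_⟩
  rw [← cfc_sum (fun i => aP N i) a _ (fun i _ => (aP_cont N i).continuousOn),
    ← cfc_const_one ℝ a ha]
  refine cfc_congr fun t ht => ?_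
  have h0 : 0 < t := haspec ht
  have h1 := (Real.le_norm_self t).trans
    (IsometricContinuousFunctionalCalculus.norm_spectrum_le a ht ha)
  rw [Finset.sum_apply]
  refine aP_sum N K t (by positivity) (le_trans ?_ hK)
  gcongr

theorem aux_coarse {A : Type*} [CStarAlgebra A] [PartialOrder A] [StarOrderedRing A]
    (a : A) (ha : IsSelfAdjoint a)
    (haspec : spectrum ℝ a ⊆ Set.Ioi (0 : ℝ)) (x : A) (N : ℝ) (hN : 0 < N)
    (h : ∀ i : ℕ, cfc (aP N i) a * x = cfc (aP N i) a * x * cfc (aQ N i) a) :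
    ‖a * x - x * a‖ ≤ 20 * ‖x‖ / N := by
  set y := a * x - x * a with hy
  set M := ‖y‖ * (4 * ‖x‖ / N) with hM
  have hM0 : 0 ≤ M := by positivity
  obtain ⟨K, hK⟩ := aP_psum a ha haspec N hN
  have hT : ∀ i : ℕ, star y * cfc (aP N i) a * y ≤ M • cfc (aQ N i) a := by
    intro i
    set D := cfc (fun t : ℝ => t - i / N) a with hD
    have hDc : Continuous (fun t : ℝ => t - i / N) := by fun_prop
    have hDa : D = a - algebraMap ℝ A (i / N) := by
      rw [hD, cfc_sub (fun t : ℝ => t) (fun _ => (i / N : ℝ)) a, cfc_id' ℝ a, cfc_const _ a]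
    have hPD : ‖cfc (aP N i) a * D‖ ≤ 1 / N := by
      refine aux_near a _ _ (aP_cont N i).continuousOn hDc.continuousOn _ (by positivity) ?_
      intro t _
      rw [abs_mul, abs_of_nonneg (aP_nonneg N i t)]
      rcases le_total 1 |N * t - i| with h | h
      · rw [aP_zero _ _ _ h, zero_mul]; positivity
      · have e : t - i / N = (N * t - i) / N := by field_simp
        rw [e, abs_div, abs_of_pos hN]
        have := aP_le N i t
        have := aP_nonneg N i t
        calc aP N i t * (|N * t - i| / N) ≤ 1 * (1 / N) := by gcongr
          _ = 1 / N := one_mul _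
    have hQD : ‖cfc (aQ N i) a * D‖ ≤ 3 / N := by
      refine aux_near a _ _ (aQ_cont N i).continuousOn hDc.continuousOn _ (by positivity) ?_
      intro t _
      rw [abs_mul, abs_of_nonneg (aQ_nonneg N i t)]
      rcases le_total 3 |N * t - i| with h | h
      · rw [aQ_zero _ _ _ h, zero_mul]; positivity
      · have e : t - i / N = (N * t - i) / N := by field_simp
        rw [e, abs_div, abs_of_pos hN]
        have := aQ_le N i t
        have := aQ_nonneg N i t
        calc aQ N i t * (|N * t - i| / N) ≤ 1 * (3 / N) := by gcongr
          _ = 3 / N := one_mul _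
    have hP1 : ‖cfc (aP N i) a‖ ≤ 1 := norm_cfc_le zero_le_one fun t _ => by
      rw [Real.norm_of_nonneg (aP_nonneg N i t)]; exact aP_le N i t
    have hQ1 : cfc (aQ N i) a ≤ 1 := cfc_le_one _ _ fun t _ => aQ_le N i t
    have hQ0 : 0 ≤ cfc (aQ N i) a := cfc_nonneg fun t _ => aQ_nonneg N i t
    have hP0 : 0 ≤ cfc (aP N i) a := cfc_nonneg fun t _ => aP_nonneg N i t
    have hQQ : cfc (aQ N i) a * cfc (aQ N i) a ≤ cfc (aQ N i) a := by
      rw [← cfc_mul (aQ N i) (aQ N i) a (aQ_cont N i).continuousOn (aQ_cont N i).continuousOn]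
      refine cfc_mono (fun t _ => ?_) ((aQ_cont N i).mul (aQ_cont N i)).continuousOn
        (aQ_cont N i).continuousOn
      exact mul_le_of_le_one_left (aQ_nonneg N i t) (aQ_le N i t)
    have hPa : cfc (aP N i) a * a = a * cfc (aP N i) a := by
      have := cfc_commute_cfc (aP N i) (fun t : ℝ => t) a
      rw [cfc_id' ℝ a] at this
      exact this.eq
    have hQa : cfc (aQ N i) a * a = a * cfc (aQ N i) a := by
      have := cfc_commute_cfc (aQ N i) (fun t : ℝ => t) a
      rw [cfc_id' ℝ a] at this
      exact this.eq
    have hi := h i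
    generalize cfc (aP N i) a = P at *
    generalize cfc (aQ N i) a = Q at *
    have hPy : ‖P * y‖ ≤ 4 * ‖x‖ / N := by
      have e : P * y = (P * D) * x - P * x * (Q * D) := by
        rw [← mul_assoc, ← hi, hDa, hy]
        simp only [mul_sub, sub_mul, mul_assoc, Algebra.commutes]
        noncomm_ring
      rw [e]
      grw [norm_sub_le, norm_mul_le (P * D), norm_mul_le (P * x), norm_mul_le P x, hPD, hP1, hQD]
      apply le_of_eq; ring
    have hPyQ : P * y = P * y * Q := by
      have e1 : P * y = a * (P * x) - P * x * a := by
        rw [hy, mul_sub, ← mul_assoc, hPa]; simp only [mul_assoc]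
      rw [e1, sub_mul, mul_assoc (P * x) a Q, ← hQa, mul_assoc a, ← mul_assoc (P * x), ← hi]
    set T := star y * P * y with hT
    have hTs : star T = T := by
      rw [hT, star_mul, star_mul, star_star, hP0.isSelfAdjoint.star_eq, mul_assoc]
    have hTQ : T = T * Q := by
      rw [hT, mul_assoc, mul_assoc, ← hPyQ]
    have hQT : T = Q * T := by
      have := congrArg star hTQ
      rwa [star_mul T Q, hTs, hQ0.isSelfAdjoint.star_eq] at this
    have hTn : ‖T‖ ≤ M := by
      rw [hT, mul_assoc]
      grw [norm_mul_le, hPy, norm_star]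
    have h1 : T = star Q * T * Q := by
      rw [hQ0.isSelfAdjoint.star_eq, ← hQT, ← hTQ]
    rw [h1]
    have := CStarAlgebra.star_left_conjugate_le_norm_smul (a := Q) (b := T) (hb := hTs)
    refine this.trans ?_
    rw [hQ0.isSelfAdjoint.star_eq]
    exact (smul_le_smul_of_nonneg_right hTn (hQ0.isSelfAdjoint.mul_self_nonneg)).trans
      (smul_le_smul_of_nonneg_left hQQ hM0)
  have hyy : star y * y ≤ algebraMap ℝ A (M * 5) := by
    calc star y * y = ∑ i ∈ Finset.range K, star y * cfc (aP N i) a * y := by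
          rw [← Finset.sum_mul, ← Finset.mul_sum, hK, mul_one]
      _ ≤ ∑ i ∈ Finset.range K, M • cfc (aQ N i) a := Finset.sum_le_sum fun i _ => hT i
      _ = M • cfc (∑ i ∈ Finset.range K, aQ N i) a := by
          rw [← Finset.smul_sum, cfc_sum (fun i => aQ N i) a _ (fun i _ => (aQ_cont N i).continuousOn)]
      _ ≤ M • algebraMap ℝ A 5 := by
          refine smul_le_smul_of_nonneg_left ?_ hM0
          refine cfc_le_algebraMap _ _ _ (fun t _ => ?_) ?_
          · rw [Finset.sum_apply]; exact aQ_sum N K t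
          · have : Continuous (∑ i ∈ Finset.range K, aQ N i) := by
              rw [show (∑ i ∈ Finset.range K, aQ N i) =
                fun t => ∑ i ∈ Finset.range K, aQ N i t from by ext t; rw [Finset.sum_apply]]
              exact continuous_finsetSum _ fun i _ => aQ_cont N i
            exact this.continuousOn
      _ = _ := by rw [map_mul, Algebra.smul_def]
  have := (CStarAlgebra.norm_le_iff_le_algebraMap _ (by positivity) (star_mul_self_nonneg y)).2 hyy
  rw [CStarRing.norm_star_mul_self, hM] at this
  rcases eq_or_lt_of_le (norm_nonneg y) with h0 | h0
  · rw [← h0]; positivity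
  · have e : ‖y‖ * (4 * ‖x‖ / N) * 5 = ‖y‖ * (20 * ‖x‖ / N) := by ring
    rw [e] at this
    exact le_of_mul_le_mul_left this h0

theorem aux_point {A : Type*} [CStarAlgebra A] (a : A) (f : ℝ → ℝ)
    (hf : ContinuousOn f (spectrum ℝ a)) (N : ℝ) (k : ℕ) (v ε : ℝ) (hε : 0 ≤ ε)
    (h : ∀ u ∈ spectrum ℝ a, |N * u - k| < 3 → |f u - v| ≤ ε) :
    ‖cfc f a * cfc (aQ N k) a - v • cfc (aQ N k) a‖ ≤ ε := by
  have hQ : ContinuousOn (aQ N k) (spectrum ℝ a) := (aQ_cont N k).continuousOn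
  have hfQ : ContinuousOn (fun x => f x * aQ N k x) (spectrum ℝ a) := hf.mul hQ
  have hvQ : ContinuousOn (fun x => v * aQ N k x) (spectrum ℝ a) := by fun_prop
  rw [← cfc_mul f (aQ N k) a hf hQ, ← cfc_const_mul v (aQ N k) a hQ, ← cfc_sub _ _ a hfQ hvQ]
  refine norm_cfc_le hε fun u hu => ?_
  rw [← sub_mul, norm_mul, Real.norm_of_nonneg (aQ_nonneg N k u), Real.norm_eq_abs]
  rcases lt_or_ge |N * u - k| 3 with h3 | h3
  · calc _ ≤ ε * 1 := by
          have := h u hu h3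
          have := aQ_le N k u
          have := aQ_nonneg N k u
          gcongr
      _ = ε := mul_one _
  · rw [aQ_zero _ _ _ h3, mul_zero]; exact hε

theorem aux_left {A : Type*} [CStarAlgebra A] (a : A) (f : ℝ → ℝ)
    (hf : ContinuousOn f (spectrum ℝ a)) (N : ℝ) (k : ℕ) (v ε : ℝ) (hε : 0 ≤ ε)
    (h : ∀ u ∈ spectrum ℝ a, |N * u - k| < 3 → |f u - v| ≤ ε)
    (y : A) (hy : ‖y‖ = 1) (hq : cfc (aQ N k) a * y = y) :
    ‖cfc f a * y - v • y‖ ≤ ε := by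
  have e : cfc f a * y - v • y = (cfc f a * cfc (aQ N k) a - v • cfc (aQ N k) a) * y := by
    rw [sub_mul, smul_mul_assoc, mul_assoc, hq]
  rw [e]
  grw [norm_mul_le, aux_point a f hf N k v ε hε h, hy, mul_one]

theorem aux_right {A : Type*} [CStarAlgebra A] (a : A) (f : ℝ → ℝ)
    (hf : ContinuousOn f (spectrum ℝ a)) (N : ℝ) (k : ℕ) (v ε : ℝ) (hε : 0 ≤ ε)
    (h : ∀ u ∈ spectrum ℝ a, |N * u - k| < 3 → |f u - v| ≤ ε)
    (y : A) (hy : ‖y‖ = 1) (hq : y * cfc (aQ N k) a = y) :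
    ‖y * cfc f a - v • y‖ ≤ ε := by
  have e : y * cfc f a - v • y = y * (cfc f a * cfc (aQ N k) a - v • cfc (aQ N k) a) := by
    rw [mul_sub, mul_smul_comm, hq, (cfc_commute_cfc f (aQ N k) a).eq, ← mul_assoc, hq]
  rw [e]
  grw [norm_mul_le, aux_point a f hf N k v ε hε h, hy, one_mul]

theorem aux_ne {A : Type*} [CStarAlgebra A] (a : A) (f : ℝ → ℝ) (h : cfc f a ≠ 0) :
    ∃ s ∈ spectrum ℝ a, f s ≠ 0 := by
  by_contra! hc
  exact h (by rw [cfc_congr (g := fun _ => 0) hc, cfc_const_zero])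

theorem aux_unif (a : Set ℝ) (ha : IsCompact a) (f : ℝ → ℝ) (hf : ContinuousOn f a)
    (ε : ℝ) (hε : 0 < ε) : ∃ N₀ : ℝ, 0 < N₀ ∧ ∀ N : ℝ, N₀ ≤ N → ∀ (k : ℕ), ∀ s ∈ a, ∀ u ∈ a,
      |N * s - k| < 3 → |N * u - k| < 3 → |f u - f s| ≤ ε := by
  have := ha.uniformContinuousOn_of_continuous hf
  obtain ⟨δ, hδ, h⟩ := Metric.uniformContinuousOn_iff.1 this ε hε
  refine ⟨6 / δ, by positivity, fun N hN k s hs u hu h1 h2 => ?_⟩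
  have hN0 : 0 < N := lt_of_lt_of_le (by positivity) hN
  refine (h u hu s hs ?_).le
  rw [Real.dist_eq]
  have h3 : |N * (u - s)| < 6 := by
    rw [abs_lt] at *
    constructor <;> nlinarith
  rw [abs_mul, abs_of_pos hN0] at h3
  rw [div_le_iff₀ hδ] at hN
  by_contra! hc
  nlinarith

theorem aux_loc_s10 {A : Type*} [CStarAlgebra A] [PartialOrder A] [StarOrderedRing A]
    (p : ℝ) (hp : 1 < p)
    (a : A) (ha : IsSelfAdjoint a) (haspec : spectrum ℝ a ⊆ Set.Ioi (0 : ℝ))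
    (x : A) (hx : a * x ≠ x * a) :
    ∃ η : ℝ, 0 < η ∧ ∀ ε : ℝ, 0 < ε → ∃ s ∈ spectrum ℝ a, ∃ t ∈ spectrum ℝ a, η ≤ |s - t| ∧
      ∃ y : A, ‖y‖ = 1 ∧ y * y = 0 ∧ ‖a * y - s • y‖ ≤ ε ∧ ‖y * a - t • y‖ ≤ ε ∧
        ‖cfc (fun t : ℝ => t ^ p) a * y - (s ^ p) • y‖ ≤ ε ∧
        ‖y * cfc (fun t : ℝ => t ^ p) a - (t ^ p) • y‖ ≤ ε := by
  have hx0 : 0 < ‖a * x - x * a‖ := norm_pos_iff.2 (sub_ne_zero.2 hx)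
  obtain ⟨N, hN, hNb⟩ : ∃ N : ℝ, 0 < N ∧ 20 * ‖x‖ / N < ‖a * x - x * a‖ := by
    refine ⟨(20 * ‖x‖ + 1) / ‖a * x - x * a‖, by positivity, ?_⟩
    rw [div_lt_iff₀ (by positivity)]
    field_simp
    linarith
  obtain ⟨i, hi⟩ : ∃ i : ℕ, cfc (aP N i) a * x ≠ cfc (aP N i) a * x * cfc (aQ N i) a := by
    by_contra! hc
    exact absurd (aux_coarse a ha haspec x N hN hc) (not_le.2 hNb)
  set f1 : ℝ → ℝ := fun u => 1 - aQ N i u with hf1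
  have hf1c : Continuous f1 := continuous_const.sub (aQ_cont N i)
  have hf1a : cfc f1 a = 1 - cfc (aQ N i) a := by
    rw [hf1, cfc_sub (fun _ : ℝ => (1 : ℝ)) (aQ N i) a (by fun_prop) (aQ_cont N i).continuousOn,
      cfc_const_one ℝ a]
  set z := cfc (aP N i) a * x * cfc f1 a with hz
  have hz0 : z ≠ 0 := by
    rw [hz, hf1a, mul_sub, mul_one]
    exact sub_ne_zero.2 hi
  refine ⟨1 / N, by positivity, fun ε hε => ?_⟩
  have hcomp : IsCompact (spectrum ℝ a) := ContinuousFunctionalCalculus.isCompact_spectrum a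
  have hpc : Continuous (fun t : ℝ => t ^ p) := Real.continuous_rpow_const (by linarith)
  have hidc : Continuous (fun t : ℝ => t) := continuous_id
  obtain ⟨N1, hN1, hu1⟩ := aux_unif _ hcomp _ hidc.continuousOn ε hε
  obtain ⟨N2, hN2, hu2⟩ := aux_unif _ hcomp _ hpc.continuousOn ε hε
  set R := max N1 N2 with hR
  have hR0 : 0 < R := lt_max_of_lt_left hN1
  replace hu1 := hu1 R (le_max_left _ _)
  replace hu2 := hu2 R (le_max_right _ _)
  obtain ⟨K, hK⟩ := aP_psum a ha haspec R hR0
  obtain ⟨k, l, hkl⟩ : ∃ k l : ℕ, cfc (aP R k) a * z * cfc (aP R l) a ≠ 0 := by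
    by_contra! hc
    apply hz0
    calc z = (∑ k ∈ Finset.range K, cfc (aP R k) a) * z * ∑ l ∈ Finset.range K, cfc (aP R l) a := by
          rw [hK, one_mul, mul_one]
      _ = 0 := by
          rw [Finset.sum_mul, Finset.sum_mul_sum]
          exact Finset.sum_eq_zero fun k _ => Finset.sum_eq_zero fun l _ => hc k l
  have cP := fun (M : ℝ) (j : ℕ) => (aP_cont M j).continuousOn (s := spectrum ℝ a)
  have cQ := fun (M : ℝ) (j : ℕ) => (aQ_cont M j).continuousOn (s := spectrum ℝ a)
  obtain ⟨s, hs, hs1⟩ : ∃ s ∈ spectrum ℝ a, aP R k s * aP N i s ≠ 0 := by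
    apply aux_ne a
    rw [cfc_mul _ _ a (cP R k) (cP N i)]
    intro h0
    apply hkl
    rw [hz, ← mul_assoc, ← mul_assoc, h0, zero_mul, zero_mul, zero_mul]
  obtain ⟨t, ht, ht1⟩ : ∃ t ∈ spectrum ℝ a, f1 t * aP R l t ≠ 0 := by
    apply aux_ne a
    rw [cfc_mul _ _ a hf1c.continuousOn (cP R l)]
    intro h0
    apply hkl
    rw [hz, mul_assoc, mul_assoc _ (cfc f1 a), h0, mul_zero, mul_zero]
  have hsk : |R * s - k| < 1 := by
    by_contra! hc
    exact hs1 (by rw [aP_zero _ _ _ hc, zero_mul])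
  have hsi : |N * s - i| < 1 := by
    by_contra! hc
    exact hs1 (by rw [aP_zero _ _ _ hc, mul_zero])
  have htl : |R * t - l| < 1 := by
    by_contra! hc
    exact ht1 (by rw [aP_zero _ _ _ hc, mul_zero])
  have hti : 2 < |N * t - i| := by
    by_contra! hc
    exact ht1 (by rw [hf1]; simp only; rw [aQ_one _ _ _ hc]; simp)
  have hst : 1 / N ≤ |s - t| := by
    have hmul : |N * (s - t)| = |s - t| * N := by rw [abs_mul, abs_of_pos hN, mul_comm]
    rw [div_le_iff₀ hN, ← hmul]
    have := abs_sub_abs_le_abs_sub (N * t - i) (N * s - i)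
    rw [show N * t - i - (N * s - i) = -(N * (s - t)) by ring, abs_neg] at this
    linarith
  set y0 := cfc (aP R k) a * z * cfc (aP R l) a with hy0
  have hyn : 0 < ‖y0‖ := norm_pos_iff.2 hkl
  have hy1 : ‖‖y0‖⁻¹ • y0‖ = 1 := by
    rw [norm_smul, norm_inv, norm_norm, inv_mul_cancel₀ hyn.ne']
  have hPQ : ∀ j : ℕ, cfc (aP R j) a * cfc (aQ R j) a = cfc (aP R j) a := fun j => by
    rw [← cfc_mul _ _ a (cP R j) (cQ R j)]
    exact cfc_congr fun u _ => aP_mul_aQ R j u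
  have hql : cfc (aQ R k) a * (‖y0‖⁻¹ • y0) = ‖y0‖⁻¹ • y0 := by
    have e : cfc (aQ R k) a * y0 = y0 := by
      rw [hy0, ← mul_assoc, ← mul_assoc (cfc (aQ R k) a),
        (cfc_commute_cfc (aQ R k) (aP R k) a).eq, hPQ]
    rw [mul_smul_comm, e]
  have hqr : (‖y0‖⁻¹ • y0) * cfc (aQ R l) a = ‖y0‖⁻¹ • y0 := by
    rw [smul_mul_assoc, hy0, mul_assoc _ _ (cfc (aQ R l) a), hPQ]
  have hf1P : cfc f1 a * cfc (aP N i) a = 0 := by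
    rw [← cfc_mul _ _ a hf1c.continuousOn (cP N i), ← cfc_const_zero ℝ a]
    refine cfc_congr fun u _ => ?_
    have := aP_mul_aQ N i u
    simp only [hf1]
    linarith
  have hzz : cfc f1 a * (cfc (aP R l) a * (cfc (aP R k) a * cfc (aP N i) a)) = 0 := by
    rw [(cfc_commute_cfc (aP R k) (aP N i) a).eq, ← mul_assoc (cfc (aP R l) a),
      (cfc_commute_cfc (aP R l) (aP N i) a).eq, mul_assoc, ← mul_assoc, hf1P, zero_mul]
  have hyy : y0 * y0 = 0 := by
    have e : y0 * y0 = cfc (aP R k) a * cfc (aP N i) a * x *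
        (cfc f1 a * (cfc (aP R l) a * (cfc (aP R k) a * cfc (aP N i) a))) *
        x * cfc f1 a * cfc (aP R l) a := by
      rw [hy0, hz]; simp only [mul_assoc]
    rw [e, hzz]; simp
  have b1 : ∀ u ∈ spectrum ℝ a, |R * u - k| < 3 → |u - s| ≤ ε := fun u hu h =>
    hu1 k s hs u hu (by linarith) h
  have b2 : ∀ u ∈ spectrum ℝ a, |R * u - l| < 3 → |u - t| ≤ ε := fun u hu h =>
    hu1 l t ht u hu (by linarith) h
  have b3 : ∀ u ∈ spectrum ℝ a, |R * u - k| < 3 → |u ^ p - s ^ p| ≤ ε := fun u hu h =>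
    hu2 k s hs u hu (by linarith) h
  have b4 : ∀ u ∈ spectrum ℝ a, |R * u - l| < 3 → |u ^ p - t ^ p| ≤ ε := fun u hu h =>
    hu2 l t ht u hu (by linarith) h
  refine ⟨s, hs, t, ht, hst, ‖y0‖⁻¹ • y0, hy1, ?_, ?_, ?_, ?_, ?_⟩
  · rw [smul_mul_assoc, mul_smul_comm, hyy]; simp
  · have := aux_left a _ hidc.continuousOn R k s ε hε.le b1 _ hy1 hql
    rwa [cfc_id' ℝ a] at this
  · have := aux_right a _ hidc.continuousOn R l t ε hε.le b2 _ hy1 hqr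
    rwa [cfc_id' ℝ a] at this
  · exact aux_left a _ hpc.continuousOn R k _ ε hε.le b3 _ hy1 hql
  · exact aux_right a _ hpc.continuousOn R l _ ε hε.le b4 _ hy1 hqr

/-- A positive invertible element `a` of a unital C*-algebra is central if and only if
`a ≤ b` implies `a ^ p ≤ b ^ p` for every positive invertible `b`, where `p > 1`. -/
theorem central_iff_rpow_locally_monotone
    {A : Type*} [CStarAlgebra A] [PartialOrder A] [StarOrderedRing A]
    (p : ℝ) (hp : 1 < p)
    (a : A) (ha : IsSelfAdjoint a) (haspec : spectrum ℝ a ⊆ Set.Ioi (0 : ℝ)) :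
    (∀ b : A, a * b = b * a) ↔
      (∀ b : A, IsSelfAdjoint b → spectrum ℝ b ⊆ Set.Ioi (0 : ℝ) → a ≤ b →
        cfc (fun t : ℝ => t ^ p) a ≤ cfc (fun t : ℝ => t ^ p) b) := by
  constructor
  · intro hc b hb hbs hab
    exact aux_forward p (by linarith) a b ha haspec hb hbs hab (hc b)
  · intro H x
    by_contra hx
    obtain ⟨η, hη, hloc⟩ := aux_loc_s10 p hp a ha haspec x hx
    obtain ⟨ε, hε, _, hj⟩ := aux_jensen p hp (spectrum ℝ a)
      (ContinuousFunctionalCalculus.isCompact_spectrum a) haspec η hη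
    obtain ⟨s, hs, t, ht, hst, y, hy, hyy, h1, h2, h3, h4⟩ := hloc ε hε
    exact absurd (aux_core p hp a ha haspec H y hy hyy s t ε (haspec hs) (haspec ht) hε h1 h2 h3 h4)
      (not_le.2 (hj s hs t ht hst))
end

section
/- Let A be a unital C*-algebra and let a ∈ A be a positive invertible element. Then a is central (ab = ba for all b ∈ A) if and only if for every positive invertible b ∈ A, a ≤ b implies a² ≤ b². -/
/-- one resolvent estimate -/
theorem aux_resolvent {A : Type*} [CStarAlgebra A] [PartialOrder A] [StarOrderedRing A]
    (k e : A) (hk : IsSelfAdjoint k) (μ ε : ℝ) (hε : 0 < ε)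
    (h : e * star e ≤ (k - algebraMap ℝ A μ) ^ 2) :
    ‖star e * cfc (fun x : ℝ => ((x - μ) ^ 2 + ε ^ 2)⁻¹) k * e‖ ≤ 1 := by
  have hpos : ∀ x : ℝ, 0 < (x - μ) ^ 2 + ε ^ 2 := fun x => by positivity
  set f : ℝ → ℝ := fun x => (Real.sqrt ((x - μ) ^ 2 + ε ^ 2))⁻¹ with hf
  have hfc : Continuous f := by
    apply Continuous.inv₀ (by fun_prop)
    intro x; exact (Real.sqrt_pos.2 (hpos x)).ne'
  have hff : ∀ x, f x * f x = ((x - μ) ^ 2 + ε ^ 2)⁻¹ := fun x => by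
    simp only [hf]
    rw [← mul_inv, Real.mul_self_sqrt (hpos x).le]
  have hsa : IsSelfAdjoint (cfc f k) := cfc_predicate f k
  have hk2 : (k - algebraMap ℝ A μ) ^ 2 = cfc (fun x : ℝ => (x - μ) ^ 2) k := by
    rw [cfc_pow (fun x : ℝ => x - μ) 2 k, cfc_sub (fun x : ℝ => x) (fun _ => μ) k,
      cfc_id' ℝ k, cfc_const μ k]
  have h1 : cfc f k * (e * star e) * cfc f k ≤ 1 := by
    refine (hsa.conjugate_le_conjugate h).trans ?_
    rw [hk2, ← cfc_mul f _ k hfc.continuousOn (by fun_prop),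
      ← cfc_mul _ f k (by fun_prop) hfc.continuousOn]
    apply cfc_le_one
    intro x _
    have : f x * (x - μ) ^ 2 * f x = (x - μ) ^ 2 * ((x - μ) ^ 2 + ε ^ 2)⁻¹ := by
      rw [← hff]; ring
    rw [this, ← div_eq_mul_inv, div_le_one (hpos x)]
    nlinarith [sq_nonneg ε]
  have h2 : cfc (fun x : ℝ => ((x - μ) ^ 2 + ε ^ 2)⁻¹) k = cfc f k * cfc f k := by
    rw [← cfc_mul f f k hfc.continuousOn hfc.continuousOn]
    congr 1; ext x; exact (hff x).symm
  have h3 : star e * (cfc f k * cfc f k) * e = star (cfc f k * e) * (cfc f k * e) := by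
    rw [star_mul, hsa.star_eq]; simp only [mul_assoc]
  have h4 : cfc f k * (e * star e) * cfc f k = (cfc f k * e) * star (cfc f k * e) := by
    rw [star_mul, hsa.star_eq]; simp only [mul_assoc]
  rw [h2, h3, CStarRing.norm_star_mul_self, ← CStarRing.norm_self_mul_star]
  rw [h4] at h1
  exact (CStarAlgebra.norm_le_one_iff_of_nonneg _ (mul_star_self_nonneg _)).2 h1

theorem aux_zero {A : Type*} [CStarAlgebra A] [PartialOrder A] [StarOrderedRing A]
    (k e : A) (hk : IsSelfAdjoint k)
    (h : ∀ μ : ℝ, e * star e ≤ (k - algebraMap ℝ A μ) ^ 2) : e = 0 := by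
  nontriviality A
  obtain ⟨M, hM, hMk⟩ : ∃ M : ℝ, 0 < M ∧ ‖k‖ ≤ M := ⟨‖k‖ + 1, by positivity, by linarith⟩
  have key : ∀ n : ℕ, ‖e‖ * ‖e‖ ≤ 2 * (M / (n + 1)) ^ 2 * (2 * (n + 1) + 1) := by
    intro n
    set ε : ℝ := M / (n + 1) with hεd
    have hε : 0 < ε := by positivity
    have hεM : ε * (n + 1) = M := by rw [hεd]; field_simp
    let μ : ℕ → ℝ := fun j => j * ε - M
    let g : ℕ → ℝ → ℝ := fun j x => ((x - μ j) ^ 2 + ε ^ 2)⁻¹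
    have hg : ∀ j, Continuous (g j) := fun j => by
      apply Continuous.inv₀ (by fun_prop)
      intro x; positivity
    let s := Finset.range (2 * (n + 1) + 1)
    have h1 : algebraMap ℝ A ((2 * ε ^ 2)⁻¹) ≤ ∑ j ∈ s, cfc (g j) k := by
      rw [← cfc_sum g k s (fun j _ => (hg j).continuousOn)]
      apply algebraMap_le_cfc
      · intro x hx
        have hx' : |x| ≤ M := (spectrum.norm_le_norm_of_mem hx).trans hMk
        obtain ⟨hx1, hx2⟩ := abs_le.1 hx'
        have hq : 0 ≤ (x + M) / ε := div_nonneg (by linarith) hε.le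
        have f1 := Nat.floor_le hq
        have f2 := Nat.lt_floor_add_one ((x + M) / ε)
        set j := ⌊(x + M) / ε⌋₊ with hj
        rw [le_div_iff₀ hε] at f1
        rw [div_lt_iff₀ hε] at f2
        have hjs : j ∈ s := by
          have : (j : ℝ) ≤ 2 * (n + 1) := by
            by_contra hc
            push Not at hc
            nlinarith
          have : j ≤ 2 * (n + 1) := by exact_mod_cast this
          exact Finset.mem_range.2 (by omega)
        have h2 : (2 * ε ^ 2)⁻¹ ≤ g j x := by
          apply inv_anti₀ (by positivity)
          simp only [μ]
          nlinarith
        rw [Finset.sum_apply]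
        refine h2.trans (Finset.single_le_sum (f := fun j => g j x) (fun i _ => ?_) hjs)
        simp only [g]; positivity
      · have : Continuous (∑ i ∈ s, g i) := by
          have := continuous_finsetSum s (fun i _ => hg i)
          convert this using 1
          ext x; simp
        exact this.continuousOn
      · exact hk
    have h2 := star_left_conjugate_le_conjugate h1 e
    have h3 : star e * algebraMap ℝ A ((2 * ε ^ 2)⁻¹) * e = (2 * ε ^ 2)⁻¹ • (star e * e) := by
      simp [Algebra.algebraMap_eq_smul_one]
    rw [h3] at h2
    have h4 := CStarAlgebra.norm_le_norm_of_nonneg_of_le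
      (smul_nonneg (by positivity) (star_mul_self_nonneg e)) h2
    rw [norm_smul, CStarRing.norm_star_mul_self, Real.norm_of_nonneg (by positivity)] at h4
    have h5 : ‖star e * (∑ j ∈ s, cfc (g j) k) * e‖ ≤ 2 * (n + 1) + 1 := by
      rw [Finset.mul_sum, Finset.sum_mul]
      refine (norm_sum_le_of_le s (fun j _ => aux_resolvent k e hk (μ j) ε hε (h _))).trans ?_
      simp [s]
    have h6 := h4.trans h5
    rw [inv_mul_le_iff₀ (by positivity)] at h6
    exact h6
  have lim : Filter.Tendsto (fun n : ℕ => 2 * (M / ((n : ℝ) + 1)) ^ 2 * (2 * ((n : ℝ) + 1) + 1))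
      Filter.atTop (nhds 0) := by
    have t := tendsto_one_div_add_atTop_nhds_zero_nat (𝕜 := ℝ)
    have t2 := ((t.const_mul (4 * M ^ 2)).add ((t.pow 2).const_mul (2 * M ^ 2)))
    simp only [mul_zero, ne_eq, OfNat.ofNat_ne_zero, not_false_eq_true, zero_pow, add_zero] at t2
    refine t2.congr (fun n => ?_)
    have : (n : ℝ) + 1 ≠ 0 := by positivity
    field_simp
    ring
  have h0 : ‖e‖ * ‖e‖ ≤ 0 := ge_of_tendsto' lim key
  have : ‖e‖ = 0 := by nlinarith [norm_nonneg e]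
  exact norm_eq_zero.1 this

theorem aux_comm_s11 {A : Type*} [CStarAlgebra A] [PartialOrder A] [StarOrderedRing A]
    (a : A) (ha : IsStrictlyPositive a)
    (h : ∀ x : A, 0 ≤ x → 0 ≤ a * x + x * a) (y : A) (hy : IsSelfAdjoint y) :
    a * y = y * a := by
  obtain ⟨s, hs⟩ := ha.isUnit_cfcSqrt
  have hss : (s : A) * s = a := by rw [hs]; exact CFC.sqrt_mul_sqrt_self a ha.nonneg
  have hsa : star (s : A) = s := by
    rw [hs]; exact (IsSelfAdjoint.of_nonneg (CFC.sqrt_nonneg a)).star_eq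
  set v : A := ((s⁻¹ : Aˣ) : A) with hv
  have sv : (s : A) * v = 1 := s.mul_inv
  have vs : v * (s : A) = 1 := s.inv_mul
  have hva : star v = v := by
    have : star v * s = 1 := by
      have := congrArg star sv
      rwa [star_mul, hsa, star_one] at this
    calc star v = star v * (s * v) := by rw [sv, mul_one]
      _ = v := by rw [← mul_assoc, this, one_mul]
  generalize (s : A) = s at *
  have hw : star (s * y * v) = v * y * s := by
    rw [star_mul, star_mul, hsa, hva, hy.star_eq, mul_assoc]
  have hz : s * y * v - v * y * s = 0 := by
    apply aux_zero (s * y * v + v * y * s)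
    · rw [IsSelfAdjoint, star_add, hw, ← hw, star_star, add_comm]
    intro μ
    set m : A := algebraMap ℝ A (μ / 2) with hm
    have hmm : algebraMap ℝ A μ = m + m := by rw [hm, ← map_add]; congr 1; ring
    have hcm : ∀ z : A, m * z = z * m := fun z => Algebra.commutes _ _
    have hmsa : IsSelfAdjoint m := by
      rw [hm]; exact IsSelfAdjoint.algebraMap A (IsSelfAdjoint.all _)
    have hx : 0 ≤ (y - m) ^ 2 := (hy.sub hmsa).sq_nonneg
    have h1 := star_left_conjugate_nonneg (h _ hx) v
    rw [hva] at h1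
    have e1 : s * (y - m) * v = s * y * v - m := by
      rw [mul_sub, sub_mul, ← hcm s, mul_assoc m, sv, mul_one]
    have e2 : v * (y - m) * s = v * y * s - m := by
      rw [mul_sub, sub_mul, ← hcm v, mul_assoc m, vs, mul_one]
    have e3 : v * (a * (y - m) ^ 2 + (y - m) ^ 2 * a) * v
        = (s * y * v - m) ^ 2 + (v * y * s - m) ^ 2 := by
      rw [← e1, ← e2, ← hss]
      generalize y - m = q
      calc v * (s * s * q ^ 2 + q ^ 2 * (s * s)) * v
          = (v * s) * s * q * q * v + v * q * q * s * (s * v) := by noncomm_ring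
        _ = s * q * (v * s) * q * v + v * q * (s * v) * q * s := by
            rw [vs, sv]; noncomm_ring
        _ = _ := by noncomm_ring
    rw [e3] at h1
    rw [star_sub, hw, ← hw, star_star, hw, hmm]
    have c1 := hcm (s * y * v)
    have c2 := hcm (v * y * s)
    generalize s * y * v = p at *
    generalize v * y * s = r at *
    rw [← sub_nonneg]
    have : (p + r - (m + m)) ^ 2 - (p - r) * (r - p)
        = ((p - m) ^ 2 + (r - m) ^ 2) + ((p - m) ^ 2 + (r - m) ^ 2) := by
      noncomm_ring
    rw [this]
    exact add_nonneg h1 h1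
  have hz' := sub_eq_zero.1 hz
  calc a * y = s * (s * y * v) * s := by
        rw [← hss]; simp only [mul_assoc, vs, mul_one]
    _ = s * (v * y * s) * s := by rw [hz']
    _ = (s * v) * y * (s * s) := by simp only [mul_assoc]
    _ = y * a := by rw [sv, hss, one_mul]

/-- (local Ogasawara) A positive invertible element `a` of a unital C*-algebra is central if
and only if `a ≤ b` implies `a² ≤ b²` for every positive invertible `b`. -/
theorem central_iff_sq_locally_monotone
    {A : Type*} [CStarAlgebra A] [PartialOrder A] [StarOrderedRing A]
    (a : A) (ha : IsSelfAdjoint a) (haspec : spectrum ℝ a ⊆ Set.Ioi (0 : ℝ)) :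
    (∀ b : A, a * b = b * a) ↔
      (∀ b : A, IsSelfAdjoint b → spectrum ℝ b ⊆ Set.Ioi (0 : ℝ) → a ≤ b →
        a ^ 2 ≤ b ^ 2) := by
  have ha0 : 0 ≤ a :=
    (StarOrderedRing.nonneg_iff_spectrum_nonneg (R := ℝ) a).2 (fun x hx => (haspec hx).le)
  have hau : IsUnit a := by
    rw [← spectrum.zero_notMem_iff ℝ]
    exact fun h0 => lt_irrefl (0 : ℝ) (haspec h0)
  have hap : IsStrictlyPositive a := ⟨ha0, hau⟩
  constructor
  · intro hc b hb _ hab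
    have hd : 0 ≤ b - a := sub_nonneg.2 hab
    have h1 : 0 ≤ a * (b - a) := Commute.mul_nonneg ha0 hd (hc _)
    have h2 : 0 ≤ (b - a) ^ 2 := (hb.sub ha).sq_nonneg
    rw [← sub_nonneg]
    have : b ^ 2 - a ^ 2 = (b - a) ^ 2 + (a * (b - a) + a * (b - a)) := by
      have := hc b
      have h3 : b ^ 2 - a ^ 2 = (b - a) ^ 2 + (a * (b - a) + (b - a) * a) := by noncomm_ring
      rw [h3, hc (b - a)]
    rw [this]
    exact add_nonneg h2 (add_nonneg h1 h1)
  · intro h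
    have hpos : ∀ x : A, 0 ≤ x → 0 ≤ a * x + x * a := by
      intro x hx
      have step : ∀ n : ℕ, 0 ≤ a * x + x * a + (1 / ((n : ℝ) + 1)) • x ^ 2 := by
        intro n
        set t : ℝ := 1 / ((n : ℝ) + 1) with ht
        have htp : 0 < t := by positivity
        have htx : 0 ≤ t • x := smul_nonneg htp.le hx
        have hb : IsStrictlyPositive (a + t • x) := hap.add_nonneg htx
        have := h (a + t • x) (IsSelfAdjoint.of_nonneg hb.nonneg) (fun r hr => by
          have r0 := spectrum_nonneg_of_nonneg hb.nonneg hr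
          refine lt_of_le_of_ne r0 ?_
          rintro rfl
          exact (spectrum.zero_notMem_iff ℝ).2 hb.isUnit hr) (le_add_of_nonneg_right htx)
        rw [← sub_nonneg] at this
        have e : (a + t • x) ^ 2 - a ^ 2 = t • (a * x + x * a + t • x ^ 2) := by
          simp only [sq, add_mul, mul_add, smul_add, smul_mul_assoc, mul_smul_comm]
          abel
        rw [e] at this
        have h2 := smul_nonneg (inv_nonneg.2 htp.le) this
        rwa [inv_smul_smul₀ htp.ne'] at h2
      have lim : Filter.Tendsto (fun n : ℕ => a * x + x * a + (1 / ((n : ℝ) + 1)) • x ^ 2)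
          Filter.atTop (nhds (a * x + x * a + (0 : ℝ) • x ^ 2)) :=
        tendsto_const_nhds.add ((tendsto_one_div_add_atTop_nhds_zero_nat (𝕜 := ℝ)).smul_const _)
      rw [zero_smul, add_zero] at lim
      exact ge_of_tendsto' lim step
    intro b
    have h1 := aux_comm_s11 a hap hpos (realPart b : A) (realPart b).2
    have h2 := aux_comm_s11 a hap hpos (imaginaryPart b : A) (imaginaryPart b).2
    rw [← realPart_add_I_smul_imaginaryPart b, mul_add, add_mul, h1, mul_smul_comm,
      smul_mul_assoc, h2]
end

section
/- Let p > 1 be a real number. A unital C*-algebra A is commutative if and only if for all positive invertible a, b ∈ A, a ≤ b implies a^p ≤ b^p. -/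
section aux

variable {A : Type*} [CStarAlgebra A] [PartialOrder A] [StarOrderedRing A]

lemma aux_pow_le (hc : ∀ a b : A, a * b = b * a) {a b : A} (ha : 0 ≤ a) (hab : a ≤ b) (n : ℕ) :
    a ^ n ≤ b ^ n := by
  have hb : 0 ≤ b := ha.trans hab
  induction n with
  | zero => simp
  | succ n ih =>
    have h1 : 0 ≤ b ^ n * (b - a) :=
      Commute.mul_nonneg (pow_nonneg_aux hb n) (sub_nonneg.2 hab) (hc _ _)
    have h2 : 0 ≤ (b ^ n - a ^ n) * a := Commute.mul_nonneg (sub_nonneg.2 ih) ha (hc _ _)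
    rw [← sub_nonneg]
    have : b ^ (n+1) - a ^ (n+1) = b ^ n * (b - a) + (b ^ n - a ^ n) * a := by
      rw [pow_succ, pow_succ]; noncomm_ring
    rw [this]
    exact add_nonneg h1 h2
where
  pow_nonneg_aux {b : A} (hb : 0 ≤ b) (n : ℕ) : 0 ≤ b ^ n := by
    rw [← CFC.rpow_natCast b n hb]; exact CFC.rpow_nonneg

lemma aux_forward_s13 (hc : ∀ a b : A, a * b = b * a) {p : ℝ} (hp : 1 < p) {a b : A}
    (ha : 0 ≤ a) (hab : a ≤ b) : a ^ p ≤ b ^ p := by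
  have hb : 0 ≤ b := ha.trans hab
  obtain ⟨n, hn⟩ := exists_nat_ge p
  have hn0 : (0:ℝ) < n := by linarith
  have h := CFC.rpow_le_rpow (p := p / n) ⟨by positivity, (div_le_one hn0).2 hn⟩
    (aux_pow_le hc ha hab n)
  have key : ∀ c : A, 0 ≤ c → (c ^ n) ^ (p / n) = c ^ p := by
    intro c hc
    rw [← CFC.rpow_natCast c n hc, CFC.rpow_rpow_of_exponent_nonneg c n (p/n) hn0.le (by positivity) hc]
    congr 1
    field_simp
  rwa [key a ha, key b hb] at h

lemma aux_sq {p : ℝ} (hp : 1 < p)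
    (h : ∀ a b : A, IsStrictlyPositive a → IsStrictlyPositive b → a ≤ b → a ^ p ≤ b ^ p)
    {a b : A} (ha : IsStrictlyPositive a) (hab : a ≤ b) : a * a ≤ b * b := by
  have hb : IsStrictlyPositive b := ha.of_le hab
  have hit : ∀ n : ℕ, a ^ (p ^ n) ≤ b ^ (p ^ n) := by
    intro n
    induction n with
    | zero => simpa [CFC.rpow_one a ha.nonneg, CFC.rpow_one b hb.nonneg] using hab
    | succ n ih =>
      have := h _ _ (IsStrictlyPositive.rpow a (p ^ n) ha) (IsStrictlyPositive.rpow b (p ^ n) hb) ih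
      rwa [CFC.rpow_rpow_of_exponent_nonneg a _ _ (by positivity) (by positivity) ha.nonneg,
        CFC.rpow_rpow_of_exponent_nonneg b _ _ (by positivity) (by positivity) hb.nonneg,
        ← pow_succ] at this
  obtain ⟨n, hn⟩ := pow_unbounded_of_one_lt 2 hp
  have hn0 : 0 < p ^ n := by positivity
  have h2 := CFC.rpow_le_rpow (p := 2 / p ^ n) ⟨by positivity, (div_le_one hn0).2 hn.le⟩ (hit n)
  have key : ∀ c : A, 0 ≤ c → (c ^ (p ^ n)) ^ (2 / p ^ n) = c * c := by
    intro c hc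
    rw [CFC.rpow_rpow_of_exponent_nonneg c _ _ hn0.le (by positivity) hc]
    have : p ^ n * (2 / p ^ n) = ((2:ℕ):ℝ) := by field_simp; norm_num
    rw [this, CFC.rpow_natCast c 2 hc, pow_two]
  rwa [key a ha.nonneg, key b hb.nonneg] at h2

lemma aux_jordan (h : ∀ a b : A, IsStrictlyPositive a → a ≤ b → a * a ≤ b * b)
    {x y : A} (hx : 0 ≤ x) (hy : 0 ≤ y) : 0 ≤ x * y + y * x := by
  have key : ∀ e : ℝ, 0 < e → 0 ≤ (x * y + y * x) + e • (y + y + y * y) := by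
    intro e he
    have h1 : IsStrictlyPositive (x + algebraMap ℝ A e) :=
      (isStrictlyPositive_algebraMap he).nonneg_add hx
    have h2 := h _ (x + algebraMap ℝ A e + e • y) h1 (le_add_of_nonneg_right (smul_nonneg he.le hy))
    rw [← sub_nonneg] at h2
    have h3 := smul_nonneg (inv_nonneg.2 he.le) h2
    have : e⁻¹ • ((x + algebraMap ℝ A e + e • y) * (x + algebraMap ℝ A e + e • y) -
        (x + algebraMap ℝ A e) * (x + algebraMap ℝ A e))
        = (x * y + y * x) + e • (y + y + y * y) := by
      rw [inv_smul_eq_iff₀ he.ne']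
      simp only [Algebra.algebraMap_eq_smul_one, add_mul, mul_add, smul_mul_assoc, mul_smul_comm,
        one_mul, mul_one, smul_add, smul_smul]
      abel
    rwa [this] at h3
  have ht : Filter.Tendsto (fun e : ℝ => (x * y + y * x) + e • (y + y + y * y))
      (nhdsWithin 0 (Set.Ioi 0)) (nhds (x * y + y * x)) := by
    have : Continuous (fun e : ℝ => (x * y + y * x) + e • (y + y + y * y)) := by fun_prop
    have := this.tendsto 0
    simp only [zero_smul, add_zero] at this
    exact this.mono_left nhdsWithin_le_nhds
  exact ge_of_tendsto ht (by filter_upwards [self_mem_nhdsWithin] with e he using key e he)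

/-- Ogasawara-type inequality with constant `l`. -/
def AuxP (A : Type*) [CStarAlgebra A] [PartialOrder A] (l : ℝ) : Prop :=
  ∀ a b : A, 0 ≤ a → 0 ≤ b →
    0 ≤ (a * b + b * a) * (a * b + b * a) + l • ((a * b - b * a) * (a * b - b * a))

lemma aux_skew {k : A} (hk : star k = -k) : 0 ≤ -(k * k) := by
  have := star_mul_self_nonneg k
  rwa [hk, neg_mul] at this

lemma aux_star_k {a b : A} (ha : 0 ≤ a) (hb : 0 ≤ b) :
    star (a * b - b * a) = -(a * b - b * a) := by
  simp [(IsSelfAdjoint.of_nonneg ha).star_eq, (IsSelfAdjoint.of_nonneg hb).star_eq]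

lemma auxP_one (hj : ∀ x y : A, 0 ≤ x → 0 ≤ y → 0 ≤ x * y + y * x) : AuxP A 1 := by
  intro a b ha hb
  have := hj a (b * a * b) ha (conjugate_nonneg_of_nonneg ha hb)
  have := add_nonneg this this
  convert this using 1
  rw [one_smul]
  noncomm_ring

lemma auxP_step (hj : ∀ x y : A, 0 ≤ x → 0 ≤ y → 0 ≤ x * y + y * x) {l : ℝ} (hl : 1 ≤ l)
    (hP : AuxP A l) : AuxP A (√(l ^ 2 + 2 * l - 1)) := by
  intro a b ha hb
  have h0 := hP a b ha hb
  have h1 := hP a (b * a * b) ha (conjugate_nonneg_of_nonneg ha hb)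
  have hs : 0 ≤ a * b + b * a := hj a b ha hb
  have hk := aux_star_k ha hb
  have e1 : (4:ℝ) • (a * (b * a * b) + (b * a * b) * a) = (2:ℝ) •
     ((a * b + b * a) * (a * b + b * a) + (a * b - b * a) * (a * b - b * a)) := by
    simp only [ofNat_smul_eq_nsmul]
    noncomm_ring
  have e2 : (4:ℝ) • (a * (b * a * b) - (b * a * b) * a) = (2:ℝ) •
     ((a * b + b * a) * (a * b - b * a) + (a * b - b * a) * (a * b + b * a)) := by
    simp only [ofNat_smul_eq_nsmul]
    noncomm_ring
  have e1' : a * (b * a * b) + (b * a * b) * a = (1/2:ℝ) •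
     ((a * b + b * a) * (a * b + b * a) + (a * b - b * a) * (a * b - b * a)) := by
    rw [← inv_smul_eq_iff₀ (by norm_num)] at e1
    rw [← inv_smul_eq_iff₀ (a := (1/2:ℝ)) (by norm_num), ← e1, smul_smul]
    norm_num
  have e2' : a * (b * a * b) - (b * a * b) * a = (1/2:ℝ) •
     ((a * b + b * a) * (a * b - b * a) + (a * b - b * a) * (a * b + b * a)) := by
    rw [← inv_smul_eq_iff₀ (by norm_num)] at e2
    rw [← inv_smul_eq_iff₀ (a := (1/2:ℝ)) (by norm_num), ← e2, smul_smul]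
    norm_num
  rw [e1', e2'] at h1
  clear e1 e2 e1' e2'
  generalize a * b + b * a = s at *
  generalize a * b - b * a = k at *
  have hk2 := aux_skew hk
  have hss : star s = s := (IsSelfAdjoint.of_nonneg hs).star_eq
  -- (s²+k²)² + l (sk+ks)² ≥ 0
  have h1' : 0 ≤ (s * s + k * k) * (s * s + k * k) + l • ((s * k + k * s) * (s * k + k * s)) := by
    have := smul_nonneg (show (0:ℝ) ≤ 4 by norm_num) h1
    convert this using 1
    generalize s * s + k * k = u
    generalize s * k + k * s = v
    rw [smul_mul_smul_comm, smul_mul_smul_comm, smul_add, smul_smul, smul_smul, smul_smul,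
      show (4:ℝ) * (1 / 2 * (1 / 2)) = 1 by norm_num,
      show (4:ℝ) * l * (1 / 2 * (1 / 2)) = l by ring, one_smul]
  have h2 := hj _ _ h0 hk2
  have h3 : 0 ≤ -(k * s * k) := by
    have := star_left_conjugate_nonneg hs k
    rwa [hk, neg_mul, neg_mul] at this
  have h4 := hj _ _ hs h3
  have h5 := star_left_conjugate_nonneg hk2 s
  rw [hss] at h5
  have h6 := star_left_conjugate_nonneg h0 k
  rw [hk] at h6
  set m := l ^ 2 + 2 * l - 1 with hm
  have hm0 : 0 ≤ m := by nlinarith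
  have h7 : 0 ≤ (s * s) * (s * s) - m • ((k * k) * (k * k)) := by
    have := add_nonneg h1' (add_nonneg h2 (smul_nonneg (show 0 ≤ l by linarith)
      (add_nonneg h4 (add_nonneg h5 h6))))
    convert this using 1
    rw [hm]
    simp only [add_mul, mul_add, sub_eq_add_neg, smul_add, smul_mul_assoc, mul_smul_comm, neg_mul,
      mul_neg, smul_neg, smul_smul, mul_assoc, add_smul, neg_smul, one_smul, pow_two, two_mul,
      neg_add, neg_neg]
    abel
  have h8 : (√m • -(k * k)) * (√m • -(k * k)) ≤ (s * s) * (s * s) := by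
    rw [smul_mul_smul_comm, Real.mul_self_sqrt hm0, neg_mul_neg]
    exact sub_nonneg.1 h7
  have h9 := CFC.sqrt_le_sqrt _ _ h8
  have hs2 : 0 ≤ s * s := by simpa [hss] using star_mul_self_nonneg s
  rw [CFC.sqrt_mul_self _ (smul_nonneg (Real.sqrt_nonneg m) hk2), CFC.sqrt_mul_self _ hs2,
    ← sub_nonneg, smul_neg, sub_neg_eq_add] at h9
  exact h9

lemma auxP_all (hj : ∀ x y : A, 0 ≤ x → 0 ≤ y → 0 ≤ x * y + y * x) (n : ℕ) :
    ∃ l : ℝ, 1 ≤ l ∧ (n : ℝ) ≤ l ^ 2 ∧ AuxP A l := by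
  induction n with
  | zero => exact ⟨1, le_rfl, by norm_num, auxP_one hj⟩
  | succ n ih =>
    obtain ⟨l, h1, h2, h3⟩ := ih
    refine ⟨_, ?_, ?_, auxP_step hj h1 h3⟩
    · rw [Real.one_le_sqrt]; nlinarith
    · rw [Real.sq_sqrt (by nlinarith)]; push_cast; nlinarith

lemma aux_comm_nonneg (hj : ∀ x y : A, 0 ≤ x → 0 ≤ y → 0 ≤ x * y + y * x)
    {a b : A} (ha : 0 ≤ a) (hb : 0 ≤ b) : a * b = b * a := by
  rw [← sub_eq_zero]
  have hk := aux_star_k ha hb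
  have hk2 := aux_skew hk
  by_contra hne
  have hpos : 0 < ‖-((a * b - b * a) * (a * b - b * a))‖ := by
    have : -((a * b - b * a) * (a * b - b * a)) = star (a * b - b * a) * (a * b - b * a) := by
      rw [hk, neg_mul]
    rw [this, CStarRing.norm_star_mul_self]
    have := norm_pos_iff.2 hne
    positivity
  set N := ‖-((a * b - b * a) * (a * b - b * a))‖ with hN
  obtain ⟨n, hn⟩ := exists_nat_gt ((‖(a * b + b * a) * (a * b + b * a)‖ / N) ^ 2)
  obtain ⟨l, h1, h2, h3⟩ := auxP_all hj n
  have h4 := h3 a b ha hb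
  have h5 : l • -((a * b - b * a) * (a * b - b * a)) ≤ (a * b + b * a) * (a * b + b * a) := by
    rwa [← sub_nonneg, smul_neg, sub_neg_eq_add]
  have h6 := CStarAlgebra.norm_le_norm_of_nonneg_of_le (smul_nonneg (by linarith) hk2) h5
  rw [norm_smul, Real.norm_of_nonneg (by linarith), ← hN, ← le_div_iff₀ hpos] at h6
  have := pow_le_pow_left₀ (by linarith) h6 2
  linarith

lemma aux_comm_s13 (hj : ∀ x y : A, 0 ≤ x → 0 ≤ y → 0 ≤ x * y + y * x) (a b : A) :
    a * b = b * a := by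
  have ha : a ∈ Submodule.span ℂ {x : A | 0 ≤ x} := by rw [CStarAlgebra.span_nonneg]; trivial
  have hb : b ∈ Submodule.span ℂ {x : A | 0 ≤ x} := by rw [CStarAlgebra.span_nonneg]; trivial
  induction ha using Submodule.span_induction with
  | zero => simp
  | add x y _ _ h1 h2 => rw [add_mul, mul_add, h1, h2]
  | smul c x _ h => rw [smul_mul_assoc, mul_smul_comm, h]
  | mem x hx =>
    induction hb using Submodule.span_induction with
    | zero => simp
    | add y z _ _ h1 h2 => rw [add_mul, mul_add, h1, h2]
    | smul c y _ h => rw [smul_mul_assoc, mul_smul_comm, h]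
    | mem y hy => exact aux_comm_nonneg hj hx hy

end aux

/-- (Pedersen) Let `p > 1`. A unital C*-algebra is commutative if and only if the `p`-th power
function is monotone on the positive invertible elements. -/
theorem commutative_iff_rpow_monotone
    {A : Type*} [CStarAlgebra A] [PartialOrder A] [StarOrderedRing A]
    (p : ℝ) (hp : 1 < p) :
    (∀ a b : A, a * b = b * a) ↔
      (∀ a b : A, IsSelfAdjoint a → IsSelfAdjoint b →
        spectrum ℝ a ⊆ Set.Ioi (0 : ℝ) → spectrum ℝ b ⊆ Set.Ioi (0 : ℝ) → a ≤ b →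
        cfc (fun t : ℝ => t ^ p) a ≤ cfc (fun t : ℝ => t ^ p) b) := by
  constructor
  · intro hc a b ha hb hsa hsb hab
    have ha' := (StarOrderedRing.isStrictlyPositive_iff_spectrum_pos (R := ℝ) a ha).2 hsa
    have hb' := (StarOrderedRing.isStrictlyPositive_iff_spectrum_pos (R := ℝ) b hb).2 hsb
    rw [← CFC.rpow_eq_cfc_real (ha := ha'.nonneg), ← CFC.rpow_eq_cfc_real (ha := hb'.nonneg)]
    exact aux_forward_s13 hc hp ha'.nonneg hab
  · intro h
    have h' : ∀ a b : A, IsStrictlyPositive a → IsStrictlyPositive b → a ≤ b →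
        a ^ p ≤ b ^ p := by
      intro a b ha hb hab
      rw [CFC.rpow_eq_cfc_real (ha := ha.nonneg), CFC.rpow_eq_cfc_real (ha := hb.nonneg)]
      have ha1 := IsSelfAdjoint.of_nonneg ha.nonneg
      have hb1 := IsSelfAdjoint.of_nonneg hb.nonneg
      exact h a b ha1 hb1
        ((StarOrderedRing.isStrictlyPositive_iff_spectrum_pos (R := ℝ) a ha1).1 ha)
        ((StarOrderedRing.isStrictlyPositive_iff_spectrum_pos (R := ℝ) b hb1).1 hb) hab
    exact aux_comm_s13 fun x y hx hy =>
      aux_jordan (fun a b ha hab => aux_sq hp h' ha hab) hx hy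
end

section
/- A unital C*-algebra A is commutative if and only if for all positive invertible a, b ∈ A, a ≤ b implies a² ≤ b². -/
section OgasawaraAux
open Filter Topology

variable {A : Type*} [CStarAlgebra A] [PartialOrder A] [StarOrderedRing A]

lemma oga_unscale {s : ℝ} (hs : 0 < s) {x : A} (h : 0 ≤ s • x) : 0 ≤ x := by
  have := smul_nonneg (inv_nonneg.2 hs.le) h
  rwa [smul_smul, inv_mul_cancel₀ hs.ne', one_smul] at this

lemma oga_limit {x y : A} (h : ∀ s : ℝ, 0 < s → 0 ≤ x + s • y) : 0 ≤ x := by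
  have hc : Tendsto (fun s : ℝ => x + s • y) (𝓝[>] 0) (𝓝 x) := by
    have : Continuous (fun s : ℝ => x + s • y) := by fun_prop
    have h2 := this.tendsto 0
    simp only [zero_smul, add_zero] at h2
    exact h2.mono_left nhdsWithin_le_nhds
  exact ge_of_tendsto hc (by filter_upwards [self_mem_nhdsWithin] with s hs using h s hs)

lemma oga_anti (H : ∀ a b : A, IsSelfAdjoint a → IsSelfAdjoint b →
        spectrum ℝ a ⊆ Set.Ioi (0 : ℝ) → spectrum ℝ b ⊆ Set.Ioi (0 : ℝ) → a ≤ b →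
        a ^ 2 ≤ b ^ 2) {a b : A} (ha : 0 ≤ a) (hb : 0 ≤ b) : 0 ≤ a * b + b * a := by
  refine oga_limit (y := (2 : ℝ) • b + b * b) fun s hs => oga_unscale hs ?_
  have h1 : IsStrictlyPositive (a + s • (1 : A)) :=
    IsStrictlyPositive.nonneg_add ha (isStrictlyPositive_one.smul hs)
  have h2 : IsStrictlyPositive (a + s • (1 : A) + s • b) :=
    h1.add_nonneg (smul_nonneg hs.le hb)
  have h3 := H _ _ h1.isSelfAdjoint h2.isSelfAdjoint (fun x hx => h1.spectrum_pos hx)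
    (fun x hx => h2.spectrum_pos hx) (le_add_of_nonneg_right (smul_nonneg hs.le hb))
  rw [← sub_nonneg] at h3
  convert h3 using 1
  simp only [pow_two, mul_add, add_mul, smul_add, smul_mul_assoc, mul_smul_comm, one_mul, mul_one,
    smul_smul]
  module

lemma oga_step (H : ∀ a b : A, 0 ≤ a → 0 ≤ b → 0 ≤ a * b + b * a) (n : ℕ) :
    ∀ a b : A, 0 ≤ a → 0 ≤ b →
      (1 + n / 3 : ℝ) • (-((a * b - b * a) * (a * b - b * a))) ≤
        (a * b + b * a) * (a * b + b * a) := by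
  induction n with
  | zero =>
    intro a b ha hb
    have hbab : 0 ≤ b * a * b := (IsSelfAdjoint.of_nonneg hb).conjugate_nonneg ha
    have h := smul_nonneg (zero_le_two (α := ℝ)) (H a (b * a * b) ha hbab)
    rw [← sub_nonneg]
    convert h using 1
    simp only [Nat.cast_zero, zero_div, add_zero, one_smul, two_smul]
    noncomm_ring
  | succ n ih =>
    intro a b ha hb
    have hbab : 0 ≤ b * a * b := (IsSelfAdjoint.of_nonneg hb).conjugate_nonneg ha
    have h1 := ih a b ha hb
    have h2 := ih a (b * a * b) ha hbab
    have sa : star a = a := (IsSelfAdjoint.of_nonneg ha).star_eq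
    have sb : star b = b := (IsSelfAdjoint.of_nonneg hb).star_eq
    have hc := H a b ha hb
    have e1 : (2 : ℝ) • (a * (b * a * b) + (b * a * b) * a) =
        (a * b + b * a) * (a * b + b * a) + (a * b - b * a) * (a * b - b * a) := by
      rw [two_smul]; noncomm_ring
    have e2 : (2 : ℝ) • (a * (b * a * b) - (b * a * b) * a) =
        (a * b + b * a) * (a * b - b * a) + (a * b - b * a) * (a * b + b * a) := by
      rw [two_smul]; noncomm_ring
    have he : star (a * b - b * a) = -(a * b - b * a) := by simp [sa, sb]
    generalize a * (b * a * b) + (b * a * b) * a = c' at *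
    generalize a * (b * a * b) - (b * a * b) * a = e' at *
    generalize a * b + b * a = c at *
    generalize a * b - b * a = e at *
    have sc : star c = c := (IsSelfAdjoint.of_nonneg hc).star_eq
    set l : ℝ := 1 + n / 3 with hl
    have hl1 : 1 ≤ l := by rw [hl]; exact le_add_of_nonneg_right (by positivity)
    have h3 : l • (-((c * e + e * c) * (c * e + e * c))) ≤ (c * c + e * e) * (c * c + e * e) := by
      rw [← e1, ← e2]
      have := smul_le_smul_of_nonneg_left h2 (show (0 : ℝ) ≤ 4 by norm_num)
      convert this using 1
      · simp only [smul_mul_assoc, mul_smul_comm, smul_neg, smul_smul]; module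
      · simp only [smul_mul_assoc, mul_smul_comm, smul_smul]; module
    have hD : 0 ≤ -(e * e) := by simpa [he] using star_mul_self_nonneg e
    have hcDc : 0 ≤ c * (-(e * e)) * c := (IsSelfAdjoint.of_nonneg hc).conjugate_nonneg hD
    have hece : 0 ≤ -(e * c * e) := by simpa [he] using star_left_conjugate_nonneg hc e
    have h4 := H _ _ hc hece
    have h5 := star_left_conjugate_nonneg (sub_nonneg.2 h1) e
    rw [he] at h5
    have h6 := H _ _ hD (sub_nonneg.2 h1)
    have hl0 : 0 ≤ l := by linarith
    have hDD : 0 ≤ e * e * (e * e) := by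
      have := (IsSelfAdjoint.of_nonneg hD).mul_self_nonneg
      simpa using this
    have hm : 0 ≤ l ^ 2 + 2 * l - 1 - (l + 1 / 3) ^ 2 := by nlinarith
    have h7 : ((l + 1 / 3) • (-(e * e))) * ((l + 1 / 3) • (-(e * e))) ≤ (c * c) * (c * c) := by
      rw [← sub_nonneg]
      have k := add_nonneg (add_nonneg (add_nonneg (add_nonneg (sub_nonneg.2 h3)
        (smul_nonneg hl0 (add_nonneg h4 hcDc))) (smul_nonneg hl0 h5)) h6) (smul_nonneg hm hDD)
      convert k using 1
      simp only [mul_add, add_mul, mul_sub, sub_mul, smul_add, smul_sub, smul_mul_assoc,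
        mul_smul_comm, smul_smul, neg_mul, mul_neg, smul_neg, neg_neg, ← mul_assoc]
      module
    have hcc : 0 ≤ c * c := (IsSelfAdjoint.of_nonneg hc).mul_self_nonneg
    have h8 := CFC.sqrt_le_sqrt _ _ h7
    rw [CFC.sqrt_mul_self _ (smul_nonneg (by linarith) hD), CFC.sqrt_mul_self _ hcc] at h8
    convert h8 using 2
    push_cast
    rw [hl]; ring

lemma oga_comm (H : ∀ a b : A, 0 ≤ a → 0 ≤ b → 0 ≤ a * b + b * a) {a b : A}
    (ha : 0 ≤ a) (hb : 0 ≤ b) : a * b = b * a := by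
  have sa : star a = a := (IsSelfAdjoint.of_nonneg ha).star_eq
  have sb : star b = b := (IsSelfAdjoint.of_nonneg hb).star_eq
  have he : star (a * b - b * a) = -(a * b - b * a) := by simp [sa, sb]
  have key := fun n => oga_step H n a b ha hb
  have hc := H a b ha hb
  rw [← sub_eq_zero]
  generalize a * b + b * a = c at *
  generalize a * b - b * a = e at *
  have hD : 0 ≤ -(e * e) := by simpa [he] using star_mul_self_nonneg e
  have h0 : 0 ≤ -(-(e * e)) := by
    refine oga_limit (y := c * c) fun s hs => ?_
    obtain ⟨n, hn⟩ := exists_nat_gt (3 / s)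
    have hp : (0 : ℝ) < 1 + n / 3 := by positivity
    have h1 : 1 ≤ s * (1 + n / 3) := by
      rw [div_lt_iff₀ hs] at hn
      nlinarith
    have h2 := smul_le_smul_of_nonneg_left (key n) hs.le
    rw [← sub_nonneg] at h2
    have h3 := add_nonneg h2 (smul_nonneg (sub_nonneg.2 h1) hD)
    convert h3 using 1
    module
  have h1 : star e * e = 0 := by
    rw [he, neg_mul]
    exact le_antisymm (neg_nonneg.1 h0) hD
  exact CStarRing.star_mul_self_eq_zero_iff e |>.1 h1

end OgasawaraAux

/-- (Ogasawara) A unital C*-algebra is commutative if and only if the square function is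
monotone on the positive invertible elements. -/
theorem commutative_iff_sq_monotone
    {A : Type*} [CStarAlgebra A] [PartialOrder A] [StarOrderedRing A] :
    (∀ a b : A, a * b = b * a) ↔
      (∀ a b : A, IsSelfAdjoint a → IsSelfAdjoint b →
        spectrum ℝ a ⊆ Set.Ioi (0 : ℝ) → spectrum ℝ b ⊆ Set.Ioi (0 : ℝ) → a ≤ b →
        a ^ 2 ≤ b ^ 2) := by
  constructor
  · intro h a b ha hb sa sb hab
    have pa : 0 ≤ a :=
      (CStarAlgebra.isStrictlyPositive_iff_isSelfAdjoint_and_spectrum_pos.2 ⟨ha, sa⟩).nonneg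
    have pb : 0 ≤ b := pa.trans hab
    rw [← sub_nonneg]
    have := Commute.mul_nonneg (sub_nonneg.2 hab) (add_nonneg pa pb) (h _ _)
    convert this using 1
    rw [mul_add, sub_mul, sub_mul, h a b]
    noncomm_ring
  · intro H
    have hpos : ∀ a b : A, 0 ≤ a → 0 ≤ b → a * b = b * a := fun a b ha hb =>
      oga_comm (fun a b ha hb => oga_anti H ha hb) ha hb
    have mem : ∀ x : A, x ∈ Submodule.span ℂ {a : A | 0 ≤ a} := fun x => by
      rw [CStarAlgebra.span_nonneg]; trivial
    intro a b
    induction mem a using Submodule.span_induction with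
    | zero => simp
    | add x y _ _ hx hy => rw [add_mul, mul_add, hx, hy]
    | smul r x _ hx => rw [smul_mul_assoc, mul_smul_comm, hx]
    | mem x hx =>
      induction mem b using Submodule.span_induction with
      | zero => simp
      | add y z _ _ hy hz => rw [add_mul, mul_add, hy, hz]
      | smul r y _ hy => rw [smul_mul_assoc, mul_smul_comm, hy]
      | mem y hy => exact hpos x y hx hy
end
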